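/- For each z ∈ I_ℤ, the map φ ↦ (P_EGᴼ(φ), Q_EGᴼ(φ)) is a bijection from Incr_∞(R_inv^+(z)) to the set of pairs (P, Q) of shifted tableaux of the same shape in which P is increasing with no primed entries on the main diagonal and row(P) ∈ R_inv^+(z), and Q is semistandard. -/

import Mathlib

/-! ## Primed letters: the alphabet `ℤ ⊔ ℤ'`, with `i' = i - 1/2`.
A letter is encoded by its "ceiling" together with a flag recording whether it is primed. -/

structure Letter where
  ceil : ℤ
  primed : Bool
deriving DecidableEq, Repr

instance : Inhabited Letter := ⟨⟨0, false⟩⟩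

/-- The order `⋯ < 1' < 1 < 2' < 2 < ⋯`. -/
instance : LinearOrder Letter :=
  LinearOrder.lift' (fun x : Letter => toLex (x.ceil, !x.primed))
    (fun a b h => by
      have h' : (a.ceil, !a.primed) = (b.ceil, !b.primed) := toLex.injective h
      obtain ⟨ac, ap⟩ := a
      obtain ⟨bc, bp⟩ := b
      simp only [Prod.mk.injEq] at h'
      obtain ⟨h1, h2⟩ := h'
      cases ap <;> cases bp <;> simp_all)

/-- A primed word. -/
abbrev PWord := List Letter

def Letter.unprime (x : Letter) : Letter := ⟨x.ceil, false⟩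

def Letter.succL (x : Letter) : Letter := ⟨x.ceil + 1, x.primed⟩

/-- `unprime` of a primed word: replace each letter `x` by `⌈x⌉`. -/
def unprimeWord (a : PWord) : List ℤ := a.map Letter.ceil

/-- `unprime` of a primed word, as a primed word with no primes. -/
def unprimeP (a : PWord) : PWord := a.map Letter.unprime

/-! ## Involution words -/

/-- The simple transposition `s_i = (i, i+1)` of `ℤ`. -/
def sPerm (i : ℤ) : Equiv.Perm ℤ := Equiv.swap i (i + 1)

/-- The Demazure product `s_{w_1} ∘ s_{w_2} ∘ ⋯ ∘ s_{w_k}` of a word, computed by the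
defining recursion `σ ∘ s_i = σ·s_i` if `σ(i) < σ(i+1)` and `σ ∘ s_i = σ` otherwise. -/
def heckeProd (w : List ℤ) : Equiv.Perm ℤ :=
  w.foldl (fun σ i => if σ i < σ (i + 1) then σ * sPerm i else σ) 1

/-- `s_{a_n} ∘ ⋯ ∘ s_{a_2} ∘ s_{a_1} ∘ s_{a_2} ∘ ⋯ ∘ s_{a_n}` for `a = a_1 a_2 ⋯ a_n`. -/
def invHecke (a : List ℤ) : Equiv.Perm ℤ := heckeProd (a.reverse ++ a.tail)

/-- Membership in `I_ℤ`: a finitely supported involution of `ℤ`. -/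
def IZ (z : Equiv.Perm ℤ) : Prop := {x : ℤ | z x ≠ x}.Finite ∧ z * z = 1

/-- The set of involution words of `z`. -/
def Rinv (z : Equiv.Perm ℤ) : Set (List ℤ) :=
  {a | invHecke a = z ∧ ∀ b : List ℤ, invHecke b = z → a.length ≤ b.length}

/-- 0-based index `k` is a commutation in the word `a` (this corresponds to the 1-based
index `k+1`): `a_{k+1}` and `a_{k+1} + 1` are both fixed points of
`s_{a_k} ∘ ⋯ ∘ s_{a_1} ∘ ⋯ ∘ s_{a_k}`. -/
def IsCommutation (a : List ℤ) (k : ℕ) : Prop :=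
  ∃ x, a[k]? = some x ∧ invHecke (a.take k) x = x ∧ invHecke (a.take k) (x + 1) = x + 1

/-- The set of primed involution words of `z`. -/
def RinvPlus (z : Equiv.Perm ℤ) : Set PWord :=
  {a | unprimeWord a ∈ Rinv z ∧
     ∀ (k : ℕ) (x : Letter), a[k]? = some x → x.primed = true →
       IsCommutation (unprimeWord a) k}

/-! ## Shifted tableaux.
A shifted tableau is recorded as its list of rows, from the first (bottom) row upward;
the entry at 0-based index `k` of 0-based row `r` occupies the box in row `r+1` and
column `r+1+k` of the shifted diagram. -/

abbrev STab := List (List Letter)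

/-- A strict partition, recorded as its (strictly decreasing) list of positive parts. -/
def IsStrictPartition (sh : List ℕ) : Prop :=
  List.Chain' (fun a b => b < a) sh ∧ ∀ m ∈ sh, 0 < m

def shapeOf {α : Type*} (T : List (List α)) : List ℕ := T.map List.length

/-- The rows form the shifted diagram of a strict partition. -/
def IsShifted {α : Type*} (T : List (List α)) : Prop := IsStrictPartition (shapeOf T)

/-- The entry of `T` in (0-based) row `r` and column `c` of the shifted diagram. -/
def entryG? {α : Type*} (T : List (List α)) (r c : ℕ) : Option α :=
  if r ≤ c then (T[r]?).bind (fun row => row[c - r]?) else none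

def entry? (T : STab) (r c : ℕ) : Option Letter := entryG? T r c

def setRowG {α : Type*} (T : List (List α)) (r : ℕ) (row : List α) : List (List α) :=
  if r < T.length then T.set r row else T ++ [row]

def setEntryG {α : Type*} (T : List (List α)) (r c : ℕ) (x : α) : List (List α) :=
  T.set r ((T.getD r []).set (c - r) x)

def numCols {α : Type*} (T : List (List α)) : ℕ := (T.getD 0 []).length

/-- Row reading word: rows left to right, starting with the last (top) row. -/
def rowWord (T : STab) : PWord := T.reverse.flatten

/-- Column reading word: columns top to bottom, starting with the first column. -/
def colWord (T : STab) : PWord :=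
  (List.range (numCols T)).flatMap (fun c =>
    ((List.range (c + 1)).reverse).filterMap (fun r => entry? T r c))

def unprimeT (T : STab) : STab := T.map (List.map Letter.unprime)

/-- Remove the primes from all main-diagonal entries. -/
def unprimeDiagT (T : STab) : STab :=
  T.map (fun row =>
    match row with
    | [] => []
    | x :: rest => Letter.unprime x :: rest)

/-- Rows and columns are strictly increasing. -/
def IsIncreasing (T : STab) : Prop :=
  (∀ r c x y, entry? T r c = some x → entry? T r (c + 1) = some y → x < y) ∧
  (∀ r c x y, entry? T r c = some x → entry? T (r + 1) c = some y → x < y)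

/-- No primed entries on the main diagonal. -/
def NoDiagPrimes (T : STab) : Prop :=
  ∀ r x, entry? T r r = some x → x.primed = false

/-- Entries positive, rows and columns weakly increasing, no primed entry repeated
in a row and no unprimed entry repeated in a column. -/
def IsSemistandard (T : STab) : Prop :=
  (∀ x ∈ T.flatten, 0 < x.ceil) ∧
  (∀ r c x y, entry? T r c = some x → entry? T r (c + 1) = some y → x ≤ y) ∧
  (∀ r c x y, entry? T r c = some x → entry? T (r + 1) c = some y → x ≤ y) ∧
  (∀ r c c' x, c < c' → entry? T r c = some x → entry? T r c' = some x →
    x.primed = false) ∧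
  (∀ r r' c x, r < r' → entry? T r c = some x → entry? T r' c = some x →
    x.primed = true)

/-- Increasing, with exactly one of `i` or `i'` as an entry for each `i = 1, …, n`,
where `n` is the number of boxes. -/
def IsStandard (T : STab) : Prop :=
  IsIncreasing T ∧
  ∀ i : ℤ, 1 ≤ i → i ≤ (T.flatten.length : ℤ) →
    T.flatten.countP (fun x => decide (x.ceil = i)) = 1
/-! ## Orthogonal Edelman–Greene insertion -/

/-- "Switching the primes" of a pair: reverse the primes on both letters if exactly one
of them is unprimed, and leave them unchanged otherwise. -/
def switchPrimes (x y : Letter) : Letter × Letter :=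
  if x.primed = y.primed then (x, y)
  else (⟨x.ceil, !x.primed⟩, ⟨y.ceil, !y.primed⟩)

/-- Column-insertion stage of orthogonal Edelman–Greene insertion:
insert letter `w` into column `c` of `T` (then continue into later columns). -/
def egCol : ℕ → STab → ℕ → Letter → STab × Bool
  | 0, T, _, _ => (T, true)
  | fuel + 1, T, c, w =>
    let occ := (List.range (c + 1)).filterMap (fun r => (entry? T r c).map (fun x => (r, x)))
    match occ.findIdx? (fun p => decide (w.ceil < p.2.ceil)) with
    | none =>
        -- place `w` in the first empty box of the column
        let r := occ.length
        let w' := if r = c ∧ w.primed then Letter.unprime w else w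
        (setRowG T r ((T.getD r []) ++ [w']), if r = c then w.primed else true)
    | some kM =>
        let km := (occ.findIdx? (fun p => decide (w.ceil ≤ p.2.ceil))).getD kM
        let im := (occ.getD km (0, default)).1
        let m := (occ.getD km (0, default)).2
        if km = kM then
          if im = c then
            -- m = M on the main diagonal
            egCol fuel (setEntryG T im c (Letter.unprime w)) (c + 1) ⟨m.ceil, w.primed⟩
          else
            -- m = M off the main diagonal
            egCol fuel (setEntryG T im c w) (c + 1) m
        else
          -- m < M : switch the primes on m and M, insert w+1 into the next column
          let iM := (occ.getD kM (0, default)).1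
          let M := (occ.getD kM (0, default)).2
          let p := switchPrimes m M
          egCol fuel (setEntryG (setEntryG T im c p.1) iM c p.2) (c + 1) (Letter.succL w)

/-- Row-insertion stage of orthogonal Edelman–Greene insertion:
insert letter `w` into row `r` of `T`. -/
def egRow : ℕ → STab → ℕ → Letter → STab × Bool
  | 0, T, _, _ => (T, true)
  | fuel + 1, T, r, w =>
    let row := T.getD r []
    match row.findIdx? (fun x => decide (w.ceil < x.ceil)) with
    | none =>
        if row.isEmpty ∧ w.primed then (setRowG T r [Letter.unprime w], true)
        else (setRowG T r (row ++ [w]), false)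
    | some kM =>
        let km := (row.findIdx? (fun x => decide (w.ceil ≤ x.ceil))).getD kM
        let m := row.getD km default
        if km = kM then
          if km = 0 then
            -- m = M on the main diagonal
            egCol fuel (setRowG T r (row.set 0 (Letter.unprime w))) (r + 1)
              ⟨m.ceil, w.primed⟩
          else
            -- m = M off the main diagonal
            egRow fuel (setRowG T r (row.set km w)) (r + 1) m
        else
          -- m < M : switch primes; insert w+1 into the next column (if m is on the
          -- main diagonal) or the next row (otherwise)
          let M := row.getD kM default
          let p := switchPrimes m M
          let row' := (row.set km p.1).set kM p.2
          if km = 0 then egCol fuel (setRowG T r row') (r + 1) (Letter.succL w)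
          else egRow fuel (setRowG T r row') (r + 1) (Letter.succL w)

/-- `T ←ᴼ u` together with the flag recording whether the insertion ended in
column insertion. -/
def egInsert (T : STab) (u : Letter) : STab × Bool :=
  egRow (T.flatten.length + T.length + 2) T 0 u

/-- The orthogonal Edelman–Greene insertion tableau `P_EGᴼ(a)`. -/
def PEG (a : PWord) : STab := a.foldl (fun T u => (egInsert T u).1) []

/-- Add the recording letter `x` to `Q` in the unique box of `Pnew` not in `Pold`. -/
def addBox (Q Pold Pnew : STab) (x : Letter) : STab :=
  match (List.range Pnew.length).find?
      (fun r => decide ((Pold.getD r []).length ≠ (Pnew.getD r []).length)) with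
  | some r => setRowG Q r ((Q.getD r []) ++ [x])
  | none => Q

def QEGaux : STab → STab → ℕ → PWord → STab
  | _, Q, _, [] => Q
  | P, Q, n, u :: rest =>
      let res := egInsert P u
      QEGaux res.1 (addBox Q P res.1 ⟨(n : ℤ), res.2⟩) (n + 1) rest

/-- The orthogonal Edelman–Greene recording tableau `Q_EGᴼ(a)`. -/
def QEG (a : PWord) : STab := QEGaux [] [] 1 a

/-! ## Orthogonal Coxeter–Knuth operators -/

def ock1 (x : Letter) : Letter := ⟨x.ceil, !x.primed⟩

def ock2 (x y : Letter) : Letter × Letter := (⟨y.ceil, x.primed⟩, ⟨x.ceil, y.primed⟩)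

def ock3 (x y z : Letter) : Letter × Letter × Letter :=
  if x.ceil = z.ceil ∧ (x.ceil - y.ceil = 1 ∨ y.ceil - x.ceil = 1) then
    if x.primed = false ∧ y.primed = false ∧ z.primed = false then
      -- XYX ↔ YXY
      (⟨y.ceil, false⟩, ⟨x.ceil, false⟩, ⟨y.ceil, false⟩)
    else if x.primed = true ∧ y.primed = false ∧ z.primed = false then
      -- X'YX ↦ YXY'
      (⟨y.ceil, false⟩, ⟨x.ceil, false⟩, ⟨y.ceil, true⟩)
    else if x.primed = false ∧ y.primed = false ∧ z.primed = true then
      -- YXY' ↦ X'YX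
      (⟨y.ceil, true⟩, ⟨x.ceil, false⟩, ⟨y.ceil, false⟩)
    else (x, y, z)
  else if (x.ceil < z.ceil ∧ z.ceil < y.ceil) ∨ (y.ceil < z.ceil ∧ z.ceil < x.ceil) then
    -- ACB ↔ CAB
    (y, x, z)
  else if (y.ceil < x.ceil ∧ x.ceil < z.ceil) ∨ (z.ceil < x.ceil ∧ x.ceil < y.ceil) then
    -- BCA ↔ BAC
    (x, z, y)
  else (x, y, z)

/-- The operator `ock_i` for `i ∈ ℤ`. -/
def ockW (i : ℤ) (a : PWord) : PWord :=
  if i = -1 then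
    match a with
    | [] => []
    | x :: rest => ock1 x :: rest
  else if i = 0 then
    match a with
    | x :: y :: rest => (ock2 x y).1 :: (ock2 x y).2 :: rest
    | _ => a
  else if 1 ≤ i ∧ i + 2 ≤ (a.length : ℤ) then
    let k := (i - 1).toNat
    match a[k]?, a[k + 1]?, a[k + 2]? with
    | some x, some y, some z =>
        a.take k ++ [(ock3 x y z).1, (ock3 x y z).2.1, (ock3 x y z).2.2] ++ a.drop (k + 3)
    | _, _, _ => a
  else a

/-- Orthogonal Coxeter–Knuth equivalence: generated by `a ∼ ock_i(a)` for all `i ∈ ℤ`. -/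
def OckEquiv : PWord → PWord → Prop :=
  Relation.EqvGen (fun a b => ∃ i : ℤ, b = ockW i a)
/-! ## Descents -/

/-- Descent set of a primed word (as a set of 1-based positions). -/
def DesWord (a : PWord) : Set ℤ :=
  {i | ∃ k : ℕ, i = (k : ℤ) + 1 ∧ ∃ x y, a[k]? = some x ∧ a[k + 1]? = some y ∧ y < x}

/-- Descent set of a standard shifted tableau. -/
def DesT (T : STab) : Set ℤ :=
  {i | 0 < i ∧ (
    (∃ r c r' c', entry? T r c = some ⟨i, false⟩ ∧
        entry? T r' c' = some ⟨i + 1, false⟩ ∧ r < r') ∨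
    (∃ r c r' c', entry? T r c = some ⟨i, true⟩ ∧
        entry? T r' c' = some ⟨i + 1, true⟩ ∧ c < c') ∨
    (∃ r c r' c', entry? T r c = some ⟨i, false⟩ ∧
        entry? T r' c' = some ⟨i + 1, true⟩))}

/-! ## Dual equivalence operators on standard shifted tableaux -/

def numPrimes (T : STab) : ℕ := T.flatten.countP (fun x => x.primed)

/-- The entries of column `c`, read from bottom to top (increasing). -/
def colLetters (T : STab) (c : ℕ) : PWord :=
  (List.range (c + 1)).filterMap (fun r => entry? T r c)

/-- The shifted reading word `unprime(C_q R_q ⋯ C_1 R_1)`. -/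
def shword (T : STab) : List ℤ :=
  (((List.range (numCols T)).reverse).flatMap (fun idx =>
    (colLetters T idx).filter (fun x => x.primed) ++
      ((T.getD idx []).filter (fun x => !x.primed)))).map Letter.ceil

def idxOfZ (v : ℤ) : List ℤ → ℕ
  | [] => 0
  | x :: r => if x = v then 0 else idxOfZ v r + 1

def positionsOf (T : STab) : List (ℕ × ℕ) :=
  (List.range T.length).flatMap (fun r =>
    (List.range (T.getD r []).length).map (fun k => (r, r + k)))

/-- The box `□_v` of `T` containing `v` or `v'`. -/
def boxOf (T : STab) (v : ℤ) : Option (ℕ × ℕ) :=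
  (positionsOf T).find? (fun p =>
    match entry? T p.1 p.2 with
    | some x => decide (x.ceil = v)
    | none => false)

/-- Reverse the prime of the entry in position `(r, c)`. -/
def togglePos (T : STab) (r c : ℕ) : STab :=
  match entry? T r c with
  | some x => setEntryG T r c ⟨x.ceil, !x.primed⟩
  | none => T

/-- Switch the primes of the entries in the two given positions. -/
def switchAt (T : STab) (p q : ℕ × ℕ) : STab :=
  match entry? T p.1 p.2, entry? T q.1 q.2 with
  | some x, some y =>
      if x.primed = y.primed then T else togglePos (togglePos T p.1 p.2) q.1 q.2
  | _, _ => T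

/-- The row index of `□_v` if it is a main-diagonal box. -/
def diagBox? (T : STab) (v : ℤ) : Option ℕ :=
  (boxOf T v).bind (fun p => if p.1 = p.2 then some p.1 else none)

def switchDiag (T T' : STab) (u v : ℤ) : STab :=
  match diagBox? T u, diagBox? T v with
  | some r, some s => switchAt T' (r, r) (s, s)
  | _, _ => T'

/-- The operator `𝔰_i`. -/
def sOp (i : ℤ) (T : STab) : STab :=
  match boxOf T i, boxOf T (i + 1) with
  | some (r1, c1), some (r2, c2) =>
      if r1 ≠ r2 ∧ c1 ≠ c2 then
        -- swap i ↔ i+1 and i' ↔ (i+1)'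
        setEntryG (setEntryG T r1 c1 ⟨i + 1, ((entry? T r1 c1).getD default).primed⟩)
          r2 c2 ⟨i, ((entry? T r2 c2).getD default).primed⟩
      else if r1 ≠ c1 ∧ r2 ≠ c2 then
        -- same row or column, neither box diagonal: reverse both primes
        togglePos (togglePos T r1 c1) r2 c2
      else
        -- same row or column, one box diagonal
        let T1 := if r1 = c1 then togglePos T r2 c2 else togglePos T r1 c1
        let T2 :=
          if 1 ≤ i - 1 ∧ (diagBox? T (i - 1)).isSome ∧ (diagBox? T (i + 1)).isSome then
            switchDiag T T1 (i - 1) (i + 1)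
          else T1
        if i + 2 ≤ (T.flatten.length : ℤ) ∧ (diagBox? T i).isSome ∧
            (diagBox? T (i + 2)).isSome then
          switchDiag T T2 i (i + 2)
        else T2
  | _, _ => T

def btwn (a m b : ℕ) : Prop := (a < m ∧ m < b) ∨ (b < m ∧ m < a)

instance (a m b : ℕ) : Decidable (btwn a m b) := by unfold btwn; infer_instance

/-- The dual equivalence operator `𝔡_i` for `i ∈ ℤ`. -/
def dOp (i : ℤ) (T : STab) : STab :=
  if ¬(1 ≤ i + 2 ∧ i + 2 ≤ (T.flatten.length : ℤ)) then T
  else if i = -1 then togglePos T 0 0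
  else if i = 0 then togglePos T 0 1
  else
    let w := shword T
    if btwn (idxOfZ i w) (idxOfZ (i + 2) w) (idxOfZ (i + 1) w) then sOp i T
    else if btwn (idxOfZ (i + 1) w) (idxOfZ i w) (idxOfZ (i + 2) w) then sOp (i + 1) T
    else T

/-! ## Marked cycles -/

/-- The 2-cycles of `z`, as ordered pairs `(i, j)` with `i < j = z(i)`. -/
def cycSet (z : Equiv.Perm ℤ) : Set (ℤ × ℤ) := {p | p.1 < p.2 ∧ z p.1 = p.2}

/-- `s_{a_n} ⋯ s_{a_{k+2}} s_{a_{k+1}}` (ordinary product; 0-based index `k`). -/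
def suffixPerm (a : List ℤ) (k : ℕ) : Equiv.Perm ℤ :=
  ((a.drop (k + 1)).reverse.map sPerm).prod

/-- `γ_{k+1}(a)` as an ordered pair (junk value `(0,0)` off the commutation set). -/
def gammaPair (a : List ℤ) (k : ℕ) : ℤ × ℤ :=
  match a[k]? with
  | some x => (min (suffixPerm a k x) (suffixPerm a k (x + 1)),
               max (suffixPerm a k x) (suffixPerm a k (x + 1)))
  | none => (0, 0)
/-! ## Increasing factorization sequences and Schur Q-functions -/

/-- `Incr_∞(R_inv^+(z))`: sequences of weakly increasing primed words, all but
finitely many empty, whose concatenation is a primed involution word for `z`. -/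
def IncrSeq (z : Equiv.Perm ℤ) : Set (ℕ → PWord) :=
  {φ | (∀ n, List.Chain' (· ≤ ·) (φ n)) ∧
    ∃ N, (∀ n, N ≤ n → φ n = []) ∧ ((List.range N).map φ).flatten ∈ RinvPlus z}

/-- Least bound past which a sequence of words is empty. -/
noncomputable def seqBound (φ : ℕ → PWord) : ℕ := sInf {N | ∀ n, N ≤ n → φ n = []}

/-- The concatenation `a^1 a^2 ⋯` of a sequence of words. -/
noncomputable def concatSeq (φ : ℕ → PWord) : PWord :=
  ((List.range (seqBound φ)).map φ).flatten

/-- `ℓ(a^1) + ⋯ + ℓ(a^i)`. -/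
def prefLen (φ : ℕ → PWord) (i : ℕ) : ℕ := (((List.range i).map φ).map List.length).sum

/-- The minimal `i ≥ 1` with `j ≤ ℓ(a^1) + ⋯ + ℓ(a^i)`. -/
noncomputable def relabel (φ : ℕ → PWord) (j : ℤ) : ℤ :=
  ((sInf {i : ℕ | 1 ≤ i ∧ j ≤ (prefLen φ i : ℤ)} : ℕ) : ℤ)

/-- The semistandard recording tableau `Q_EGᴼ(φ)`. -/
noncomputable def QEGseq (φ : ℕ → PWord) : STab :=
  (QEG (concatSeq φ)).map (List.map (fun x => (⟨relabel φ x.ceil, x.primed⟩ : Letter)))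

/-- The insertion tableau `P_EGᴼ(φ)`. -/
noncomputable def PEGseq (φ : ℕ → PWord) : STab := PEG (concatSeq φ)

/-- The Schur Q-function of a strict partition: the coefficient of the monomial with
exponent vector `d` is the number of semistandard shifted tableaux `T` of the given
shape with `x^T = x^d`. -/
noncomputable def SchurQ (sh : List ℕ) : MvPowerSeries ℤ ℤ :=
  fun d => (({T : STab | shapeOf T = sh ∧ IsSemistandard T ∧
    ∀ i : ℤ, d i = T.flatten.countP (fun x => decide (x.ceil = i))} : Set STab).ncard : ℤ)

/-- `Q_z = Σ_{φ ∈ Incr_∞(R_inv^+(z))} x^φ`. -/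
noncomputable def Qz (z : Equiv.Perm ℤ) : MvPowerSeries ℤ ℤ :=
  fun d => (({φ : ℕ → PWord | φ ∈ IncrSeq z ∧
    (∀ i : ℕ, d ((i : ℤ) + 1) = (φ i).length) ∧
    (∀ j : ℤ, j ≤ 0 → d j = 0)} : Set (ℕ → PWord)).ncard : ℤ)

/-! ## Dominant involutions -/

/-- The shifted diagram `SD_λ ⊆ ℤ × ℤ` of a strict partition. -/
def SDset (sh : List ℕ) : Set (ℤ × ℤ) :=
  {p | ∃ i j : ℕ, 1 ≤ i ∧ i ≤ sh.length ∧ 1 ≤ j ∧ j ≤ sh.getD (i - 1) 0 ∧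
    p.1 = (i : ℤ) ∧ p.2 = (i : ℤ) + (j : ℤ) - 1}

/-- The involution Rothe diagram `D̂(z) = {(i,j) : z(i) > j ≤ i < z(j)}`. -/
def invRothe (z : Equiv.Perm ℤ) : Set (ℤ × ℤ) :=
  {p | p.2 < z p.1 ∧ p.2 ≤ p.1 ∧ p.1 < z p.2}

/-- The tableau `T_λ` with entry `i + j - 1` in box `(i, j)` of `SD_λ`. -/
def Tlam (sh : List ℕ) : STab :=
  (List.range sh.length).map (fun r =>
    (List.range (sh.getD r 0)).map (fun k =>
      (⟨2 * (r : ℤ) + (k : ℤ) + 1, false⟩ : Letter)))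

/-- The permutation `i + m ↦ w(i) + m` (fixing everything outside `m + support`). -/
def shiftPerm (m : ℕ) (w : Equiv.Perm ℤ) : Equiv.Perm ℤ :=
  (Equiv.addLeft (m : ℤ)).permCongr w

/-- `z ∈ S_m`: `z` fixes every point outside `[1, m]`. -/
def SupportedOn (z : Equiv.Perm ℤ) (m : ℕ) : Prop :=
  ∀ x : ℤ, x < 1 ∨ (m : ℤ) < x → z x = x
/-! ## Primed compatible sequences -/

/-- A primed compatible sequence, recorded as the list of its columns `(index; value)`. -/
def IsPrimedCompatible (φ : List (ℕ × Letter)) : Prop :=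
  (∀ p ∈ φ, 0 < p.1 ∧ 0 < p.2.ceil) ∧
  List.Chain' (fun p q : ℕ × Letter => p.1 ≤ q.1 ∧ (p.1 = q.1 → p.2 ≤ q.2)) φ ∧
  (∀ (k l : ℕ) (p : ℕ × Letter), k < l → φ[k]? = some p → φ[l]? = some p →
    p.2.primed = false)

def IsIndexStrict (φ : List (ℕ × Letter)) : Prop :=
  List.Chain' (fun p q : ℕ × Letter => p.1 < q.1) φ

/-! ## Sagan–Worley insertion (orthogonal and symplectic versions) -/

/-- Whether `u` bumps `v`: strict comparison when inserting an unprimed letter into a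
row or a primed letter into a column, weak comparison otherwise. -/
def swBump (isRow : Bool) (u v : Letter) : Bool :=
  if (isRow && !u.primed) || (!isRow && u.primed) then decide (u < v) else decide (u ≤ v)

/-- Column stage of orthogonal Sagan–Worley insertion. -/
def swColO : ℕ → STab → ℕ → Letter → STab × Bool
  | 0, T, _, _ => (T, true)
  | fuel + 1, T, c, u =>
    let occ := (List.range (c + 1)).filterMap (fun r => (entry? T r c).map (fun x => (r, x)))
    match occ.find? (fun p => swBump false u p.2) with
    | none =>
        let r := occ.length
        let u' := if r = c ∧ u.primed then Letter.unprime u else u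
        (setRowG T r ((T.getD r []) ++ [u']), true)
    | some p =>
        if p.1 = c then
          if u.ceil = p.2.ceil then swColO fuel T (c + 1) (Letter.unprime p.2)
          else
            let q := switchPrimes u p.2
            swColO fuel (setEntryG T p.1 c q.1) (c + 1) q.2
        else swColO fuel (setEntryG T p.1 c u) (c + 1) p.2

/-- Row stage of orthogonal Sagan–Worley insertion. -/
def swRowO : ℕ → STab → ℕ → Letter → STab × Bool
  | 0, T, _, _ => (T, true)
  | fuel + 1, T, r, u =>
    let row := T.getD r []
    match row.findIdx? (fun v => swBump true u v) with
    | none =>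
        if row.isEmpty ∧ u.primed then (setRowG T r [Letter.unprime u], true)
        else (setRowG T r (row ++ [u]), false)
    | some k =>
        let v := row.getD k default
        if k = 0 then
          if u.ceil = v.ceil then swColO fuel T (r + 1) (Letter.unprime v)
          else
            let q := switchPrimes u v
            swColO fuel (setRowG T r (row.set 0 q.1)) (r + 1) q.2
        else swRowO fuel (setRowG T r (row.set k u)) (r + 1) v

def swInsertO (T : STab) (u : Letter) : STab × Bool :=
  swRowO (T.flatten.length + T.length + 2) T 0 u

/-- Column stage of symplectic (original) Sagan–Worley insertion. -/
def swColSp : ℕ → STab → ℕ → Letter → STab × Bool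
  | 0, T, _, _ => (T, true)
  | fuel + 1, T, c, u =>
    let occ := (List.range (c + 1)).filterMap (fun r => (entry? T r c).map (fun x => (r, x)))
    match occ.find? (fun p => swBump false u p.2) with
    | none => (setRowG T occ.length ((T.getD occ.length []) ++ [u]), true)
    | some p =>
        if p.1 = c then
          if u.ceil = p.2.ceil then swColSp fuel T (c + 1) (Letter.unprime p.2)
          else swColSp fuel (setEntryG T p.1 c u) (c + 1) p.2
        else swColSp fuel (setEntryG T p.1 c u) (c + 1) p.2

/-- Row stage of symplectic (original) Sagan–Worley insertion. -/
def swRowSp : ℕ → STab → ℕ → Letter → STab × Bool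
  | 0, T, _, _ => (T, true)
  | fuel + 1, T, r, u =>
    let row := T.getD r []
    match row.findIdx? (fun v => swBump true u v) with
    | none => (setRowG T r (row ++ [u]), false)
    | some k =>
        let v := row.getD k default
        if k = 0 then
          if u.ceil = v.ceil then swColSp fuel T (r + 1) (Letter.unprime v)
          else swColSp fuel (setRowG T r (row.set 0 u)) (r + 1) v
        else swRowSp fuel (setRowG T r (row.set k u)) (r + 1) v

def swInsertSp (T : STab) (u : Letter) : STab × Bool :=
  swRowSp (T.flatten.length + T.length + 2) T 0 u

def PSWO (φ : List (ℕ × Letter)) : STab := φ.foldl (fun T p => (swInsertO T p.2).1) []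

def PSWSp (φ : List (ℕ × Letter)) : STab := φ.foldl (fun T p => (swInsertSp T p.2).1) []

def QSWaux (ins : STab → Letter → STab × Bool) : STab → STab → List (ℕ × Letter) → STab
  | _, Q, [] => Q
  | P, Q, p :: rest =>
      let res := ins P p.2
      QSWaux ins res.1 (addBox Q P res.1 ⟨(p.1 : ℤ), res.2⟩) rest

def QSWO (φ : List (ℕ × Letter)) : STab := QSWaux swInsertO [] [] φ

def QSWSp (φ : List (ℕ × Letter)) : STab := QSWaux swInsertSp [] [] φ

/-- Entry `A_{ij}` of the circled matrix of `φ` (forgetting the circles). -/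
def cmEntry (φ : List (ℕ × Letter)) (i j : ℕ) : ℕ :=
  φ.countP (fun p => decide (p.1 = i ∧ p.2.ceil = (j : ℤ)))

/-! ## Shifted mixed insertion (orthogonal and symplectic versions) -/

/-- Tableaux whose entries are signed letters `(ε, u)`, `ε ∈ {+, -}`
(`true` records the sign `-`). -/
abbrev MTab := List (List (Bool × Letter))

def extractO (U : MTab) : STab :=
  U.map (fun row =>
    match row with
    | [] => []
    | (e, x) :: rest => (if e then (⟨x.ceil, true⟩ : Letter) else x) :: rest.map Prod.snd)

def extractSp (U : MTab) : STab := U.map (List.map Prod.snd)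

/-- One mixed insertion, of the pair `β` into row (`isCol = false`) or column
(`isCol = true`) number `idx`; returns the tableau and the added box. -/
def hmIns (sympl : Bool) : ℕ → MTab → Bool → ℕ → Bool × Letter → MTab × (ℕ × ℕ)
  | 0, T, _, _, _ => (T, (0, 0))
  | fuel + 1, T, isCol, idx, β =>
    if isCol then
      let c := idx
      let occ := (List.range (c + 1)).filterMap
        (fun r => (entryG? T r c).map (fun x => (r, x)))
      match occ.find? (fun p => decide (β.2 < p.2.2)) with
      | none =>
          let r := occ.length
          (setRowG T r ((T.getD r []) ++ [β]), (r, c))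
      | some p =>
          if p.1 = c then
            hmIns sympl fuel
              (setEntryG T p.1 c (if sympl then (p.2.1, β.2) else β)) true (c + 1)
              (if sympl then (β.1, ⟨p.2.2.ceil, true⟩) else (p.2.1, ⟨p.2.2.ceil, true⟩))
          else
            hmIns sympl fuel (setEntryG T p.1 c (p.2.1, β.2)) p.2.2.primed
              (if p.2.2.primed then c + 1 else p.1 + 1) (β.1, p.2.2)
    else
      let r := idx
      let row := T.getD r []
      match row.findIdx? (fun p => decide (β.2 < p.2)) with
      | none => (setRowG T r (row ++ [β]), (r, r + row.length))
      | some k =>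
          let q := row.getD k default
          if k = 0 then
            hmIns sympl fuel
              (setRowG T r (row.set 0 (if sympl then (q.1, β.2) else β))) true (r + 1)
              (if sympl then (β.1, ⟨q.2.ceil, true⟩) else (q.1, ⟨q.2.ceil, true⟩))
          else
            hmIns sympl fuel (setRowG T r (row.set k (q.1, β.2))) q.2.primed
              (if q.2.primed then r + k + 1 else r + 1) (β.1, q.2)

def hmInsert (sympl : Bool) (T : MTab) (x : Letter) : MTab × (ℕ × ℕ) :=
  hmIns sympl (2 * T.flatten.length + 4) T false 0 (x.primed, ⟨x.ceil, false⟩)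

def hmAuxCS (sympl : Bool) : MTab → STab → List (ℕ × Letter) → MTab × STab
  | U, Q, [] => (U, Q)
  | U, Q, p :: rest =>
      let res := hmInsert sympl U p.2
      let pos := res.2
      let sgn := ((entryG? res.1 pos.1 pos.2).map Prod.fst).getD false
      let pr : Bool := if sympl then sgn else (decide (pos.1 ≠ pos.2) && sgn)
      hmAuxCS sympl res.1
        (setRowG Q pos.1 ((Q.getD pos.1 []) ++ [(⟨(p.1 : ℤ), pr⟩ : Letter)])) rest

def PHMO (φ : List (ℕ × Letter)) : STab := extractO (hmAuxCS false [] [] φ).1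
def QHMO (φ : List (ℕ × Letter)) : STab := (hmAuxCS false [] [] φ).2
def PHMSp (φ : List (ℕ × Letter)) : STab := extractSp (hmAuxCS true [] [] φ).1
def QHMSp (φ : List (ℕ × Letter)) : STab := (hmAuxCS true [] [] φ).2

/-- A primed word, identified with the primed compatible sequence with
index row `1, 2, …, n`. -/
def wordCS (a : PWord) : List (ℕ × Letter) :=
  ((List.range a.length).zip a).map (fun p => (p.1 + 1, p.2))

/-! ## The transpose of a primed compatible sequence -/

def insSortedCS (p : ℕ × Letter) : List (ℕ × Letter) → List (ℕ × Letter)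
  | [] => [p]
  | q :: rest =>
      if p.1 < q.1 ∨ (p.1 = q.1 ∧ p.2 ≤ q.2) then p :: q :: rest
      else q :: insSortedCS p rest

def sortCS (l : List (ℕ × Letter)) : List (ℕ × Letter) := l.foldr insSortedCS []

/-- `φ^⊤`: move each prime from the value to the index above it, interchange the two
rows, and reorder the columns lexicographically. -/
def transposeCS (φ : List (ℕ × Letter)) : List (ℕ × Letter) :=
  sortCS (φ.map (fun p => (p.2.ceil.toNat, (⟨(p.1 : ℤ), p.2.primed⟩ : Letter))))

/-- Right Demazure multiplication by a simple transposition. -/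
def rho (x : ℤ) (σ : Equiv.Perm ℤ) : Equiv.Perm ℤ := if σ x < σ (x + 1) then σ * sPerm x else σ

/-- Left Demazure multiplication by a simple transposition. -/
def lam (x : ℤ) (σ : Equiv.Perm ℤ) : Equiv.Perm ℤ := (rho x σ⁻¹)⁻¹

/-- Demazure conjugation by a simple transposition. -/
def dact (x : ℤ) (σ : Equiv.Perm ℤ) : Equiv.Perm ℤ := lam x (rho x σ)

theorem sPerm_apply (x t : ℤ) :
    sPerm x t = if t = x then x + 1 else if t = x + 1 then x else t := by
  simp [sPerm, Equiv.swap_apply_def]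

theorem sPerm_inv (x : ℤ) : (sPerm x)⁻¹ = sPerm x := by simp [sPerm]

theorem rho_pos {x : ℤ} {σ : Equiv.Perm ℤ} (h : σ x < σ (x + 1)) : rho x σ = σ * sPerm x :=
  if_pos h

theorem rho_neg {x : ℤ} {σ : Equiv.Perm ℤ} (h : ¬ σ x < σ (x + 1)) : rho x σ = σ := if_neg h

theorem lam_pos {x : ℤ} {σ : Equiv.Perm ℤ} (h : σ⁻¹ x < σ⁻¹ (x + 1)) : lam x σ = sPerm x * σ := by
  unfold lam; rw [rho_pos h, mul_inv_rev, inv_inv, sPerm_inv]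

theorem lam_neg {x : ℤ} {σ : Equiv.Perm ℤ} (h : ¬ σ⁻¹ x < σ⁻¹ (x + 1)) : lam x σ = σ := by
  unfold lam; rw [rho_neg h, inv_inv]

theorem lam_rho_comm (x y : ℤ) (σ : Equiv.Perm ℤ) : lam x (rho y σ) = rho y (lam x σ) := by
  have hinv : ∀ t u, σ t = u ↔ t = σ⁻¹ u := fun t u => by
    rw [Equiv.Perm.eq_inv_iff_eq]
  have e1 := hinv y x
  have e2 := hinv (y + 1) x
  have e3 := hinv y (x + 1)
  have e4 := hinv (y + 1) (x + 1)
  by_cases hp : σ y = x ∧ σ (y + 1) = x + 1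
  · obtain ⟨h1, h2⟩ := hp
    have hs : sPerm x * σ = σ * sPerm y := by
      ext t
      have i1 := hinv t x
      have i2 := hinv t (x + 1)
      simp only [Equiv.Perm.mul_apply, sPerm_apply]
      grind
    have a1 : σ⁻¹ x = y := (e1.1 h1).symm
    have a2 : σ⁻¹ (x + 1) = y + 1 := (e4.1 h2).symm
    rw [rho_pos (by rw [h1, h2]; omega), lam_neg, lam_pos (by rw [a1, a2]; omega), rho_neg, hs]
    · simp only [Equiv.Perm.mul_apply, sPerm_apply]
      simp [h1, h2]
    · simp only [mul_inv_rev, sPerm_inv, Equiv.Perm.mul_apply, sPerm_apply, a1, a2]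
      simp
  · by_cases ha : σ y < σ (y + 1) <;> by_cases hb : σ⁻¹ x < σ⁻¹ (x + 1)
    · rw [rho_pos ha, lam_pos hb, lam_pos, rho_pos, mul_assoc]
      · simp only [Equiv.Perm.mul_apply, sPerm_apply]
        grind
      · simp only [mul_inv_rev, sPerm_inv, Equiv.Perm.mul_apply, sPerm_apply]
        grind
    · rw [rho_pos ha, lam_neg hb, lam_neg, rho_pos ha]
      simp only [mul_inv_rev, sPerm_inv, Equiv.Perm.mul_apply, sPerm_apply]
      grind
    · rw [rho_neg ha, lam_pos hb, rho_neg]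
      simp only [Equiv.Perm.mul_apply, sPerm_apply]
      grind
    · rw [rho_neg ha, lam_neg hb, rho_neg ha]

theorem heckeProd_append (w : List ℤ) (x : ℤ) : heckeProd (w ++ [x]) = rho x (heckeProd w) := by
  unfold heckeProd
  rw [List.foldl_append]
  rfl

theorem lam_one (x : ℤ) : lam x 1 = rho x 1 := by
  rw [lam_pos (by simp), rho_pos (by simp)]; simp

theorem heckeProd_cons (x : ℤ) (w : List ℤ) : heckeProd (x :: w) = lam x (heckeProd w) := by
  induction w using List.reverseRecOn with
  | nil => rw [← List.nil_append [x], heckeProd_append]; exact (lam_one x).symm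
  | append_singleton w y ih =>
    rw [← List.cons_append, heckeProd_append, ih, heckeProd_append, lam_rho_comm]

theorem invHecke_nil : invHecke [] = 1 := by simp [invHecke, heckeProd]

theorem rho_not_asc (x : ℤ) (σ : Equiv.Perm ℤ) : ¬ rho x σ x < rho x σ (x + 1) := by
  by_cases h : σ x < σ (x + 1)
  · rw [rho_pos h]
    simp only [Equiv.Perm.mul_apply, sPerm_apply]
    simp
    omega
  · rwa [rho_neg h]

theorem rho_idem (x : ℤ) (σ : Equiv.Perm ℤ) : rho x (rho x σ) = rho x σ :=
  rho_neg (rho_not_asc x σ)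

theorem invHecke_append_singleton (a : List ℤ) (x : ℤ) :
    invHecke (a ++ [x]) = dact x (invHecke a) := by
  cases a with
  | nil =>
    simp only [invHecke, List.nil_append, List.reverse_singleton, List.tail_cons, List.append_nil,
      List.reverse_nil, List.tail_nil, heckeProd_cons, dact]
    simp [heckeProd, lam_rho_comm, lam_one, rho_idem]
  | cons y a =>
    have : (y :: a ++ [x]).reverse ++ (y :: a ++ [x]).tail =
        x :: (((y :: a).reverse ++ (y :: a).tail) ++ [x]) := by simp
    rw [invHecke, this, heckeProd_cons, heckeProd_append, dact, invHecke]

theorem lam_inv (x : ℤ) (σ : Equiv.Perm ℤ) : (lam x σ)⁻¹ = rho x σ⁻¹ := by simp [lam]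

theorem rho_inv (x : ℤ) (σ : Equiv.Perm ℤ) : (rho x σ)⁻¹ = lam x σ⁻¹ := by simp [lam]

theorem dact_inv (x : ℤ) (σ : Equiv.Perm ℤ) : (dact x σ)⁻¹ = dact x σ⁻¹ := by
  simp [dact, lam_inv, rho_inv, lam_rho_comm]

theorem rho_far {x y : ℤ} (h : x + 1 < y ∨ y + 1 < x) (σ : Equiv.Perm ℤ) :
    rho x (rho y σ) = rho y (rho x σ) := by
  have hc : sPerm x * sPerm y = sPerm y * sPerm x := by
    ext t; simp only [Equiv.Perm.mul_apply, sPerm_apply]; grind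
  have e1 : (σ * sPerm x) y = σ y ∧ (σ * sPerm x) (y + 1) = σ (y + 1) := by
    simp only [Equiv.Perm.mul_apply, sPerm_apply]; constructor <;> congr 1 <;> grind
  have e2 : (σ * sPerm y) x = σ x ∧ (σ * sPerm y) (x + 1) = σ (x + 1) := by
    simp only [Equiv.Perm.mul_apply, sPerm_apply]; constructor <;> congr 1 <;> grind
  by_cases h1 : σ x < σ (x + 1) <;> by_cases h2 : σ y < σ (y + 1)
  · rw [rho_pos h1, rho_pos h2, rho_pos (by rwa [e2.1, e2.2]), rho_pos (by rwa [e1.1, e1.2]),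
      mul_assoc, mul_assoc, hc]
  · rw [rho_pos h1, rho_neg h2, rho_pos h1, rho_neg (by rwa [e1.1, e1.2])]
  · rw [rho_neg h1, rho_pos h2, rho_neg (by rwa [e2.1, e2.2])]
  · rw [rho_neg h1, rho_neg h2, rho_neg h1]

theorem rho_braid (x : ℤ) (σ : Equiv.Perm ℤ) :
    rho x (rho (x + 1) (rho x σ)) = rho (x + 1) (rho x (rho (x + 1) σ)) := by
  have hb : sPerm x * (sPerm (x + 1) * sPerm x) = sPerm (x + 1) * (sPerm x * sPerm (x + 1)) := by
    ext t; simp only [Equiv.Perm.mul_apply, sPerm_apply]; grind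
  have n1 : σ x ≠ σ (x + 1) := fun h => by have := σ.injective h; omega
  have n2 : σ x ≠ σ (x + 1 + 1) := fun h => by have := σ.injective h; omega
  have n3 : σ (x + 1) ≠ σ (x + 1 + 1) := fun h => by have := σ.injective h; omega
  have s1 : sPerm x x = x + 1 := by simp [sPerm_apply]
  have s2 : sPerm x (x + 1) = x := by simp [sPerm_apply]
  have s3 : sPerm x (x + 1 + 1) = x + 1 + 1 := by rw [sPerm_apply]; split_ifs <;> omega
  have s4 : sPerm (x + 1) x = x := by rw [sPerm_apply]; split_ifs <;> omega
  have s5 : sPerm (x + 1) (x + 1) = x + 1 + 1 := by simp [sPerm_apply]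
  have s6 : sPerm (x + 1) (x + 1 + 1) = x + 1 := by simp [sPerm_apply]
  have P : ∀ {y : ℤ} {τ : Equiv.Perm ℤ}, τ y < τ (y + 1) → rho y τ = τ * sPerm y := rho_pos
  have Q : ∀ {y : ℤ} {τ : Equiv.Perm ℤ}, ¬ τ y < τ (y + 1) → rho y τ = τ := rho_neg
  have R : ∀ y, (rho y σ = if σ y < σ (y + 1) then σ * sPerm y else σ) := fun y => rfl
  rcases lt_or_gt_of_ne n1 with h1 | h1 <;> rcases lt_or_gt_of_ne n3 with h2 | h2 <;>
    rcases lt_or_gt_of_ne n2 with h3 | h3 <;> try omega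
  · rw [P h1, P (y := x + 1) (τ := σ * sPerm x), P (y := x), P h2, P (y := x), P (y := x + 1)]
    · simp only [mul_assoc, hb]
    all_goals first | omega | (simp only [Equiv.Perm.mul_apply, s1, s2, s3, s4, s5, s6]; omega)
  · rw [P h1, P (y := x + 1) (τ := σ * sPerm x), Q (y := x), Q (y := x + 1) (τ := σ), P h1,
      P (y := x + 1)]
    all_goals first | omega | (simp only [Equiv.Perm.mul_apply, s1, s2, s3, s4, s5]; omega)
  · rw [P h1, Q (y := x + 1) (τ := σ * sPerm x), Q (y := x), Q (y := x + 1) (τ := σ), P h1,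
      Q (y := x + 1)]
    all_goals first | omega | (simp only [Equiv.Perm.mul_apply, s1, s2, s3]; omega)
  · rw [Q (y := x) (τ := σ), P h2, P (y := x), Q (y := x + 1)]
    all_goals first | omega | (simp only [Equiv.Perm.mul_apply, s2, s3, s4, s5, s6]; omega)
  · rw [Q (y := x) (τ := σ), P h2, Q (y := x), Q (y := x + 1)]
    all_goals first | omega | (simp only [Equiv.Perm.mul_apply, s4, s5, s6]; omega)
  · rw [Q (y := x) (τ := σ), Q (y := x + 1) (τ := σ), Q (y := x) (τ := σ), Q (y := x + 1) (τ := σ)]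
    all_goals omega

theorem lam_far {x y : ℤ} (h : x + 1 < y ∨ y + 1 < x) (σ : Equiv.Perm ℤ) :
    lam x (lam y σ) = lam y (lam x σ) := by
  simp only [lam, inv_inv, rho_far h]

theorem lam_braid (x : ℤ) (σ : Equiv.Perm ℤ) :
    lam x (lam (x + 1) (lam x σ)) = lam (x + 1) (lam x (lam (x + 1) σ)) := by
  simp only [lam, inv_inv, rho_braid]

theorem dact_far {x y : ℤ} (h : x + 1 < y ∨ y + 1 < x) (σ : Equiv.Perm ℤ) :
    dact x (dact y σ) = dact y (dact x σ) := by
  simp only [dact, ← lam_rho_comm, rho_far h, lam_far h]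

theorem dact_braid (x : ℤ) (σ : Equiv.Perm ℤ) :
    dact x (dact (x + 1) (dact x σ)) = dact (x + 1) (dact x (dact (x + 1) σ)) := by
  simp only [dact, ← lam_rho_comm, rho_braid, lam_braid]

theorem dact_not_asc (x : ℤ) (σ : Equiv.Perm ℤ) : ¬ dact x σ x < dact x σ (x + 1) := by
  rw [dact, lam_rho_comm]
  exact rho_not_asc x _

theorem dact_of_not_asc {x : ℤ} {σ : Equiv.Perm ℤ} (hσ : σ⁻¹ = σ) (h : ¬ σ x < σ (x + 1)) :
    dact x σ = σ := by
  rw [dact, rho_neg h, lam_neg (by rwa [hσ])]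

theorem dact_fixed {x : ℤ} {σ : Equiv.Perm ℤ} (hσ : σ⁻¹ = σ) (h : σ x = x) (h' : σ (x + 1) = x + 1) :
    dact x σ = σ * sPerm x := by
  have : σ x < σ (x + 1) := by omega
  rw [dact, rho_pos this, lam_neg]
  simp only [mul_inv_rev, sPerm_inv, Equiv.Perm.mul_apply, sPerm_apply, hσ, h, h']
  simp

theorem dact_moved {x : ℤ} {σ : Equiv.Perm ℤ} (hσ : σ⁻¹ = σ) (h : σ x < σ (x + 1))
    (h' : ¬ (σ x = x ∧ σ (x + 1) = x + 1)) : dact x σ = sPerm x * σ * sPerm x := by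
  rw [dact, rho_pos h, lam_pos, mul_assoc]
  simp only [mul_inv_rev, sPerm_inv, Equiv.Perm.mul_apply, sPerm_apply, hσ]
  grind

/-- The involution reached from `σ` by a word of Demazure conjugations. -/
def act (σ : Equiv.Perm ℤ) (a : PWord) : Equiv.Perm ℤ := a.foldl (fun τ x => dact x.ceil τ) σ

theorem act_append (σ : Equiv.Perm ℤ) (a b : PWord) : act σ (a ++ b) = act (act σ a) b :=
  List.foldl_append

theorem act_inv {σ : Equiv.Perm ℤ} (hσ : σ⁻¹ = σ) (a : PWord) : (act σ a)⁻¹ = act σ a := by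
  induction a generalizing σ with
  | nil => exact hσ
  | cons x a ih => exact ih (by rw [dact_inv, hσ])

theorem invHecke_unprimeWord (a : PWord) : invHecke (unprimeWord a) = act 1 a := by
  induction a using List.reverseRecOn with
  | nil => exact invHecke_nil
  | append_singleton a x ih =>
    rw [act_append, ← ih, unprimeWord, List.map_append, List.map_singleton,
      invHecke_append_singleton]
    rfl

/-- Every primed letter acts on two fixed points. -/
def PC : Equiv.Perm ℤ → PWord → Prop
  | _, [] => True
  | σ, x :: a => (x.primed = true → σ x.ceil = x.ceil ∧ σ (x.ceil + 1) = x.ceil + 1) ∧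
      PC (dact x.ceil σ) a

/-- Every letter is an ascent. -/
def Asc : Equiv.Perm ℤ → PWord → Prop
  | _, [] => True
  | σ, x :: a => σ x.ceil < σ (x.ceil + 1) ∧ Asc (dact x.ceil σ) a

theorem PC_append (σ : Equiv.Perm ℤ) (a b : PWord) :
    PC σ (a ++ b) ↔ PC σ a ∧ PC (act σ a) b := by
  induction a generalizing σ with
  | nil => simp [PC, act]
  | cons x a ih => simp only [List.cons_append, PC, ih, and_assoc]; rfl

theorem Asc_append (σ : Equiv.Perm ℤ) (a b : PWord) :
    Asc σ (a ++ b) ↔ Asc σ a ∧ Asc (act σ a) b := by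
  induction a generalizing σ with
  | nil => simp [Asc, act]
  | cons x a ih => simp only [List.cons_append, Asc, ih, and_assoc]; rfl

theorem PC_iff (a : PWord) :
    PC 1 a ↔ ∀ (k : ℕ) (x : Letter), a[k]? = some x → x.primed = true →
       IsCommutation (unprimeWord a) k := by
  induction a using List.reverseRecOn with
  | nil => simp [PC]
  | append_singleton a x ih =>
    have htake : ∀ k, k ≤ a.length → (unprimeWord (a ++ [x])).take k = (unprimeWord a).take k := by
      intro k hk
      rw [unprimeWord, List.map_append, List.take_append_of_le_length (by simpa using hk)]; rfl
    have hfull : (unprimeWord a).take a.length = unprimeWord a := by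
      rw [List.take_of_length_le]; simp [unprimeWord]
    rw [PC_append, ih]
    constructor
    · rintro ⟨h1, h2⟩ k y hk hp
      by_cases hka : k < a.length
      · rw [List.getElem?_append_left hka] at hk
        obtain ⟨c, hc, hc2⟩ := h1 k y hk hp
        refine ⟨c, ?_, ?_⟩
        · rw [unprimeWord, List.map_append, List.getElem?_append_left (by simpa using hka)]
          exact hc
        · rwa [htake k hka.le]
      · have hk' : k = a.length := by
          have := (List.getElem?_eq_some_iff.1 hk).1
          simp at this; omega
        subst hk'
        simp at hk
        subst hk
        refine ⟨x.ceil, by simp [unprimeWord], ?_⟩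
        rw [htake _ le_rfl, hfull, invHecke_unprimeWord]
        exact h2.1 hp
    · intro h
      constructor
      · intro k y hk hp
        have hka := (List.getElem?_eq_some_iff.1 hk).1
        obtain ⟨c, hc, hc2⟩ := h k y (by rw [List.getElem?_append_left hka]; exact hk) hp
        refine ⟨c, ?_, ?_⟩
        · rw [unprimeWord, List.map_append, List.getElem?_append_left (by simpa using hka)] at hc
          exact hc
        · rwa [htake k hka.le] at hc2
      · refine ⟨fun hp => ?_, trivial⟩
        obtain ⟨c, hc, hc2⟩ := h a.length x (by simp) hp
        have : c = x.ceil := by simpa [unprimeWord] using hc.symm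
        subst this
        rwa [htake _ le_rfl, hfull, invHecke_unprimeWord] at hc2

theorem mem_RinvPlus_iff {z : Equiv.Perm ℤ} {a : PWord} :
    a ∈ RinvPlus z ↔ act 1 a = z ∧ (∀ b : PWord, act 1 b = z → a.length ≤ b.length) ∧ PC 1 a := by
  have hlen : (unprimeWord a).length = a.length := by simp [unprimeWord]
  rw [PC_iff]
  simp only [RinvPlus, Rinv, Set.mem_ofPred_eq, invHecke_unprimeWord, hlen, and_assoc]
  refine and_congr_right fun _ => and_congr_left fun _ => ⟨fun h b hb => ?_, fun h b hb => ?_⟩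
  · simpa [unprimeWord] using h (unprimeWord b) (by rwa [invHecke_unprimeWord])
  · have := h (b.map fun i => ⟨i, false⟩) (by
      rw [← invHecke_unprimeWord]; simpa [unprimeWord, Function.comp_def] using hb)
    simpa using this

theorem asc_of_mem {z : Equiv.Perm ℤ} {a : PWord} (h : a ∈ RinvPlus z) : Asc 1 a := by
  obtain ⟨h1, h2, -⟩ := mem_RinvPlus_iff.1 h
  by_contra hn
  have key : ∀ (b : PWord) (σ : Equiv.Perm ℤ), σ⁻¹ = σ → ¬ Asc σ b →
      ∃ c : PWord, act σ c = act σ b ∧ c.length < b.length := by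
    intro b
    induction b with
    | nil => intro σ _ h; exact absurd trivial h
    | cons x b ih =>
      intro σ hσ h
      by_cases hx : σ x.ceil < σ (x.ceil + 1)
      · have : ¬ Asc (dact x.ceil σ) b := fun h' => h ⟨hx, h'⟩
        obtain ⟨c, hc, hl⟩ := ih _ (by rw [dact_inv, hσ]) this
        exact ⟨x :: c, hc, by simpa using hl⟩
      · exact ⟨b, by simp [act, dact_of_not_asc hσ hx], by simp⟩
  obtain ⟨c, hc, hl⟩ := key a 1 inv_one hn
  have := h2 c (hc.trans h1)
  omega

/-- Replacing a window by another of the same length and effect. -/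
theorem RinvPlus_window {z : Equiv.Perm ℤ} {L w w' L' : PWord} (h : L ++ w ++ L' ∈ RinvPlus z)
    (hl : w'.length = w.length) (hact : act (act 1 L) w' = act (act 1 L) w)
    (hpc : PC (act 1 L) w') : L ++ w' ++ L' ∈ RinvPlus z := by
  rw [mem_RinvPlus_iff] at h ⊢
  obtain ⟨h1, h2, h3⟩ := h
  rw [act_append, act_append] at h1 ⊢
  rw [PC_append, PC_append, act_append] at h3
  rw [PC_append, PC_append, act_append]
  refine ⟨by rw [hact, h1], fun b hb => ?_, ⟨h3.1.1, hpc⟩, by rw [hact]; exact h3.2⟩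
  have := h2 b hb
  simp only [List.length_append] at this ⊢
  omega

theorem RinvPlus_PC {z : Equiv.Perm ℤ} {L w L' : PWord} (h : L ++ w ++ L' ∈ RinvPlus z) :
    PC (act 1 L) w ∧ Asc (act 1 L) w := by
  have h1 := (mem_RinvPlus_iff.1 h).2.2
  have h2 := asc_of_mem h
  rw [PC_append, PC_append] at h1
  rw [Asc_append, Asc_append] at h2
  exact ⟨h1.1.2, h2.1.2⟩

theorem RinvPlus_prefix {z : Equiv.Perm ℤ} {a b : PWord} (h : a ++ b ∈ RinvPlus z) :
    a ∈ RinvPlus (act 1 a) := by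
  rw [mem_RinvPlus_iff] at h ⊢
  obtain ⟨h1, h2, h3⟩ := h
  rw [PC_append] at h3
  refine ⟨rfl, fun c hc => ?_, h3.1⟩
  have := h2 (c ++ b) (by rw [act_append, hc, ← act_append, h1])
  simp at this
  exact this

/-- Two letters differ by at least two. -/
def Far (a b : ℤ) : Prop := a + 1 < b ∨ b + 1 < a

theorem Far.symm {a b : ℤ} (h : Far a b) : Far b a := Or.symm h

/-- A class of words closed under the local moves of primed involution words. -/
structure LocCls (K : PWord → Prop) : Prop where
  comm : ∀ A x y B, K (A ++ x :: y :: B) → Far x.ceil y.ceil → K (A ++ y :: x :: B)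
  braid : ∀ A a b p s q B, K (A ++ ⟨a, p⟩ :: ⟨b, s⟩ :: ⟨a, q⟩ :: B) → (a = b + 1 ∨ b = a + 1) →
    s = false ∧ K (A ++ ⟨b, q⟩ :: ⟨a, false⟩ :: ⟨b, p⟩ :: B)
  ne : ∀ A x y B, K (A ++ x :: y :: B) → x.ceil ≠ y.ceil
  prime : ∀ A a b p q B, K (A ++ ⟨a, p⟩ :: ⟨b, q⟩ :: B) → (a = b + 1 ∨ b = a + 1) →
    p = true → q = true → False

theorem LocCls.reverse {K : PWord → Prop} (h : LocCls K) : LocCls fun w => K w.reverse where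
  comm A x y B hK hf := by
    have := h.comm B.reverse y x A.reverse (by simpa using hK) hf.symm
    simpa using this
  braid A a b p s q B hK hf := by
    have := h.braid B.reverse a b q s p A.reverse (by simpa using hK) hf
    simpa using this
  ne A x y B hK := (h.ne B.reverse y x A.reverse (by simpa using hK)).symm
  prime A a b p q B hK hf hp hq :=
    h.prime B.reverse b a q p A.reverse (by simpa using hK) hf.symm hq hp

theorem LocCls.context {K : PWord → Prop} (h : LocCls K) (L L' : PWord) :
    LocCls fun w => K (L ++ w ++ L') where
  comm A x y B hK hf := by
    have := h.comm (L ++ A) x y (B ++ L') (by simpa using hK) hf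
    simpa using this
  braid A a b p s q B hK hf := by
    have := h.braid (L ++ A) a b p s q (B ++ L') (by simpa using hK) hf
    simpa using this
  ne A x y B hK := h.ne (L ++ A) x y (B ++ L') (by simpa using hK)
  prime A a b p q B hK := h.prime (L ++ A) a b p q (B ++ L') (by simpa using hK)

/-- Value table of a Demazure conjugation at an ascent. -/
theorem dact_asc_apply {x : ℤ} {σ : Equiv.Perm ℤ} (hσ : σ⁻¹ = σ) (h : σ x < σ (x + 1)) (t : ℤ) :
    dact x σ t = if σ x = x ∧ σ (x + 1) = x + 1 then σ (sPerm x t) else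
      sPerm x (σ (sPerm x t)) := by
  split_ifs with h'
  · rw [dact_fixed hσ h'.1 h'.2]; rfl
  · rw [dact_moved hσ h h']; rfl

theorem invol_apply {σ : Equiv.Perm ℤ} (hσ : σ⁻¹ = σ) (t : ℤ) : σ (σ t) = t := by
  have h : σ⁻¹ (σ t) = t := σ.symm_apply_apply t
  rwa [hσ] at h

theorem sPerm_of_far {x y : ℤ} (hf : Far x y) : sPerm x y = y ∧ sPerm x (y + 1) = y + 1 := by
  unfold Far at hf
  rw [sPerm_apply, sPerm_apply]
  constructor <;> split_ifs <;> omega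

theorem dact_far_apply {x y : ℤ} {σ : Equiv.Perm ℤ} (hσ : σ⁻¹ = σ) (hf : Far x y)
    (h : dact x σ y = y ∧ dact x σ (y + 1) = y + 1) : σ y = y ∧ σ (y + 1) = y + 1 := by
  by_cases ha : σ x < σ (x + 1)
  · have hinv : ∀ t, σ (σ t) = t := invol_apply hσ
    rw [dact_asc_apply hσ ha, dact_asc_apply hσ ha, (sPerm_of_far hf).1, (sPerm_of_far hf).2] at h
    have i1 := hinv y
    have i2 := hinv (y + 1)
    have i3 := hinv x
    have i4 := hinv (x + 1)
    simp only [sPerm_apply] at h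
    unfold Far at hf
    grind
  · rwa [dact_of_not_asc hσ ha] at h

theorem dact_far_apply' {x y : ℤ} {σ : Equiv.Perm ℤ} (hσ : σ⁻¹ = σ) (hf : Far x y)
    (h : σ y = y ∧ σ (y + 1) = y + 1) : dact x σ y = y ∧ dact x σ (y + 1) = y + 1 := by
  by_cases ha : σ x < σ (x + 1)
  · rw [dact_asc_apply hσ ha, dact_asc_apply hσ ha]
    simp only [sPerm_apply]
    unfold Far at hf
    grind
  · rwa [dact_of_not_asc hσ ha]

theorem PC_comm {σ : Equiv.Perm ℤ} (hσ : σ⁻¹ = σ) {x y : Letter} (hf : Far x.ceil y.ceil)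
    (h : PC σ [x, y]) : PC σ [y, x] :=
  ⟨fun hp => dact_far_apply hσ hf (h.2.1 hp),
    fun hp => dact_far_apply' hσ hf.symm (h.1 hp), trivial⟩

theorem asc_triple {σ : Equiv.Perm ℤ} (hσ : σ⁻¹ = σ) {a b : ℤ} (hab : a = b + 1 ∨ b = a + 1)
    (h1 : σ a < σ (a + 1)) (h3 : dact b (dact a σ) a < dact b (dact a σ) (a + 1)) :
    σ b < σ (b + 1) := by
  by_contra hb
  have hbr : dact a (dact b (dact a σ)) = dact b (dact a (dact b σ)) := by
    rcases hab with rfl | rfl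
    · exact (dact_braid b σ).symm
    · exact dact_braid a σ
  rw [dact_of_not_asc hσ hb] at hbr
  have := dact_not_asc a (dact b (dact a σ))
  rw [hbr] at this
  exact this h3

theorem dact_shift_not_fixed {σ : Equiv.Perm ℤ} (hσ : σ⁻¹ = σ) {a b : ℤ}
    (hab : a = b + 1 ∨ b = a + 1) (ha : σ a < σ (a + 1)) (hb : σ b < σ (b + 1)) :
    ¬ (dact a σ b = b ∧ dact a σ (b + 1) = b + 1) := by
  by_cases hF : σ a = a ∧ σ (a + 1) = a + 1
  · rw [dact_fixed hσ hF.1 hF.2]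
    simp only [Equiv.Perm.mul_apply, sPerm_apply]
    rcases hab with rfl | rfl
    · have : σ (if b + 1 = b + 1 then b + 1 + 1 else if b + 1 = b + 1 + 1 then b + 1 else b + 1) =
        σ (b + 1 + 1) := by simp
      rw [this]; omega
    · have : σ (if a + 1 = a then a + 1 else if a + 1 = a + 1 then a else a + 1) = σ a := by simp
      rw [this]; omega
  · rw [dact_moved hσ ha hF]
    simp only [Equiv.Perm.mul_apply]
    rcases hab with rfl | rfl
    · have e1 : sPerm (b + 1) b = b := by rw [sPerm_apply]; split_ifs <;> omega
      have e2 : sPerm (b + 1) (b + 1) = b + 1 + 1 := by rw [sPerm_apply]; split_ifs <;> omega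
      rw [e1, e2, sPerm_apply, sPerm_apply]
      split_ifs <;> omega
    · have e1 : sPerm a (a + 1) = a := by rw [sPerm_apply]; split_ifs <;> omega
      have e2 : sPerm a (a + 1 + 1) = a + 1 + 1 := by rw [sPerm_apply]; split_ifs <;> omega
      rw [e1, e2, sPerm_apply, sPerm_apply]
      split_ifs <;> omega

theorem dact_dact_fixed {σ : Equiv.Perm ℤ} (hσ : σ⁻¹ = σ) {a b : ℤ}
    (hab : a = b + 1 ∨ b = a + 1) (ha : σ a < σ (a + 1)) (hb : σ b < σ (b + 1))
    (h2 : dact a σ b < dact a σ (b + 1))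
    (h : dact b (dact a σ) a = a ∧ dact b (dact a σ) (a + 1) = a + 1) :
    σ b = b ∧ σ (b + 1) = b + 1 := by
  have hσ1 : (dact a σ)⁻¹ = dact a σ := by rw [dact_inv, hσ]
  rw [dact_moved hσ1 h2 (dact_shift_not_fixed hσ hab ha hb)] at h
  simp only [Equiv.Perm.mul_apply] at h
  by_cases hF : σ a = a ∧ σ (a + 1) = a + 1
  · rw [dact_fixed hσ hF.1 hF.2] at h
    simp only [Equiv.Perm.mul_apply] at h
    rcases hab with rfl | rfl
    · have e1 : sPerm b (b + 1) = b := by rw [sPerm_apply]; split_ifs <;> omega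
      have e2 : sPerm b (b + 1 + 1) = b + 1 + 1 := by rw [sPerm_apply]; split_ifs <;> omega
      have e3 : sPerm (b + 1) (b + 1 + 1) = b + 1 := by rw [sPerm_apply]; split_ifs <;> omega
      rw [e2, e3, hF.1, e1] at h
      omega
    · have e1 : sPerm (a + 1) a = a := by rw [sPerm_apply]; split_ifs <;> omega
      have e2 : sPerm (a + 1) (a + 1) = a + 1 + 1 := by rw [sPerm_apply]; split_ifs <;> omega
      have e3 : sPerm a a = a + 1 := by rw [sPerm_apply]; split_ifs <;> omega
      rw [e1, e3, hF.2, e2] at h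
      omega
  · rw [dact_moved hσ ha hF] at h
    simp only [Equiv.Perm.mul_apply] at h
    rcases hab with rfl | rfl
    · have e1 : sPerm b (b + 1) = b := by rw [sPerm_apply]; split_ifs <;> omega
      have e2 : sPerm b (b + 1 + 1) = b + 1 + 1 := by rw [sPerm_apply]; split_ifs <;> omega
      have e3 : sPerm (b + 1) (b + 1 + 1) = b + 1 := by rw [sPerm_apply]; split_ifs <;> omega
      have e4 : sPerm (b + 1) b = b := by rw [sPerm_apply]; split_ifs <;> omega
      rw [e1, e2, e3, e4] at h
      simp only [sPerm_apply] at h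
      grind
    · have e1 : sPerm (a + 1) a = a := by rw [sPerm_apply]; split_ifs <;> omega
      have e2 : sPerm (a + 1) (a + 1) = a + 1 + 1 := by rw [sPerm_apply]; split_ifs <;> omega
      have e3 : sPerm a a = a + 1 := by rw [sPerm_apply]; split_ifs <;> omega
      have e4 : sPerm a (a + 1 + 1) = a + 1 + 1 := by rw [sPerm_apply]; split_ifs <;> omega
      rw [e1, e2, e3, e4] at h
      simp only [sPerm_apply] at h
      grind

theorem braid_window {σ : Equiv.Perm ℤ} (hσ : σ⁻¹ = σ) {a b : ℤ} {p s q : Bool}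
    (hab : a = b + 1 ∨ b = a + 1) (hp : PC σ [⟨a, p⟩, ⟨b, s⟩, ⟨a, q⟩])
    (ha : Asc σ [⟨a, p⟩, ⟨b, s⟩, ⟨a, q⟩]) :
    s = false ∧ PC σ [⟨b, q⟩, ⟨a, false⟩, ⟨b, p⟩] := by
  obtain ⟨p1, p2, p3, -⟩ := hp
  obtain ⟨a1, a2, a3, -⟩ := ha
  simp only at p1 p2 p3 a1 a2 a3
  have hb := asc_triple hσ hab a1 a3
  refine ⟨?_, fun hq => dact_dact_fixed hσ hab a1 hb a2 (p3 hq), by simp, fun hpt => ?_, trivial⟩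
  · cases s
    · rfl
    · exact absurd (p2 rfl) (dact_shift_not_fixed hσ hab a1 hb)
  · obtain ⟨f1, f2⟩ := p1 hpt
    have hσ1 : (dact a σ)⁻¹ = dact a σ := by rw [dact_inv, hσ]
    have hσ2 : (dact b σ)⁻¹ = dact b σ := by rw [dact_inv, hσ]
    rw [dact_moved hσ1 a2 (dact_shift_not_fixed hσ hab a1 hb), dact_fixed hσ f1 f2] at a3
    simp only [Equiv.Perm.mul_apply] at a3
    simp only
    rcases hab with rfl | rfl
    · have e1 : sPerm b (b + 1) = b := by rw [sPerm_apply]; split_ifs <;> omega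
      have e2 : sPerm b (b + 1 + 1) = b + 1 + 1 := by rw [sPerm_apply]; split_ifs <;> omega
      have e3 : sPerm (b + 1) (b + 1 + 1) = b + 1 := by rw [sPerm_apply]; split_ifs <;> omega
      have e4 : sPerm (b + 1) b = b := by rw [sPerm_apply]; split_ifs <;> omega
      have e5 : sPerm b b = b + 1 := by rw [sPerm_apply]; split_ifs <;> omega
      have e6 : sPerm (b + 1) (b + 1) = b + 1 + 1 := by rw [sPerm_apply]; split_ifs <;> omega
      rw [e1, e2, e3, e4, f1, e1] at a3
      have hne : σ b ≠ b := fun h => by rw [h, e5] at a3; omega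
      have hlt : σ b < b := by omega
      have e7 : sPerm b (σ b) = σ b := by rw [sPerm_apply]; split_ifs <;> omega
      have hm := dact_moved hσ hb (fun h => hne h.1)
      have v1 : dact b σ b = b := by
        rw [hm]; simp only [Equiv.Perm.mul_apply]; rw [e5, f1, e1]
      have v2 : dact b σ (b + 1) = σ b := by
        rw [hm]; simp only [Equiv.Perm.mul_apply]; rw [e1, e7]
      have v3 : dact b σ (b + 1 + 1) = b + 1 + 1 := by
        rw [hm]; simp only [Equiv.Perm.mul_apply]; rw [e2, f2, e2]
      rw [dact_moved hσ2 (by omega) (by omega)]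
      simp only [Equiv.Perm.mul_apply]
      rw [e4, e6, v1, v3, e4, e3]
      simp
    · have e1 : sPerm (a + 1) a = a := by rw [sPerm_apply]; split_ifs <;> omega
      have e2 : sPerm (a + 1) (a + 1) = a + 1 + 1 := by rw [sPerm_apply]; split_ifs <;> omega
      have e3 : sPerm a a = a + 1 := by rw [sPerm_apply]; split_ifs <;> omega
      have e4 : sPerm a (a + 1 + 1) = a + 1 + 1 := by rw [sPerm_apply]; split_ifs <;> omega
      have e5 : sPerm (a + 1) (a + 1 + 1) = a + 1 := by rw [sPerm_apply]; split_ifs <;> omega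
      have e6 : sPerm a (a + 1) = a := by rw [sPerm_apply]; split_ifs <;> omega
      rw [e1, e2, e3, e4, f2, e2] at a3
      have hne : σ (a + 1 + 1) ≠ a + 1 + 1 := fun h => by rw [h, e5] at a3; omega
      have hlt : a + 1 + 1 < σ (a + 1 + 1) := by omega
      have e7 : sPerm (a + 1) (σ (a + 1 + 1)) = σ (a + 1 + 1) := by
        rw [sPerm_apply]; split_ifs <;> omega
      have hm := dact_moved hσ hb (fun h => hne h.2)
      have v1 : dact (a + 1) σ a = a := by
        rw [hm]; simp only [Equiv.Perm.mul_apply]; rw [e1, f1, e1]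
      have v2 : dact (a + 1) σ (a + 1) = σ (a + 1 + 1) := by
        rw [hm]; simp only [Equiv.Perm.mul_apply]; rw [e2, e7]
      have v3 : dact (a + 1) σ (a + 1 + 1) = a + 1 + 1 := by
        rw [hm]; simp only [Equiv.Perm.mul_apply]; rw [e5, f2, e2]
      rw [dact_moved hσ2 (by omega) (by omega)]
      simp only [Equiv.Perm.mul_apply]
      rw [e6, e4, v1, v3, e3, e4]
      simp

theorem one_inv_eq : (1 : Equiv.Perm ℤ)⁻¹ = 1 := inv_one

theorem locCls_RinvPlus (z : Equiv.Perm ℤ) : LocCls fun w => w ∈ RinvPlus z where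
  comm A x y B h hf := by
    have h' : A ++ [x, y] ++ B ∈ RinvPlus z := by simpa using h
    have hi := act_inv one_inv_eq A
    have := RinvPlus_window (w' := [y, x]) h' rfl (by simp [act, dact_far hf])
      (PC_comm hi hf (RinvPlus_PC h').1)
    simpa using this
  braid A a b p s q B h hf := by
    have h' : A ++ [⟨a, p⟩, ⟨b, s⟩, ⟨a, q⟩] ++ B ∈ RinvPlus z := by simpa using h
    have hi := act_inv one_inv_eq A
    obtain ⟨h1, h2⟩ := RinvPlus_PC h'
    obtain ⟨h3, h4⟩ := braid_window hi hf h1 h2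
    refine ⟨h3, ?_⟩
    have := RinvPlus_window (w' := [⟨b, q⟩, ⟨a, false⟩, ⟨b, p⟩]) h' rfl (by
      rcases hf with rfl | rfl
      · simp [act, dact_braid b]
      · simp [act, dact_braid a]) h4
    simpa using this
  ne A x y B h he := by
    have h' : A ++ [x, y] ++ B ∈ RinvPlus z := by simpa using h
    have := (RinvPlus_PC h').2.2.1
    rw [← he] at this
    exact dact_not_asc _ _ this
  prime A a b p q B h hf hp hq := by
    have h' : A ++ [⟨a, p⟩, ⟨b, q⟩] ++ B ∈ RinvPlus z := by simpa using h
    have hi := act_inv one_inv_eq A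
    obtain ⟨⟨h1, h2, -⟩, h3, -⟩ := RinvPlus_PC h'
    obtain ⟨h4, h5⟩ := h1 hp
    have := h2 hq
    rw [dact_asc_apply hi h3, dact_asc_apply hi h3] at this
    simp only [sPerm_apply] at this h4 h5
    grind

theorem front_toggle {z : Equiv.Perm ℤ} {a : ℤ} {p : Bool} {B : PWord}
    (h : ⟨a, p⟩ :: B ∈ RinvPlus z) (q : Bool) : ⟨a, q⟩ :: B ∈ RinvPlus z :=
  RinvPlus_window (L := []) (w := [⟨a, p⟩]) (w' := [⟨a, q⟩]) h rfl rfl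
    ⟨fun _ => by simp [act], trivial⟩

theorem front_adj {z : Equiv.Perm ℤ} {a b : ℤ} {p q : Bool} {B : PWord}
    (h : ⟨a, p⟩ :: ⟨b, q⟩ :: B ∈ RinvPlus z) (hab : a = b + 1 ∨ b = a + 1) :
    q = false ∧ ⟨b, p⟩ :: ⟨a, false⟩ :: B ∈ RinvPlus z := by
  have h' : [] ++ [⟨a, p⟩, ⟨b, q⟩] ++ B ∈ RinvPlus z := h
  refine ⟨?_, RinvPlus_window (L := []) (w' := [⟨b, p⟩, ⟨a, false⟩]) h' rfl ?_ ?_⟩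
  · obtain ⟨⟨-, h2, -⟩, -⟩ := RinvPlus_PC h'
    cases q
    · rfl
    · have := h2 rfl
      simp only [act, List.foldl_nil] at this
      rw [dact_asc_apply one_inv_eq (by simp), dact_asc_apply one_inv_eq (by simp)] at this
      simp only [sPerm_apply, Equiv.Perm.one_apply] at this
      grind
  · have e : ∀ x, dact x 1 = sPerm x := fun x => by
      rw [dact_fixed one_inv_eq (by simp) (by simp), one_mul]
    have : ∀ x y, (x = y + 1 ∨ y = x + 1) → dact x (sPerm y) = sPerm x * sPerm y * sPerm x := by
      intro x y hxy
      apply dact_moved (sPerm_inv y)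
      · simp only [sPerm_apply]; grind
      · simp only [sPerm_apply]; grind
    simp only [act, List.foldl_nil, List.foldl_cons, e]
    rw [this _ _ hab, this _ _ hab.symm]
    ext t
    simp only [Equiv.Perm.mul_apply, sPerm_apply]
    grind
  · exact ⟨fun _ => by simp [act], by simp [PC]⟩

theorem front_far {z : Equiv.Perm ℤ} {a b : ℤ} {p q : Bool} {B : PWord}
    (h : ⟨a, p⟩ :: ⟨b, q⟩ :: B ∈ RinvPlus z) (hab : Far a b) (p' q' : Bool) :
    ⟨a, p'⟩ :: ⟨b, q'⟩ :: B ∈ RinvPlus z := by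
  have h1 := (locCls_RinvPlus z).comm [] _ _ B h hab
  have h2 := (locCls_RinvPlus z).comm [] _ _ B (front_toggle h1 q') hab.symm
  exact front_toggle h2 p'

theorem front_no_triple {z : Equiv.Perm ℤ} {a b : ℤ} {p q r : Bool} {B : PWord}
    (h : ⟨a, p⟩ :: ⟨b, q⟩ :: ⟨a, r⟩ :: B ∈ RinvPlus z) (hab : a = b + 1 ∨ b = a + 1) : False :=
  (locCls_RinvPlus z).ne [_] _ _ _ (front_adj h hab).2 rfl

theorem RinvPlus_replace_prefix {z z' : Equiv.Perm ℤ} {a a' b : PWord} (ha : a ∈ RinvPlus z')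
    (ha' : a' ∈ RinvPlus z') (h : a ++ b ∈ RinvPlus z) : a' ++ b ∈ RinvPlus z := by
  rw [mem_RinvPlus_iff] at ha ha'
  have hl : a'.length = a.length :=
    le_antisymm (ha'.2.1 _ ha.1) (ha.2.1 _ ha'.1)
  have := RinvPlus_window (L := []) (w := a) (w' := a') (L' := b) (by simpa using h) hl
    (by simpa [act] using ha'.1.trans ha.1.symm) (by simpa [act] using ha'.2.2)
  simpa using this

theorem LocCls.move_left {K : PWord → Prop} (h : LocCls K) (A B : PWord) (x : Letter) (C : PWord)
    (hf : ∀ b ∈ B, Far b.ceil x.ceil) (hK : K (A ++ (B ++ x :: C))) : K (A ++ x :: (B ++ C)) := by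
  induction B generalizing A with
  | nil => exact hK
  | cons b B ih =>
    have := ih (A ++ [b]) (fun c hc => hf c (List.mem_cons_of_mem _ hc)) (by simpa using hK)
    exact h.comm A b x _ (by simpa using this) (hf b List.mem_cons_self)

theorem LocCls.move_right {K : PWord → Prop} (h : LocCls K) (A B : PWord) (x : Letter) (C : PWord)
    (hf : ∀ b ∈ B, Far b.ceil x.ceil) (hK : K (A ++ x :: (B ++ C))) : K (A ++ (B ++ x :: C)) := by
  induction B generalizing A with
  | nil => exact hK
  | cons b B ih =>
    have := h.comm A x b _ (by simpa using hK) (hf b List.mem_cons_self).symm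
    have := ih (A ++ [b]) (fun c hc => hf c (List.mem_cons_of_mem _ hc)) (by simpa using this)
    simpa using this

/-- Strictly increasing ceilings. -/
def Inc (R : PWord) : Prop := R.Pairwise fun a b => a.ceil < b.ceil

theorem insert_bump {K : PWord → Prop} (h : LocCls K) {A B : PWord} {m w : Letter} (hI : Inc (A ++ m :: B))
    (hA : ∀ a ∈ A, a.ceil < w.ceil) (hm : w.ceil < m.ceil) (hK : K (A ++ m :: B ++ [w])) :
    K (m :: (A ++ w :: B)) := by
  rw [Inc, List.pairwise_append, List.pairwise_cons] at hI
  have h1 := h.move_left (A ++ [m]) B w [] (fun b hb => Or.inr (by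
    have := hI.2.1.1 b hb; omega)) (by simpa using hK)
  have h2 := h.move_left [] A m (w :: B) (fun a ha => Or.inl (by
    have := hA a ha; omega)) (by simpa using h1)
  simpa using h2

theorem insert_eq {K : PWord → Prop} (h : LocCls K) {A B : PWord} {m w : Letter} (hI : Inc (A ++ m :: B))
    (hm : w.ceil = m.ceil) (hK : K (A ++ m :: B ++ [w])) :
    ∃ M B', B = M :: B' ∧ M.ceil = w.ceil + 1 ∧ M.primed = false ∧
      K (⟨w.ceil + 1, w.primed⟩ :: (A ++ ⟨m.ceil, false⟩ :: ⟨M.ceil, m.primed⟩ :: B')) := by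
  rw [Inc, List.pairwise_append, List.pairwise_cons] at hI
  obtain ⟨-, ⟨hmB, hB⟩, hA⟩ := hI
  cases B with
  | nil => exact absurd hm.symm (h.ne A m w [] (by simpa using hK))
  | cons M B =>
    rw [List.pairwise_cons] at hB
    have hmM := hmB M List.mem_cons_self
    have h1 := h.move_left (A ++ [m, M]) B w [] (fun b hb => Or.inr (by
      have := hB.1 b hb; omega)) (by simpa using hK)
    have hM : M.ceil = w.ceil + 1 := by
      by_contra hne
      have := h.comm (A ++ [m]) M w B (by simpa using h1) (Or.inr (by omega))
      exact h.ne A m w (M :: B) (by simpa using this) hm.symm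
    have em : m = ⟨w.ceil, m.primed⟩ := by rw [hm]
    have h2 := h.braid A w.ceil M.ceil m.primed M.primed w.primed B (by
      rw [← em]; simpa using h1) (Or.inr hM)
    refine ⟨M, B, rfl, hM, h2.1, ?_⟩
    have h3 := h.move_left [] A ⟨M.ceil, w.primed⟩ _ (fun a ha => Or.inl (by
      have := hA a ha m List.mem_cons_self
      show a.ceil + 1 < M.ceil; omega)) (by simpa using h2.2)
    simpa [hm, hM] using h3

theorem uninsert_bump {K : PWord → Prop} (h : LocCls K) {A B : PWord} {m o : Letter} (hI : Inc (A ++ m :: B))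
    (hm : m.ceil < o.ceil) (hB : ∀ b ∈ B, o.ceil < b.ceil) (hK : K (o :: (A ++ m :: B))) :
    K (A ++ o :: B ++ [m]) := by
  rw [Inc, List.pairwise_append, List.pairwise_cons] at hI
  have h1 := h.move_right [] A o (m :: B) (fun a ha => Or.inl (by
    have := hI.2.2 a ha m List.mem_cons_self; omega)) (by simpa using hK)
  have h2 := h.move_right (A ++ [o]) B m [] (fun b hb => Or.inr (by
    have := hB b hb; omega)) (by simpa using h1)
  simpa using h2

theorem uninsert_eq {K : PWord → Prop} (h : LocCls K) {A B : PWord} {M o : Letter} (hI : Inc (A ++ M :: B))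
    (hM : o.ceil = M.ceil) (hK : K (o :: (A ++ M :: B))) :
    ∃ A' m, A = A' ++ [m] ∧ m.ceil = o.ceil - 1 ∧ m.primed = false ∧
      K (A' ++ ⟨m.ceil, M.primed⟩ :: ⟨M.ceil, false⟩ :: B ++ [⟨o.ceil - 1, o.primed⟩]) := by
  rw [Inc, List.pairwise_append, List.pairwise_cons] at hI
  obtain ⟨hA, ⟨hMB, hB⟩, hAM⟩ := hI
  rcases List.eq_nil_or_concat' A with rfl | ⟨A', m, rfl⟩
  · exact absurd hM (h.ne [] o M B (by simpa using hK))
  · rw [List.pairwise_append] at hA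
    have hmM := hAM m (by simp) M List.mem_cons_self
    have h1 := h.move_right [] A' o (m :: M :: B) (fun a ha => Or.inl (by
      have := hA.2.2 a ha m (by simp)
      omega)) (by simpa using hK)
    have hm : m.ceil = o.ceil - 1 := by
      by_contra hne
      have := h.comm A' o m (M :: B) (by simpa using h1) (Or.inr (by omega))
      exact h.ne (A' ++ [m]) o M B (by simpa using this) hM
    have eM : M = ⟨o.ceil, M.primed⟩ := by rw [hM]
    have h2 := h.braid A' o.ceil m.ceil o.primed m.primed M.primed B (by
      rw [← eM]; simpa using h1) (Or.inl (by omega))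
    refine ⟨A', m, rfl, hm, h2.1, ?_⟩
    have h3 := h.move_right (A' ++ [⟨m.ceil, M.primed⟩, ⟨o.ceil, false⟩]) B ⟨m.ceil, o.primed⟩ []
      (fun b hb => Or.inr (by have := hMB b hb; show m.ceil + 1 < b.ceil; omega))
      (by simpa using h2.2)
    simpa [hm, hM] using h3

/-- The box `a` must be read before the box `b` when `a` lies weakly north-west of `b`. -/
def LinExt (l : List (ℕ × ℕ)) : Prop :=
  l.Pairwise fun a b => ¬ (a.1 ≤ b.1 ∧ b.2 ≤ a.2)

theorem LocCls.reorder {K : PWord → Prop} (h : LocCls K) {f : ℕ × ℕ → Letter}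
    {l₁ l₂ : List (ℕ × ℕ)} (hp : l₁.Perm l₂) (h₁ : LinExt l₁) (h₂ : LinExt l₂)
    (hf : ∀ a ∈ l₁, ∀ b ∈ l₁, a.1 < b.1 → a.2 < b.2 → Far (f a).ceil (f b).ceil) (A C : PWord)
    (hK : K (A ++ (l₁.map f ++ C))) : K (A ++ (l₂.map f ++ C)) := by
  induction l₂ generalizing l₁ A with
  | nil => rw [hp.eq_nil] at hK; exact hK
  | cons x l₂ ih =>
    obtain ⟨s, t, rfl⟩ := List.append_of_mem (hp.mem_iff.2 (List.mem_cons_self (a := x)))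
    have hp' : (s ++ t).Perm l₂ := by
      have := List.perm_middle.symm.trans hp
      exact List.perm_cons x |>.1 this
    rw [LinExt, List.pairwise_append, List.pairwise_cons] at h₁
    rw [LinExt, List.pairwise_cons] at h₂
    have hK' : K (A ++ f x :: (s.map f ++ (t.map f ++ C))) := by
      apply h.move_left A (s.map f) (f x)
      · intro b hb
        obtain ⟨b, hbs, rfl⟩ := List.mem_map.1 hb
        have n1 := h₁.2.2 b hbs x List.mem_cons_self
        have n2 := h₂.1 b (hp'.subset (List.mem_append_left _ hbs))
        rcases lt_or_ge b.1 x.1 with hlt | hge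
        · exact hf b (by simp [hbs]) x (by simp) hlt (by omega)
        · have : x.2 < b.2 := by omega
          exact (hf x (by simp) b (by simp [hbs]) (by omega) this).symm
      · simpa using hK
    have := ih (l₁ := s ++ t) hp' (by
        rw [LinExt, List.pairwise_append]
        exact ⟨h₁.1, h₁.2.1.2, fun a ha b hb => h₁.2.2 a ha b (List.mem_cons_of_mem _ hb)⟩) h₂.2
      (fun a ha b hb => hf a (by simp at ha ⊢; tauto) b (by simp at hb ⊢; tauto))
      (A ++ [f x]) (by simpa using hK')
    simpa using this

theorem LinExt.nodup {l : List (ℕ × ℕ)} (h : LinExt l) : l.Nodup :=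
  List.Pairwise.imp (fun hab => by rintro rfl; exact hab ⟨le_rfl, le_rfl⟩) h

/-- A partial filling of the boxes of the quarter plane. -/
abbrev Fil := ℕ × ℕ → Option Letter

theorem LocCls.reorderF {K : PWord → Prop} (h : LocCls K) {F : Fil}
    {l₁ l₂ : List (ℕ × ℕ)} (hm : ∀ p x, F p = some x → (p ∈ l₁ ↔ p ∈ l₂))
    (h₁ : LinExt l₁) (h₂ : LinExt l₂)
    (hf : ∀ a b x y, F a = some x → F b = some y → a.1 < b.1 → a.2 < b.2 → Far x.ceil y.ceil)
    (A C : PWord) (hK : K (A ++ (l₁.filterMap F ++ C))) : K (A ++ (l₂.filterMap F ++ C)) := by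
  have key : ∀ l : List (ℕ × ℕ), l.filterMap F =
      (l.filter fun p => (F p).isSome).map fun p => (F p).getD default := by
    intro l
    induction l with
    | nil => rfl
    | cons a l ih => cases hF : F a <;> simp [hF, ih]
  rw [key] at hK ⊢
  refine h.reorder ?_ (List.Pairwise.filter _ h₁) (List.Pairwise.filter _ h₂) ?_ A C hK
  · rw [List.perm_ext_iff_of_nodup (h₁.nodup.filter _) (h₂.nodup.filter _)]
    intro a
    cases hF : F a with
    | none => simp [hF]
    | some x => simp [hF, hm a x hF]
  · intro a ha b hb hab hab'
    rw [List.mem_filter, Option.isSome_iff_exists] at ha hb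
    obtain ⟨-, x, hx⟩ := ha
    obtain ⟨-, y, hy⟩ := hb
    simpa [hx, hy] using hf a b x y hx hy hab hab'

open Classical in
/-- The boxes of `L` satisfying `P`. -/
noncomputable def sel (L : List (ℕ × ℕ)) (P : ℕ × ℕ → Prop) : List (ℕ × ℕ) := L.filter fun p => P p

/-- The entries of `F` in the boxes of `L` satisfying `P`. -/
noncomputable def rd (L : List (ℕ × ℕ)) (P : ℕ × ℕ → Prop) (F : Fil) : PWord :=
  (sel L P).filterMap F

theorem mem_sel {L : List (ℕ × ℕ)} {P : ℕ × ℕ → Prop} {p : ℕ × ℕ} : p ∈ sel L P ↔ p ∈ L ∧ P p := by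
  simp [sel]

theorem sel_pairwise {R : ℕ × ℕ → ℕ × ℕ → Prop} {L : List (ℕ × ℕ)} (h : L.Pairwise R)
    (P : ℕ × ℕ → Prop) : (sel L P).Pairwise R := List.Pairwise.filter _ h

theorem mem_rd {L : List (ℕ × ℕ)} {P : ℕ × ℕ → Prop} {F : Fil} {x : Letter} :
    x ∈ rd L P F ↔ ∃ p, p ∈ L ∧ P p ∧ F p = some x := by
  simp [rd, mem_sel, and_assoc]

theorem rd_split {R : ℕ × ℕ → ℕ × ℕ → Prop} {L : List (ℕ × ℕ)} (hL : L.Pairwise R)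
    {P P₁ P₂ : ℕ × ℕ → Prop} (F : Fil) (hR : ∀ a b, P₂ a → P₁ b → ¬ R a b)
    (h : ∀ p, P p ↔ P₁ p ∨ P₂ p) (hd : ∀ p, P₁ p → ¬ P₂ p) :
    rd L P F = rd L P₁ F ++ rd L P₂ F := by
  have : sel L P = sel L P₁ ++ sel L P₂ := by
    induction L with
    | nil => rfl
    | cons a L ih =>
      rw [List.pairwise_cons] at hL
      have ih := ih hL.2
      unfold sel at ih ⊢
      by_cases h1 : P₁ a
      · have h0 : P a := (h a).2 (Or.inl h1)
        have h2 := hd a h1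
        simp [h0, h1, h2, ih]
      · by_cases h2 : P₂ a
        · have h0 : P a := (h a).2 (Or.inr h2)
          have h3 : ∀ b ∈ L, ¬ P₁ b := fun b hb h1 => hR a b h2 h1 (hL.1 b hb)
          have h4 : sel L P₁ = [] := by
            simpa [sel, List.filter_eq_nil_iff] using h3
          unfold sel at h4
          simp [h0, h1, h2, ih, h4]
        · have h0 : ¬ P a := fun h0 => ((h a).1 h0).elim h1 h2
          simp [h0, h1, h2, ih]
  rw [rd, this, List.filterMap_append]; rfl

theorem rd_congr {L : List (ℕ × ℕ)} {P P' : ℕ × ℕ → Prop} {F G : Fil}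
    (h : ∀ q ∈ L, P q → P' q → F q = G q) (h₁ : ∀ q ∈ L, P q → ¬ P' q → F q = none)
    (h₂ : ∀ q ∈ L, P' q → ¬ P q → G q = none) : rd L P F = rd L P' G := by
  unfold rd sel
  induction L with
  | nil => rfl
  | cons a L ih =>
    have ih := ih (fun q hq => h q (List.mem_cons_of_mem _ hq))
      (fun q hq => h₁ q (List.mem_cons_of_mem _ hq)) (fun q hq => h₂ q (List.mem_cons_of_mem _ hq))
    have h := h a List.mem_cons_self
    have h₁ := h₁ a List.mem_cons_self
    have h₂ := h₂ a List.mem_cons_self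
    by_cases hP : P a <;> by_cases hP' : P' a
    · simp [hP, hP', ih, List.filterMap_cons, h hP hP']
    · simp [hP, hP', ih, h₁ hP hP']
    · simp [hP, hP', ih, h₂ hP' hP]
    · simp [hP, hP', ih]

theorem rd_eq_nil {L : List (ℕ × ℕ)} {P : ℕ × ℕ → Prop} {F : Fil}
    (h : ∀ q ∈ L, P q → F q = none) : rd L P F = [] := by
  rw [rd, List.filterMap_eq_nil_iff]
  intro a ha
  exact h a (mem_sel.1 ha).1 (mem_sel.1 ha).2

theorem rd_single {L : List (ℕ × ℕ)} (hL : L.Nodup) {P : ℕ × ℕ → Prop} {F : Fil} {p : ℕ × ℕ}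
    {x : Letter} (hp : p ∈ L) (hF : F p = some x) (hP : ∀ q, P q ↔ q = p) : rd L P F = [x] := by
  have : sel L P = [p] := by
    obtain rfl : P = fun q => q = p := funext fun q => propext (hP q)
    have hn : (sel L (fun q => q = p)).Nodup := hL.filter _
    have hm : ∀ q, q ∈ sel L (fun q => q = p) ↔ q ∈ [p] := by
      intro q; rw [mem_sel, List.mem_singleton]; constructor
      · exact fun h => h.2
      · rintro rfl; exact ⟨hp, rfl⟩
    exact List.perm_singleton.1 ((List.perm_ext_iff_of_nodup hn (List.nodup_singleton p)).2 hm)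
  simp [rd, this, hF]

/-- The boxes with coordinates below `N`, row by row from the last row. -/
def RR (N : ℕ) : List (ℕ × ℕ) :=
  (List.range N).reverse.flatMap fun r => (List.range N).map fun c => (r, c)

/-- The boxes with coordinates below `N`, column by column, each from top to bottom. -/
def CR (N : ℕ) : List (ℕ × ℕ) := ((RR N).map Prod.swap).reverse

theorem mem_RR {N : ℕ} {p : ℕ × ℕ} : p ∈ RR N ↔ p.1 < N ∧ p.2 < N := by
  obtain ⟨a, b⟩ := p
  simp [RR]

theorem RR_pairwise (N : ℕ) :
    (RR N).Pairwise fun a b => b.1 < a.1 ∨ (a.1 = b.1 ∧ a.2 < b.2) := by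
  rw [RR, List.pairwise_flatMap]
  constructor
  · intro a _
    rw [List.pairwise_map]
    exact List.pairwise_lt_range.imp fun h => Or.inr ⟨rfl, h⟩
  · rw [List.pairwise_reverse]
    refine List.pairwise_lt_range.imp fun h => ?_
    intro x hx y hy
    simp only [List.mem_map] at hx hy
    obtain ⟨_, _, rfl⟩ := hx
    obtain ⟨_, _, rfl⟩ := hy
    exact Or.inl h

theorem mem_CR {N : ℕ} {p : ℕ × ℕ} : p ∈ CR N ↔ p.1 < N ∧ p.2 < N := by
  rw [CR, List.mem_reverse, List.mem_map]
  constructor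
  · rintro ⟨q, hq, rfl⟩
    exact (mem_RR.1 hq).symm
  · intro h
    exact ⟨p.swap, mem_RR.2 h.symm, Prod.swap_swap p⟩

theorem CR_pairwise (N : ℕ) :
    (CR N).Pairwise fun a b => a.2 < b.2 ∨ (a.2 = b.2 ∧ b.1 < a.1) := by
  rw [CR, List.pairwise_reverse, List.pairwise_map]
  refine (RR_pairwise N).imp fun h => ?_
  simp only [Prod.fst_swap, Prod.snd_swap]
  omega

theorem RR_nodup (N : ℕ) : (RR N).Nodup :=
  (RR_pairwise N).imp fun h => by rintro rfl; omega

theorem CR_nodup (N : ℕ) : (CR N).Nodup :=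
  (CR_pairwise N).imp fun h => by rintro rfl; omega

theorem linExt_RR (N : ℕ) : LinExt (RR N) := (RR_pairwise N).imp fun h => by omega

theorem linExt_CR (N : ℕ) : LinExt (CR N) := (CR_pairwise N).imp fun h => by omega

theorem linExt_sel {L : List (ℕ × ℕ)} (h : LinExt L) (P : ℕ × ℕ → Prop) : LinExt (sel L P) :=
  sel_pairwise h P

/-- The transposed filling. -/
def tr (F : Fil) : Fil := fun p => F (p.2, p.1)

@[simp] theorem tr_apply (F : Fil) (a b : ℕ) : tr F (a, b) = F (b, a) := rfl

@[simp] theorem tr_tr (F : Fil) : tr (tr F) = F := rfl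

theorem rd_RR_reverse (N : ℕ) (P : ℕ × ℕ → Prop) (F : Fil) :
    (rd (RR N) P F).reverse = rd (CR N) (fun p => P (p.2, p.1)) (tr F) := by
  unfold rd sel CR
  rw [← List.filterMap_reverse, ← List.filter_reverse, ← List.map_reverse, List.filter_map,
    List.filterMap_map]
  rfl

theorem line_split {N i j : ℕ} {F : Fil} {x : Letter} (hF : F (i, j) = some x) (hi : i < N)
    (hj : j < N) : rd (RR N) (fun p => p.1 = i) F =
      rd (RR N) (fun p => p.1 = i ∧ p.2 < j) F ++ x :: rd (RR N) (fun p => p.1 = i ∧ j < p.2) F := by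
  rw [rd_split (RR_pairwise N) (P₁ := fun p => p.1 = i ∧ p.2 < j)
    (P₂ := fun p => p.1 = i ∧ j ≤ p.2) F, rd_split (RR_pairwise N) (P := fun p => p.1 = i ∧ j ≤ p.2)
    (P₁ := fun p => p = (i, j))
    (P₂ := fun p => p.1 = i ∧ j < p.2) F, rd_single (RR_nodup N) (p := (i, j)) (x := x) (mem_RR.2 ⟨hi, hj⟩) hF
    (fun q => Iff.rfl)]
  · rfl
  all_goals simp only [Prod.forall, Prod.mk.injEq]; intros; omega

theorem rows_split (N i : ℕ) (F : Fil) : rd (RR N) (fun p => i ≤ p.1) F =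
    rd (RR N) (fun p => i + 1 ≤ p.1) F ++ rd (RR N) (fun p => p.1 = i) F := by
  apply rd_split (RR_pairwise N)
  all_goals intros; omega

theorem rows_split' (N i : ℕ) (F : Fil) : rd (RR N) (fun p => p.1 < i + 1) F =
    rd (RR N) (fun p => p.1 = i) F ++ rd (RR N) (fun p => p.1 < i) F := by
  apply rd_split (RR_pairwise N)
  all_goals intros; omega

/-- The boxes allowed in a shifted diagram, or in its transpose. -/
def Vd : Bool → ℕ → ℕ → Prop
  | false, i, j => i ≤ j
  | true, i, j => j ≤ i

/-- Increasing shifted (or, when `b` is set, transposed shifted) tableaux. -/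
structure Tab (N : ℕ) (b : Bool) (G : Fil) : Prop where
  vd : ∀ {i j x}, G (i, j) = some x → Vd b i j
  lt : ∀ {i j x}, G (i, j) = some x → i < N ∧ j < N
  cl : ∀ {i j i' j' x}, G (i, j) = some x → i' ≤ i → j' ≤ j → Vd b i' j' → ∃ y, G (i', j') = some y
  mono : ∀ {i j i' j' x y}, G (i, j) = some x → G (i', j') = some y → i ≤ i' → j ≤ j' →
    (i < i' ∨ j < j') → x.ceil < y.ceil
  diag : ∀ {i x}, G (i, i) = some x → x.primed = false

/-- Replace the entry in box `(i, j)`. -/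
def upd (G : Fil) (i j : ℕ) (x : Letter) : Fil := fun p => if p = (i, j) then some x else G p

theorem upd_apply (G : Fil) (i j : ℕ) (x : Letter) (a b : ℕ) :
    upd G i j x (a, b) = if a = i ∧ b = j then some x else G (a, b) := by
  simp [upd]

@[simp] theorem upd_self (G : Fil) (i j : ℕ) (x : Letter) : upd G i j x (i, j) = some x := by
  simp [upd]

theorem upd_ne {G : Fil} {i j a b : ℕ} {x : Letter} (h : a ≠ i ∨ b ≠ j) :
    upd G i j x (a, b) = G (a, b) := by
  rw [upd_apply, if_neg (by omega)]

theorem tr_upd (G : Fil) (i j : ℕ) (x : Letter) : tr (upd G i j x) = upd (tr G) j i x := by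
  funext ⟨a, b⟩
  simp only [tr_apply, upd_apply, and_comm]

theorem upd_upd (G : Fil) (i j : ℕ) (x y : Letter) : upd (upd G i j x) i j y = upd G i j y := by
  funext p
  simp only [upd]
  split_ifs <;> rfl

theorem upd_eq_self {G : Fil} {i j : ℕ} {x : Letter} (h : G (i, j) = some x) : upd G i j x = G := by
  funext p
  simp only [upd]
  split_ifs with hp
  · rw [hp, h]
  · rfl

theorem upd_comm {G : Fil} {i j a b : ℕ} {x y : Letter} (h : a ≠ i ∨ b ≠ j) :
    upd (upd G i j x) a b y = upd (upd G a b y) i j x := by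
  funext p
  simp only [upd]
  split_ifs with h1 h2
  · rw [h1] at h2
    simp only [Prod.mk.injEq] at h2
    omega
  all_goals rfl

namespace Tab

variable {N : ℕ} {b : Bool} {G : Fil}

theorem tr (h : Tab N b G) : Tab N (!b) (tr G) where
  vd hx := by have := h.vd hx; cases b <;> exact this
  lt hx := (h.lt hx).symm
  cl hx hi hj hv := h.cl hx hj hi (by cases b <;> exact hv)
  mono hx hy hi hj hs := h.mono hx hy hj hi hs.symm
  diag hx := h.diag hx

theorem mono' (h : Tab N b G) {i j i' j' : ℕ} {x y : Letter} (hx : G (i, j) = some x)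
    (hy : G (i', j') = some y) (hi : i ≤ i') (hj : j ≤ j') : x.ceil ≤ y.ceil := by
  by_cases hs : i < i' ∨ j < j'
  · exact (h.mono hx hy hi hj hs).le
  · obtain rfl : i = i' := by omega
    obtain rfl : j = j' := by omega
    rw [hx] at hy
    cases hy
    exact le_rfl

theorem upd (h : Tab N b G) {i j : ℕ} {m x : Letter} (hm : G (i, j) = some m)
    (hlo : ∀ i' j' y, G (i', j') = some y → i' ≤ i → j' ≤ j → (i' < i ∨ j' < j) → y.ceil < x.ceil)
    (hhi : ∀ i' j' y, G (i', j') = some y → i ≤ i' → j ≤ j' → (i < i' ∨ j < j') → x.ceil < y.ceil)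
    (hd : i = j → x.primed = false) : Tab N b (upd G i j x) := by
  have pres : ∀ {a c y}, _root_.upd G i j x (a, c) = some y → ∃ y', G (a, c) = some y' := by
    intro a c y hy
    rw [upd_apply] at hy
    split_ifs at hy with hp
    · rw [hp.1, hp.2]; exact ⟨m, hm⟩
    · exact ⟨y, hy⟩
  constructor
  · intro a c y hy; obtain ⟨y', hy'⟩ := pres hy; exact h.vd hy'
  · intro a c y hy; obtain ⟨y', hy'⟩ := pres hy; exact h.lt hy'
  · intro a c a' c' y hy ha hc hv
    obtain ⟨y', hy'⟩ := pres hy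
    obtain ⟨t, ht⟩ := h.cl hy' ha hc hv
    rw [upd_apply]
    split_ifs
    · exact ⟨x, rfl⟩
    · exact ⟨t, ht⟩
  · intro a c a' c' s t hs ht ha hc hlt
    rw [upd_apply] at hs ht
    split_ifs at hs ht with h1 h2 h2
    · omega
    · cases hs
      obtain ⟨rfl, rfl⟩ := h1
      exact hhi _ _ _ ht ha hc hlt
    · cases ht
      obtain ⟨rfl, rfl⟩ := h2
      exact hlo _ _ _ hs ha hc hlt
    · exact h.mono hs ht ha hc hlt
  · intro a y hy
    rw [upd_apply] at hy
    split_ifs at hy with hp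
    · cases hy; exact hd (by omega)
    · exact h.diag hy

theorem upd_prime (h : Tab N b G) {i j : ℕ} {m x : Letter} (hm : G (i, j) = some m)
    (hx : x.ceil = m.ceil) (hd : i = j → x.primed = false) : Tab N b (_root_.upd G i j x) := by
  apply h.upd hm _ _ hd
  · intro i' j' y hy hi hj hs
    rw [hx]; exact h.mono hy hm hi hj hs
  · intro i' j' y hy hi hj hs
    rw [hx]; exact h.mono hm hy hi hj hs

theorem inc_line (h : Tab N b G) (i : ℕ) (P : ℕ × ℕ → Prop) (hP : ∀ p, P p → p.1 = i) :
    Inc (rd (RR N) P G) := by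
  rw [rd, Inc, List.pairwise_filterMap]
  refine List.Pairwise.imp_of_mem ?_ (sel_pairwise (RR_pairwise N) P)
  rintro ⟨a1, a2⟩ ⟨b1, b2⟩ ha hb hab x hx y hy
  have h1 := hP _ (mem_sel.1 ha).2
  have h2 := hP _ (mem_sel.1 hb).2
  dsimp only at h1 h2 hab
  subst h1 h2
  exact h.mono hx hy (by omega) (by omega) (by omega)

/-- Boxes strictly north-east of each other have far apart entries. -/
theorem far (h : Tab N false G) (a c : ℕ × ℕ) (x y : Letter) (hx : G a = some x) (hy : G c = some y)
    (h1 : a.1 < c.1) (h2 : a.2 < c.2) : Far x.ceil y.ceil := by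
  obtain ⟨a1, a2⟩ := a
  obtain ⟨c1, c2⟩ := c
  dsimp only at h1 h2
  have := h.vd hx
  obtain ⟨t, ht⟩ := h.cl hy h1.le le_rfl (show a1 ≤ c2 by simp only [Vd] at this; omega)
  have := h.mono hx ht le_rfl h2.le (Or.inr h2)
  have := h.mono ht hy h1.le le_rfl (Or.inl h1)
  left; omega

end Tab

/-- The reading word of a filling with the letter `w` about to be inserted into row `i`. -/
noncomputable def LW (N : ℕ) (G : Fil) (i : ℕ) (w : Letter) : PWord :=
  rd (RR N) (fun p => i ≤ p.1) G ++ w :: rd (RR N) (fun p => p.1 < i) G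

/-- Involution words, or reversed involution words when `b` is set. -/
def KK (z : Equiv.Perm ℤ) : Bool → PWord → Prop
  | false => fun w => w ∈ RinvPlus z
  | true => fun w => w.reverse ∈ RinvPlus z

theorem locCls_KK (z : Equiv.Perm ℤ) (b : Bool) : LocCls (KK z b) := by
  cases b
  · exact locCls_RinvPlus z
  · exact (locCls_RinvPlus z).reverse

/-- An insertion step changing row `i` away from the main diagonal. -/
inductive Bump (G : Fil) (i : ℕ) (w : Letter) : Fil → Letter → Prop
  | bump (j : ℕ) (m : Letter) (hj : i ≠ j) (hm : G (i, j) = some m)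
      (hlo : ∀ j' x, j' < j → G (i, j') = some x → x.ceil < w.ceil) (hw : w.ceil < m.ceil) :
      Bump G i w (upd G i j w) m
  | eq (j : ℕ) (m M : Letter) (hj : i ≠ j) (hm : G (i, j) = some m) (hM : G (i, j + 1) = some M)
      (hw : m.ceil = w.ceil) (hw' : M.ceil = w.ceil + 1) (hp : M.primed = false) :
      Bump G i w (upd (upd G i j ⟨m.ceil, false⟩) i (j + 1) ⟨M.ceil, m.primed⟩) w.succL

theorem LW_split (N : ℕ) (G : Fil) (i : ℕ) (w : Letter) : LW N G i w =
    rd (RR N) (fun p => i + 1 ≤ p.1) G ++ (rd (RR N) (fun p => p.1 = i) G ++ [w]) ++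
      rd (RR N) (fun p => p.1 < i) G := by
  rw [LW, rows_split]; simp

theorem LW_split' (N : ℕ) (G : Fil) (i : ℕ) (w : Letter) : LW N G (i + 1) w =
    rd (RR N) (fun p => i + 1 ≤ p.1) G ++ (w :: rd (RR N) (fun p => p.1 = i) G) ++
      rd (RR N) (fun p => p.1 < i) G := by
  rw [LW, rows_split']; simp

theorem line_split_eq {N i j : ℕ} {F : Fil} {M : Letter} (hM : F (i, j + 1) = some M) (hi : i < N)
    (hj : j + 1 < N) : rd (RR N) (fun p => p.1 = i ∧ j < p.2) F =
      M :: rd (RR N) (fun p => p.1 = i ∧ j + 1 < p.2) F := by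
  rw [rd_split (RR_pairwise N) (P := fun p => p.1 = i ∧ j < p.2)
    (P₁ := fun p => p = (i, j + 1))
    (P₂ := fun p => p.1 = i ∧ j + 1 < p.2) F, rd_single (RR_nodup N) (p := (i, j + 1)) (x := M)
      (mem_RR.2 ⟨hi, hj⟩) hM (fun q => Iff.rfl)]
  · rfl
  all_goals simp only [Prod.forall, Prod.mk.injEq]; intros; omega

theorem rd_upd {L : List (ℕ × ℕ)} {P : ℕ × ℕ → Prop} {F : Fil} {i j : ℕ} {x : Letter}
    (h : ¬ P (i, j)) : rd L P (upd F i j x) = rd L P F := by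
  refine rd_congr ?_ (fun q _ h h' => absurd h h') (fun q _ h h' => absurd h h')
  intro q _ hq _
  rw [upd, if_neg]
  rintro rfl
  exact h hq

section Line

variable {N : ℕ} {b : Bool} {G : Fil} {K : PWord → Prop}

theorem LW_bump (hK : LocCls K) (hT : Tab N b G) {i j : ℕ} {m w : Letter}
    (hm : G (i, j) = some m)
    (hlo : ∀ j' x, j' < j → G (i, j') = some x → x.ceil < w.ceil) (hw : w.ceil < m.ceil)
    (h : K (LW N G i w)) : K (LW N (upd G i j w) (i + 1) m) := by
  have hN := hT.lt hm
  have hI := hT.inc_line i (fun p => p.1 = i) (fun p h => h)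
  rw [LW_split, line_split hm hN.1 hN.2] at h
  rw [line_split hm hN.1 hN.2] at hI
  have := insert_bump (hK.context _ _) hI (w := w) ?_ hw h
  · rw [LW_split', line_split (upd_self G i j w) hN.1 hN.2, rd_upd (by simp), rd_upd (by simp),
      rd_upd (by simp), rd_upd (by simp)]
    exact this
  · intro a ha
    obtain ⟨⟨p1, p2⟩, -, ⟨h1, h2⟩, h3⟩ := mem_rd.1 ha
    dsimp only at h1 h2
    subst h1
    exact hlo _ _ h2 h3

theorem LW_eq (hK : LocCls K) (hT : Tab N b G) {i j : ℕ} {m w : Letter}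
    (hm : G (i, j) = some m) (hw : m.ceil = w.ceil) (h : K (LW N G i w)) :
    ∃ M, G (i, j + 1) = some M ∧ M.ceil = w.ceil + 1 ∧ M.primed = false ∧
      K (LW N (upd (upd G i j ⟨m.ceil, false⟩) i (j + 1) ⟨M.ceil, m.primed⟩) (i + 1) w.succL) := by
  have hN := hT.lt hm
  have hI := hT.inc_line i (fun p => p.1 = i) (fun p h => h)
  rw [LW_split, line_split hm hN.1 hN.2] at h
  rw [line_split hm hN.1 hN.2] at hI
  obtain ⟨M, B', hB, hM, hp, hres⟩ := insert_eq (hK.context _ _) hI hw.symm h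
  have hx : M ∈ rd (RR N) (fun p => p.1 = i ∧ j < p.2) G := by rw [hB]; simp
  obtain ⟨⟨p1, p2⟩, -, ⟨h1, h2⟩, h3⟩ := mem_rd.1 hx
  dsimp only at h1 h2
  subst h1
  obtain ⟨M', hM'⟩ := hT.cl h3 (j' := j + 1) le_rfl h2 (by
    have := hT.vd hm
    have := hT.vd h3
    cases b <;> simp only [Vd] at * <;> omega)
  rw [line_split_eq hM' hN.1 (hT.lt hM').2] at hB
  cases hB
  refine ⟨M, hM', hM, hp, ?_⟩
  rw [LW_split', line_split (j := j) (x := ⟨m.ceil, false⟩) (by rw [upd_ne (by omega), upd_self])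
    hN.1 hN.2, line_split_eq (M := ⟨M.ceil, m.primed⟩) (upd_self _ _ _ _) hN.1 (hT.lt hM').2]
  iterate 8 rw [rd_upd (by simp)]
  exact hres

theorem LW_unbump (hK : LocCls K) (hT : Tab N b G) {i j : ℕ} {m o : Letter}
    (hm : G (i, j) = some m)
    (hhi : ∀ j' x, j < j' → G (i, j') = some x → o.ceil < x.ceil) (hw : m.ceil < o.ceil)
    (h : K (LW N G (i + 1) o)) : K (LW N (upd G i j o) i m) := by
  have hN := hT.lt hm
  have hI := hT.inc_line i (fun p => p.1 = i) (fun p h => h)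
  rw [LW_split', line_split hm hN.1 hN.2] at h
  rw [line_split hm hN.1 hN.2] at hI
  have := uninsert_bump (hK.context _ _) hI (o := o) hw ?_ h
  · rw [LW_split, line_split (upd_self G i j o) hN.1 hN.2, rd_upd (by simp), rd_upd (by simp),
      rd_upd (by simp), rd_upd (by simp)]
    exact this
  · intro a ha
    obtain ⟨⟨p1, p2⟩, -, ⟨h1, h2⟩, h3⟩ := mem_rd.1 ha
    dsimp only at h1 h2
    subst h1
    exact hhi _ _ h2 h3

theorem LW_uneq (hK : LocCls K) (hT : Tab N b G) {i j : ℕ} {M o : Letter}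
    (hM : G (i, j) = some M) (hw : M.ceil = o.ceil) (h : K (LW N G (i + 1) o)) :
    ∃ k m, j = k + 1 ∧ G (i, k) = some m ∧ m.ceil = o.ceil - 1 ∧ m.primed = false ∧
      K (LW N (upd (upd G i k ⟨m.ceil, M.primed⟩) i (k + 1) ⟨M.ceil, false⟩) i
        ⟨o.ceil - 1, o.primed⟩) := by
  have hN := hT.lt hM
  have hI := hT.inc_line i (fun p => p.1 = i) (fun p h => h)
  rw [LW_split', line_split hM hN.1 hN.2] at h
  rw [line_split hM hN.1 hN.2] at hI
  obtain ⟨A', m, hA, hm, hp, hres⟩ := uninsert_eq (hK.context _ _) hI hw.symm h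
  have hx : m ∈ rd (RR N) (fun p => p.1 = i ∧ p.2 < j) G := by rw [hA]; simp
  obtain ⟨⟨p1, p2⟩, -, ⟨h1, h2⟩, h3⟩ := mem_rd.1 hx
  dsimp only at h1 h2
  subst h1
  obtain ⟨k, rfl⟩ : ∃ k, j = k + 1 := ⟨j - 1, by omega⟩
  obtain ⟨m', hm'⟩ := hT.cl hM (j' := k) le_rfl (by omega) (by
    have := hT.vd hM
    have := hT.vd h3
    cases b <;> simp only [Vd] at * <;> omega)
  have hsp : rd (RR N) (fun p => p.1 = p1 ∧ p.2 < k + 1) G =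
      rd (RR N) (fun p => p.1 = p1 ∧ p.2 < k) G ++ [m'] := by
    rw [rd_split (RR_pairwise N) (P := fun p => p.1 = p1 ∧ p.2 < k + 1)
      (P₁ := fun p => p.1 = p1 ∧ p.2 < k)
      (P₂ := fun p => p = (p1, k)) G, rd_single (RR_nodup N) (p := (p1, k)) (x := m')
      (mem_RR.2 ⟨hN.1, (hT.lt hm').2⟩) hm' (fun q => Iff.rfl)]
    all_goals simp only [Prod.forall, Prod.mk.injEq]; intros; omega
  rw [hsp] at hA
  obtain ⟨rfl, h4⟩ := List.append_inj' hA rfl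
  cases h4
  refine ⟨k, m, rfl, hm', hm, hp, ?_⟩
  rw [LW_split, line_split (j := k) (x := ⟨m.ceil, M.primed⟩) (by rw [upd_ne (by omega), upd_self])
    hN.1 (hT.lt hm').2, line_split_eq (M := ⟨M.ceil, false⟩) (upd_self _ _ _ _) hN.1 hN.2]
  iterate 8 rw [rd_upd (by simp)]
  simpa using hres

end Line

/-- Reachable intermediate stages of insertion: the letter `w` is about to be inserted into row `i`
of `G`, which is a transposed tableau when `b` is set. -/
structure Good (z : Equiv.Perm ℤ) (N : ℕ) (b : Bool) (i : ℕ) (G : Fil) (w : Letter) : Prop where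
  tab : Tab N b G
  word : KK z b (LW N G i w)
  pos : b = true → 0 < i
  wit : ∀ k, i = k + 1 → ∃ j x, (b = true ∨ j ≠ k) ∧ G (k, j) = some x ∧ x.ceil < w.ceil ∧
    ∀ y, G (i, j) = some y → w.ceil ≤ y.ceil
  ext : b = true → ∀ k x, i = k + 1 → G (i, k) = some x → x.ceil = w.ceil → x.primed = false

namespace Good

variable {z : Equiv.Perm ℤ} {N : ℕ} {b : Bool} {i : ℕ} {G : Fil} {w : Letter}

/-- The witness column is weakly to the right of the insertion column. -/
theorem wit_le (h : Good z N b i G w) {j k : ℕ} (hi : i = k + 1)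
    (hlo : ∀ j' x, j' < j → G (i, j') = some x → x.ceil < w.ceil)
    (hpr : ∀ j', j' < j → Vd b i j' → ∃ y, G (i, j') = some y) :
    ∃ j₀ x, (b = true ∨ j₀ ≠ k) ∧ j ≤ j₀ ∧ G (k, j₀) = some x ∧ x.ceil < w.ceil := by
  obtain ⟨j₀, x, h1, h2, h3, h4⟩ := h.wit k hi
  refine ⟨j₀, x, h1, ?_, h2, h3⟩
  by_contra hlt
  have hv := h.tab.vd h2
  obtain ⟨y, hy⟩ := hpr j₀ (by omega) (by cases b <;> simp_all [Vd] <;> omega)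
  have := hlo _ _ (by omega) hy
  have := h4 y hy
  omega

theorem lo (h : Good z N b i G w) {j : ℕ}
    (hlo : ∀ j' x, j' < j → G (i, j') = some x → x.ceil < w.ceil)
    (hpr : ∀ j', j' < j → Vd b i j' → ∃ y, G (i, j') = some y) :
    ∀ i' j' y, G (i', j') = some y → i' ≤ i → j' ≤ j → (i' < i ∨ j' < j) → y.ceil < w.ceil := by
  intro i' j' y hy hi hj hs
  by_cases he : i' = i
  · subst he
    exact hlo _ _ (by omega) hy
  · obtain ⟨k, rfl⟩ : ∃ k, i = k + 1 := ⟨i - 1, by omega⟩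
    obtain ⟨j₀, x, -, h1, h2, h3⟩ := h.wit_le rfl hlo hpr
    exact lt_of_le_of_lt (h.tab.mono' hy h2 (by omega) (by omega)) h3

theorem bump (h : Good z N b i G w) {G' : Fil} {o : Letter} (hB : Bump G i w G' o) :
    Good z N b (i + 1) G' o := by
  cases hB with
  | bump j m hj hm hlo hw =>
    constructor
    · refine h.tab.upd hm (h.lo hlo fun j' hj' hv => h.tab.cl hm le_rfl hj'.le hv) ?_
        (fun hij => absurd hij hj)
      intro i' j' y hy hi hj hs
      exact hw.trans (h.tab.mono hm hy hi hj hs)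
    · exact LW_bump (locCls_KK z b) h.tab hm hlo hw h.word
    · intro; omega
    · rintro k hk
      obtain rfl : i = k := by omega
      refine ⟨j, w, Or.inr hj.symm, upd_self _ _ _ _, hw, ?_⟩
      intro y hy
      rw [upd_ne (by omega)] at hy
      exact (h.tab.mono hm hy (by omega) le_rfl (by omega)).le
    · rintro rfl k x hk hx he
      obtain rfl : i = k := by omega
      rw [upd_ne (by omega)] at hx
      have := h.tab.vd hm
      have := h.tab.mono hm hx (by omega) this (by omega)
      omega
  | eq j m M hj hm hM hw hw' hp =>
    have hd : i = j + 1 → m.primed = false := by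
      intro hij
      have hv := h.tab.vd hm
      cases b
      · simp only [Vd] at hv; omega
      · exact h.ext rfl j m hij hm hw
    constructor
    · refine (h.tab.upd_prime (x := ⟨m.ceil, false⟩) hm rfl (fun _ => rfl)).upd_prime
        (m := M) ?_ rfl hd
      rw [upd_ne (by omega), hM]
    · obtain ⟨M', h1, h2, h3, h4⟩ := LW_eq (locCls_KK z b) h.tab hm hw h.word
      rw [hM] at h1
      cases h1
      exact h4
    · intro; omega
    · rintro k hk
      obtain rfl : i = k := by omega
      refine ⟨j, ⟨m.ceil, false⟩, Or.inr hj.symm, by rw [upd_ne (by omega), upd_self], ?_, ?_⟩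
      · simp only [Letter.succL]; omega
      intro y hy
      rw [upd_ne (by omega), upd_ne (by omega)] at hy
      have := h.tab.mono hm hy (by omega) le_rfl (by omega)
      simp only [Letter.succL]; omega
    · rintro rfl k x hk hx he
      obtain rfl : i = k := by omega
      rw [upd_ne (by omega), upd_ne (by omega)] at hx
      have := h.tab.vd hM
      have := h.tab.mono hM hx (by omega) this (by omega)
      simp only [Letter.succL] at he; omega

theorem progress (h : Good z N b i G w) :
    (∀ j x, G (i, j) = some x → x.ceil < w.ceil) ∨ (∃ G' o, Bump G i w G' o) ∨
    (b = false ∧ ∃ m, G (i, i) = some m ∧ w.ceil ≤ m.ceil) := by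
  classical
  by_cases hall : ∀ j x, G (i, j) = some x → x.ceil < w.ceil
  · exact Or.inl hall
  right
  push Not at hall
  have hex : ∃ j, ∃ x, G (i, j) = some x ∧ w.ceil ≤ x.ceil := by
    obtain ⟨j, x, h1, h2⟩ := hall; exact ⟨j, x, h1, h2⟩
  obtain ⟨x, hx, hwx⟩ := Nat.find_spec hex
  have hlo : ∀ j' x, j' < Nat.find hex → G (i, j') = some x → x.ceil < w.ceil := by
    intro j' y hj' hy
    by_contra hc
    exact Nat.find_min hex hj' ⟨y, hy, by omega⟩
  generalize Nat.find hex = j at *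
  by_cases hij : i = j
  · subst hij
    right
    cases hb : b with
    | false => exact ⟨rfl, x, hx, hwx⟩
    | true =>
      subst hb
      obtain ⟨k, hk⟩ : ∃ k, i = k + 1 := ⟨i - 1, by have := h.pos rfl; omega⟩
      obtain ⟨j₀, y, -, h1, h2, -⟩ := h.wit_le hk hlo
        (fun j' hj' hv => h.tab.cl hx le_rfl hj'.le hv)
      have := h.tab.vd h2
      simp only [Vd] at this
      omega
  · left
    rcases lt_or_eq_of_le hwx with hlt | heq
    · exact ⟨_, _, Bump.bump j x hij hx hlo hlt⟩
    · obtain ⟨M, h1, h2, h3, -⟩ := LW_eq (locCls_KK z b) h.tab hx heq.symm h.word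
      exact ⟨_, _, Bump.eq j x M hij hx h1 heq.symm h2 h3⟩

/-- Undoing a step within rows. -/
theorem unbump {k : ℕ} (h : Good z N b (k + 1) G w)
    (hd : b = true → ∀ x, G (k, k) = some x → w.ceil ≤ x.ceil) :
    ∃ G' u, Good z N b k G' u ∧ Bump G' k u G w := by
  classical
  obtain ⟨j, x₀, hjk, hx₀, hxw, hy₀⟩ := h.wit k rfl
  set P : ℕ → Prop := fun j => ∃ x, G (k, j) = some x ∧ x.ceil < w.ceil with hP
  have hjN : j ≤ N := (h.tab.lt hx₀).2.le
  have hPj : P j := ⟨x₀, hx₀, hxw⟩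
  obtain ⟨x, hx, hxw'⟩ := Nat.findGreatest_spec hjN hPj
  have hjle := Nat.le_findGreatest hjN hPj
  have hmax : ∀ j' y, Nat.findGreatest P N < j' → G (k, j') = some y → w.ceil ≤ y.ceil := by
    intro j' y h1 hy
    by_contra hc
    have := Nat.le_findGreatest (P := P) (h.tab.lt hy).2.le ⟨y, hy, by omega⟩
    omega
  generalize Nat.findGreatest P N = j₁ at *
  have hvx := h.tab.vd hx
  have hvj := h.tab.vd hx₀
  have hkj : k ≠ j₁ := by
    rintro rfl
    cases b with
    | false => simp [Vd] at *; omega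
    | true => have := hd rfl x hx; omega
  have hv' : Vd b (k + 1) j₁ := by cases b <;> simp only [Vd] at * <;> omega
  have hvj' : Vd b (k + 1) j := by cases b <;> simp [Vd] at * <;> omega
  -- entries before the insertion point in the previous row witness the source
  have hwit : ∀ l, k = l + 1 → ∃ y, G (l, j₁) = some y ∧ y.ceil < x.ceil := by
    intro l hl
    obtain ⟨y, hy⟩ := h.tab.cl hx (i' := l) (j' := j₁) (by omega) le_rfl
      (by cases b <;> simp only [Vd] at * <;> omega)
    exact ⟨y, hy, h.tab.mono hy hx (by omega) le_rfl (by omega)⟩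
  by_cases heq : ∃ y, G (k, j₁ + 1) = some y ∧ y.ceil = w.ceil
  · obtain ⟨y, hy, hyw⟩ := heq
    obtain ⟨l, m, hl, hm, hmo, hmp, hword⟩ := LW_uneq (locCls_KK z b) h.tab hy hyw h.word
    obtain rfl : j₁ = l := by omega
    rw [hx] at hm
    cases hm
    refine ⟨_, _, ⟨?_, hword, ?_, ?_, ?_⟩, ?_⟩
    · refine (h.tab.upd_prime (x := ⟨x.ceil, y.primed⟩) hx rfl (fun hk => absurd hk hkj)).upd_prime
        (m := y) ?_ rfl (fun _ => rfl)
      rw [upd_ne (by omega), hy]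
    · rintro rfl
      simp only [Vd] at hvx
      omega
    · intro l hl
      obtain ⟨t, ht, htx⟩ := hwit l hl
      refine ⟨j₁, t, ?_, ?_, ?_, ?_⟩
      · cases b <;> simp [Vd] at * <;> omega
      · rw [upd_ne (by omega), upd_ne (by omega), ht]
      · simp only; omega
      · intro s hs
        rw [upd_ne (by omega), upd_self] at hs
        cases hs
        simp only; omega
    · rintro rfl l s hl hs hsw
      rw [upd_apply, upd_apply] at hs
      simp only [true_and] at hs
      split_ifs at hs with h1 h2
      · cases hs; rfl
      · cases hs
        subst h2
        show y.primed = false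
        refine h.tab.diag (i := k) (x := y) ?_
        rw [← hy, show k = l + 1 by assumption]
      · have := h.tab.vd hy
        simp only [Vd] at this
        have := h.tab.mono hy hs le_rfl (by omega) (by omega)
        simp only at hsw
        omega
    · have := Bump.eq (G := upd (upd G k j₁ ⟨x.ceil, y.primed⟩) k (j₁ + 1) ⟨y.ceil, false⟩) (i := k)
        (w := ⟨w.ceil - 1, w.primed⟩) j₁ ⟨x.ceil, y.primed⟩ ⟨y.ceil, false⟩ hkj
        (by rw [upd_ne (by omega), upd_self]) (upd_self _ _ _ _) hmo (by simp only; omega) rfl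
      have e1 : (⟨w.ceil - 1, w.primed⟩ : Letter).succL = w := by simp [Letter.succL]
      have e2 : upd (upd (upd (upd G k j₁ ⟨x.ceil, y.primed⟩) k (j₁ + 1) ⟨y.ceil, false⟩) k j₁
          ⟨x.ceil, false⟩) k (j₁ + 1) ⟨y.ceil, y.primed⟩ = G := by
        rw [upd_comm (i := k) (j := j₁ + 1) (a := k) (b := j₁) (by omega), upd_upd, upd_upd,
          upd_eq_self (x := ⟨x.ceil, false⟩), upd_eq_self (x := ⟨y.ceil, y.primed⟩)]
        · exact hy
        · rw [← hmp]; exact hx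
      simp only at this
      rw [e1, e2] at this
      exact this
  · push Not at heq
    have hmax' : ∀ j' y, j₁ < j' → G (k, j') = some y → w.ceil < y.ceil := by
      intro j' y hj' hy
      obtain ⟨t, ht⟩ := h.tab.cl hy (i' := k) (j' := j₁ + 1) le_rfl hj' (by
        have := h.tab.vd hy
        cases b <;> simp only [Vd] at * <;> omega)
      have h1 := hmax _ _ (Nat.lt_succ_self _) ht
      have h2 := heq t ht
      have h3 := h.tab.mono' ht hy le_rfl hj'
      omega
    have habove : ∀ y, G (k + 1, j₁) = some y → w.ceil < y.ceil := by
      intro y hy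
      obtain ⟨t, ht⟩ := h.tab.cl hy (i' := k + 1) (j' := j) le_rfl hjle hvj'
      have h1 := hy₀ t ht
      have h2 := h.tab.mono' ht hy le_rfl hjle
      rcases lt_or_eq_of_le (h1.trans h2) with h3 | h3
      · exact h3
      · obtain ⟨M, hM, hM1, -⟩ := LW_eq (locCls_KK z b) h.tab hy h3.symm h.word
        obtain ⟨s, hs⟩ := h.tab.cl hM (i' := k) (j' := j₁ + 1) (by omega) le_rfl (by
          have := h.tab.vd hM
          cases b <;> simp only [Vd] at * <;> omega)
        have h4 := hmax' _ _ (Nat.lt_succ_self _) hs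
        have h5 := h.tab.mono hs hM (by omega) le_rfl (by omega)
        omega
    refine ⟨_, _, ⟨?_, LW_unbump (locCls_KK z b) h.tab hx hmax' hxw' h.word, ?_, ?_, ?_⟩, ?_⟩
    · refine h.tab.upd hx ?_ ?_ (fun hk => absurd hk hkj)
      · intro i' j' y hy hi hj hs
        exact (h.tab.mono hy hx hi hj hs).trans hxw'
      · intro i' j' y hy hi hj hs
        by_cases hik : i' = k
        · subst hik
          exact hmax' _ _ (by omega) hy
        · obtain ⟨t, ht⟩ := h.tab.cl hy (i' := k + 1) (j' := j₁) (by omega) hj hv'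
          exact lt_of_lt_of_le (habove t ht) (h.tab.mono' ht hy (by omega) hj)
    · rintro rfl
      simp only [Vd] at hvx
      omega
    · intro l hl
      obtain ⟨t, ht, htx⟩ := hwit l hl
      refine ⟨j₁, t, ?_, ?_, htx, ?_⟩
      · cases b <;> simp [Vd] at * <;> omega
      · rw [upd_ne (by omega), ht]
      · intro s hs
        rw [upd_self] at hs
        cases hs
        omega
    · rintro rfl l s hl hs hsw
      rw [upd_apply] at hs
      simp only [true_and, Vd] at hs hvx
      split_ifs at hs with h1
      · cases hs; omega
      · have := hmax' _ _ (by omega) hs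
        omega
    · have := Bump.bump (G := upd G k j₁ w) (i := k) (w := x) j₁ w hkj (upd_self _ _ _ _) ?_ hxw'
      · rwa [upd_upd, upd_eq_self hx] at this
      · intro j' y hj' hy
        rw [upd_ne (by omega)] at hy
        exact h.tab.mono hy hx le_rfl hj'.le (Or.inr hj')

end Good

/-- The source of a step within rows is determined by its target. -/
theorem Bump.det {N : ℕ} {b : Bool} {i : ℕ} {G G₁ G₂ : Fil} {w u₁ u₂ : Letter} (hT : Tab N b G)
    (hT₁ : Tab N b G₁) (hT₂ : Tab N b G₂) (h₁ : Bump G₁ i u₁ G w) (h₂ : Bump G₂ i u₂ G w) :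
    G₁ = G₂ ∧ u₁ = u₂ := by
  have key : ∀ {G' u}, Tab N b G' → Bump G' i u G w → ∃ j x, G (i, j) = some x ∧ x.ceil < w.ceil ∧
      (((∀ y, G (i, j + 1) = some y → w.ceil < y.ceil) ∧ G' = upd G i j w ∧ u = x) ∨
        (∃ y, G (i, j + 1) = some y ∧ y.ceil = w.ceil ∧ u = ⟨w.ceil - 1, w.primed⟩ ∧
          G' = upd (upd G i j ⟨x.ceil, y.primed⟩) i (j + 1) ⟨y.ceil, false⟩)) := by
    intro G' u hT' h
    cases h with
    | bump j _ hj hm hlo hw =>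
      refine ⟨j, u, upd_self _ _ _ _, hw, Or.inl ⟨?_, ?_, rfl⟩⟩
      · intro y hy
        rw [upd_ne (by omega)] at hy
        exact hT'.mono hm hy le_rfl (by omega) (by omega)
      · rw [upd_upd, upd_eq_self hm]
    | eq j m M hj hm hM hw hw' hp =>
      refine ⟨j, ⟨m.ceil, false⟩, by rw [upd_ne (by omega), upd_self], by
        simp only [Letter.succL]; omega, Or.inr ⟨⟨M.ceil, m.primed⟩, upd_self _ _ _ _, ?_, ?_, ?_⟩⟩
      · simpa [Letter.succL] using hw'
      · simp [Letter.succL]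
      · rw [upd_comm (i := i) (j := j + 1) (a := i) (b := j) (by omega), upd_upd, upd_upd,
          upd_eq_self (x := ⟨m.ceil, m.primed⟩), upd_eq_self (x := ⟨M.ceil, false⟩)]
        · rw [← hp]; exact hM
        · exact hm
  obtain ⟨j, x, hx, hxw, h1⟩ := key hT₁ h₁
  obtain ⟨j', x', hx', hxw', h2⟩ := key hT₂ h₂
  have hmax : ∀ {j x j' x'}, G (i, j) = some x → x.ceil < w.ceil → G (i, j') = some x' →
      (∀ y, G (i, j' + 1) = some y → w.ceil ≤ y.ceil) → j ≤ j' := by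
    intro j x j' x' hx hxw hx' hn
    by_contra hlt
    obtain ⟨t, ht⟩ := hT.cl hx (i' := i) (j' := j' + 1) le_rfl (by omega) (by
      have := hT.vd hx
      have := hT.vd hx'
      cases b <;> simp only [Vd] at * <;> omega)
    have := hn t ht
    have := hT.mono' ht hx le_rfl (by omega)
    omega
  have hj : j = j' := by
    apply le_antisymm
    · refine hmax hx hxw hx' fun y hy => ?_
      rcases h2 with ⟨b1, -⟩ | ⟨y', b1, b2, -⟩
      · exact (b1 y hy).le
      · rw [b1] at hy; cases hy; exact b2.ge
    · refine hmax hx' hxw' hx fun y hy => ?_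
      rcases h1 with ⟨b1, -⟩ | ⟨y', b1, b2, -⟩
      · exact (b1 y hy).le
      · rw [b1] at hy; cases hy; exact b2.ge
  subst hj
  rw [hx] at hx'
  cases hx'
  rcases h1 with ⟨a1, a2, a3⟩ | ⟨y, a1, a2, a3, a4⟩ <;>
    rcases h2 with ⟨b1, b2, b3⟩ | ⟨y', b1, b2, b3, b4⟩
  · exact ⟨a2.trans b2.symm, a3.trans b3.symm⟩
  · have := a1 _ b1; omega
  · have := b1 _ a1; omega
  · rw [a1] at b1
    cases b1
    exact ⟨a4.trans b4.symm, a3.trans b3.symm⟩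

section Front

variable {z : Equiv.Perm ℤ} {W : PWord} {a : ℤ}

theorem front_eq_forward {m t M w : Letter} (h : m :: t :: M :: w :: W ∈ RinvPlus z)
    (hm : m = ⟨a, false⟩) (hw : w.ceil = a) (hM : M = ⟨a + 1, false⟩) (ht : a + 1 < t.ceil)
    (htp : t.primed = false) :
    w.primed = false ∧ ⟨a, false⟩ :: ⟨a + 1, false⟩ :: t :: M :: W ∈ RinvPlus z := by
  have hK := locCls_RinvPlus z
  obtain ⟨tc, tp⟩ := t
  obtain ⟨wc, wp⟩ := w
  subst hm hM
  dsimp only at hw ht htp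
  subst hw htp
  have hta : tc = wc + 1 + 1 := by
    by_contra hne
    have h1 := hK.comm [_] _ _ _ h (Or.inr (by dsimp only; omega))
    have h2 := hK.comm [_, _] _ _ _ h1 (Or.inr (by dsimp only; omega))
    exact front_no_triple h2 (Or.inr rfl)
  subst hta
  have h1 := hK.comm [] _ _ _ h (Or.inl (by dsimp only; omega))
  have h2 := (hK.braid [_] _ _ _ _ _ _ h1 (Or.inr rfl)).2
  have h3 := front_adj h2 (Or.inl rfl)
  have h4 := hK.comm [_] _ _ _ h3.2 (Or.inr (by dsimp only; omega))
  have h5 := front_adj h4 (Or.inl rfl)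
  exact ⟨h3.1, h5.2⟩

theorem front_eq_backward {x o t M : Letter} (h : x :: o :: t :: M :: W ∈ RinvPlus z)
    (hxo : x.ceil < o.ceil) (hM : M = ⟨o.ceil, false⟩) (ht : o.ceil < t.ceil) (htp : t.primed = false)
    (hxp : x.primed = false) :
    o.primed = false ∧ x.ceil = o.ceil - 1 ∧ x :: t :: M :: x :: W ∈ RinvPlus z := by
  have hK := locCls_RinvPlus z
  obtain ⟨tc, tp⟩ := t
  obtain ⟨oc, op⟩ := o
  obtain ⟨xc, xp⟩ := x
  subst hM
  dsimp only at hxo ht htp hxp ⊢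
  subst hxp htp
  have hto : tc = oc + 1 := by
    by_contra hne
    have h1 := hK.comm [_] _ _ _ h (Or.inl (by dsimp only; omega))
    exact hK.ne [_, _] _ _ _ h1 rfl
  subst hto
  have hx : oc = xc + 1 := by
    by_contra hne
    have h1 := (hK.braid [_] _ _ _ _ _ _ h (Or.inr rfl)).2
    have h2 := hK.comm [] _ _ _ h1 (Or.inl (by dsimp only; omega))
    have h3 := hK.comm [_] _ _ _ h2 (Or.inl (by dsimp only; omega))
    have h4 := (front_adj h3 (Or.inl rfl)).2
    have h5 := hK.comm [_, _] _ _ _ h4 (Or.inl (by dsimp only; omega))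
    exact hK.ne [_] _ _ _ h5 rfl
  subst hx
  have h1 := front_adj h (Or.inr rfl)
  obtain ⟨rfl, h1⟩ := h1
  have h2 := hK.comm [_] _ _ _ h1 (Or.inl (by dsimp only; omega))
  have h3 := (front_adj h2 (Or.inr rfl)).2
  have h4 := (hK.braid [_] _ _ _ _ _ _ h3 (Or.inl rfl)).2
  have h5 := hK.comm [] _ _ _ h4 (Or.inr (by dsimp only; omega))
  exact ⟨rfl, by omega, h5⟩

end Front

/-- An insertion step at the main diagonal, from row `r` to the next column. -/
inductive DStep (F : Fil) (r : ℕ) (w : Letter) : Fil → Letter → Prop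
  | bump (m : Letter) (hm : F (r, r) = some m) (hw : w.ceil < m.ceil) :
      DStep F r w (upd F r r ⟨w.ceil, false⟩) ⟨m.ceil, w.primed⟩
  | eq (m M : Letter) (hm : F (r, r) = some m) (hw : m.ceil = w.ceil) (hM : F (r, r + 1) = some M)
      (hw' : M.ceil = w.ceil + 1) (hp : M.primed = false) (hp' : w.primed = false) :
      DStep F r w F w.succL

section Diag

variable {z : Equiv.Perm ℤ} {N r : ℕ} {F : Fil}

theorem Tab.lin (hT : Tab N false F) {l₁ l₂ : List (ℕ × ℕ)}
    (hm : ∀ p x, F p = some x → (p ∈ l₁ ↔ p ∈ l₂)) (h₁ : LinExt l₁) (h₂ : LinExt l₂)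
    (A C : PWord) : A ++ (l₁.filterMap F ++ C) ∈ RinvPlus z ↔ A ++ (l₂.filterMap F ++ C) ∈ RinvPlus z :=
  ⟨(locCls_RinvPlus z).reorderF hm h₁ h₂ hT.far A C,
    (locCls_RinvPlus z).reorderF (fun p x h => (hm p x h).symm) h₂ h₁ hT.far A C⟩

theorem diag_pre (hT : Tab N false F) {m w : Letter} (hm : F (r, r) = some m) :
    LW N F r w ∈ RinvPlus z ↔ m :: (rd (CR N) (fun p => r ≤ p.1 ∧ r < p.2) F ++
      w :: rd (RR N) (fun p => p.1 < r) F) ∈ RinvPlus z := by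
  have h1 := hT.lin (z := z) (l₁ := sel (RR N) (fun p => r ≤ p.1))
    (l₂ := (r, r) :: sel (CR N) (fun p => r ≤ p.1 ∧ r < p.2)) ?_ (linExt_sel (linExt_RR N) _) ?_ []
    (w :: rd (RR N) (fun p => p.1 < r) F)
  · rw [List.filterMap_cons, hm] at h1
    exact h1
  · rintro ⟨i, j⟩ x hx
    rw [mem_sel, mem_RR, List.mem_cons, mem_sel, mem_CR]
    have := hT.vd hx
    have := hT.lt hx
    simp only [Vd, Prod.mk.injEq] at *
    omega
  · rw [LinExt, List.pairwise_cons]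
    refine ⟨?_, linExt_sel (linExt_CR N) _⟩
    rintro ⟨i, j⟩ ha
    have := (mem_sel.1 ha).2
    dsimp only at *
    omega

theorem diag_post (hT : Tab N false F) {x o : Letter} (hx : F (r, r) = some x)
    (hf : ∀ i j y, F (i, j) = some y → i < r → j ≤ r → Far y.ceil o.ceil) :
    KK z true (LW N (tr F) (r + 1) o) ↔ x :: o :: (rd (CR N) (fun p => r ≤ p.1 ∧ r < p.2) F ++
      rd (RR N) (fun p => p.1 < r) F) ∈ RinvPlus z := by
  have h1 := hT.lin (z := z) (l₁ := sel (CR N) (fun p => r ≤ p.1 ∧ r < p.2) ++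
      sel (RR N) (fun p => p.1 < r))
    (l₂ := sel (CR N) (fun p => p.1 < r ∧ p.2 ≤ r) ++ sel (CR N) (fun p => r < p.2)) ?_ ?_ ?_ [x, o] []
  · have h2 := hT.lin (z := z) (l₁ := (r, r) :: sel (CR N) (fun p => p.1 < r ∧ p.2 ≤ r))
      (l₂ := sel (CR N) (fun p => p.2 < r + 1)) ?_ ?_ (linExt_sel (linExt_CR N) _) []
      (o :: rd (CR N) (fun p => r < p.2) F)
    · have h3 : KK z true (LW N (tr F) (r + 1) o) ↔ [] ++
          (List.filterMap F (sel (CR N) fun p => p.2 < r + 1) ++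
            o :: rd (CR N) (fun p => r < p.2) F) ∈ RinvPlus z := by
        show (LW N (tr F) (r + 1) o).reverse ∈ _ ↔ _
        rw [LW, List.reverse_append, List.reverse_cons, rd_RR_reverse, rd_RR_reverse, tr_tr]
        simp only [List.append_assoc, List.singleton_append, List.nil_append]
        rfl
      rw [h3, ← h2, List.filterMap_cons, hx]
      rw [List.filterMap_append, List.filterMap_append] at h1
      simp only [List.append_nil, List.cons_append, List.nil_append] at h1 ⊢
      refine Iff.trans ?_ h1.symm
      have hB : ∀ b ∈ List.filterMap F (sel (CR N) fun p => p.1 < r ∧ p.2 ≤ r), Far b.ceil o.ceil := by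
        intro b hb
        obtain ⟨⟨i, j⟩, -, h2, h3⟩ := mem_rd.1 hb
        exact hf i j b h3 h2.1 h2.2
      exact ⟨(locCls_RinvPlus z).move_left [x] _ o _ hB, (locCls_RinvPlus z).move_right [x] _ o _ hB⟩
    · rintro ⟨i, j⟩ y hy
      rw [List.mem_cons, mem_sel, mem_sel, mem_CR]
      have := hT.vd hy
      have := hT.lt hy
      have := hT.lt hx
      simp only [Vd, Prod.mk.injEq] at *
      omega
    · rw [LinExt, List.pairwise_cons]
      refine ⟨?_, linExt_sel (linExt_CR N) _⟩
      rintro ⟨i, j⟩ ha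
      have := (mem_sel.1 ha).2
      dsimp only at *
      omega
  · rintro ⟨i, j⟩ y hy
    rw [List.mem_append, List.mem_append, mem_sel, mem_sel, mem_sel, mem_sel, mem_CR, mem_RR]
    have := hT.vd hy
    have := hT.lt hy
    simp only [Vd] at *
    omega
  · rw [LinExt, List.pairwise_append]
    refine ⟨linExt_sel (linExt_CR N) _, linExt_sel (linExt_RR N) _, ?_⟩
    intro a ha b hb
    have h1 := (mem_sel.1 ha).2
    have h2 := (mem_sel.1 hb).2
    omega
  · rw [LinExt, List.pairwise_append]
    refine ⟨linExt_sel (linExt_CR N) _, linExt_sel (linExt_CR N) _, ?_⟩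
    intro a ha b hb
    have h1 := (mem_sel.1 ha).2
    have h2 := (mem_sel.1 hb).2
    omega

theorem diag_cols (hT : Tab N false F) {M : Letter} (hM : F (r, r + 1) = some M) :
    (rd (CR N) (fun p => r ≤ p.1 ∧ r < p.2) F =
      M :: rd (CR N) (fun p => r ≤ p.1 ∧ r + 1 < p.2) F) ∨
    ∃ t, F (r + 1, r + 1) = some t ∧ rd (CR N) (fun p => r ≤ p.1 ∧ r < p.2) F =
      t :: M :: rd (CR N) (fun p => r ≤ p.1 ∧ r + 1 < p.2) F := by
  have hN := hT.lt hM
  have h1 : rd (CR N) (fun p => r ≤ p.1 ∧ r < p.2) F = rd (CR N) (fun p => p = (r + 1, r + 1)) F ++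
      M :: rd (CR N) (fun p => r ≤ p.1 ∧ r + 1 < p.2) F := by
    have h0 : rd (CR N) (fun p => r ≤ p.1 ∧ r < p.2) F =
        rd (CR N) (fun p => r ≤ p.1 ∧ p.1 ≤ r + 1 ∧ r < p.2 ∨ r ≤ p.1 ∧ r + 1 < p.2) F := by
      refine rd_congr (fun _ _ _ _ => rfl) ?_ ?_
      · rintro ⟨i, j⟩ - h h'
        cases hF : F (i, j) with
        | none => rfl
        | some x =>
          have := hT.vd hF
          simp only [Vd] at *
          omega
      · rintro ⟨i, j⟩ - h h'
        simp only at *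
        omega
    rw [h0, rd_split (CR_pairwise N) (P₁ := fun p => r < p.1 ∧ p.1 ≤ r + 1 ∧ p.2 = r + 1)
      (P₂ := fun p => p = (r, r + 1) ∨ r ≤ p.1 ∧ r + 1 < p.2) F,
      rd_split (CR_pairwise N) (P := fun p => p = (r, r + 1) ∨ r ≤ p.1 ∧ r + 1 < p.2)
      (P₁ := fun p => p = (r, r + 1))
      (P₂ := fun p => r ≤ p.1 ∧ r + 1 < p.2) F, rd_single (CR_nodup N) (p := (r, r + 1)) (x := M)
      (mem_CR.2 hN) hM (fun q => Iff.rfl)]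
    · congr 1
      refine rd_congr (fun _ _ _ _ => rfl) ?_ ?_ <;> rintro ⟨i, j⟩ - h h' <;>
        simp only [Prod.mk.injEq] at * <;> omega
    all_goals simp only [Prod.forall, Prod.mk.injEq]; intros; first | trivial | omega
  cases ht : F (r + 1, r + 1) with
  | none =>
    left
    rw [h1, rd_eq_nil]
    · rfl
    · rintro q - rfl
      exact ht
  | some t =>
    right
    refine ⟨t, rfl, ?_⟩
    rw [h1, rd_single (CR_nodup N) (p := (r + 1, r + 1)) (x := t)
      (mem_CR.2 (hT.lt ht)) ht (fun q => Iff.rfl)]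
    rfl

namespace Good

variable {w o : Letter}

theorem below (h : Good z N false r F w) : ∀ i' j' y, F (i', j') = some y → i' < r → j' ≤ r →
    y.ceil < w.ceil := by
  intro i' j' y hy hi hj
  refine h.lo (j := r) ?_ ?_ i' j' y hy hi.le hj (Or.inl hi)
  · intro j' x hj' hx
    have := h.tab.vd hx
    simp only [Vd] at this
    omega
  · intro j' hj' hv
    simp only [Vd] at hv
    omega

theorem dprogress (h : Good z N false r F w) {m : Letter} (hm : F (r, r) = some m)
    (hw : w.ceil ≤ m.ceil) :
    ∃ F' o, DStep F r w F' o ∧ Good z N true (r + 1) (tr F') o := by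
  have hK := locCls_RinvPlus z
  have hmp := h.tab.diag hm
  have hword := (diag_pre h.tab hm).1 h.word
  rcases lt_or_eq_of_le hw with hlt | heq
  · have hT' : Tab N false (upd F r r ⟨w.ceil, false⟩) := by
      refine h.tab.upd hm ?_ ?_ (fun _ => rfl)
      · intro i' j' y hy hi hj hs
        refine h.below i' j' y hy ?_ hj
        have := h.tab.vd hy
        simp only [Vd] at this
        omega
      · intro i' j' y hy hi hj hs
        exact hlt.trans (h.tab.mono hm hy hi hj hs)
    refine ⟨_, _, DStep.bump m hm hlt, hT'.tr, ?_, fun _ => Nat.succ_pos r, ?_, ?_⟩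
    · rw [diag_post hT' (upd_self _ _ _ _), rd_upd (by simp), rd_upd (by simp)]
      · have h1 := hK.move_left [m] _ w _ ?_ hword
        · obtain ⟨mc, mp⟩ := m
          dsimp only at hmp hlt ⊢
          subst hmp
          by_cases hf : w.ceil + 1 < mc
          · exact hK.comm [] _ _ _ (front_far h1 (Or.inr hf) w.primed false) (Or.inr hf)
          · have h2 := front_adj (a := mc) (b := w.ceil) (p := false) (q := w.primed) h1
              (Or.inl (by omega))
            rw [h2.1]
            exact h2.2
        · intro u hu
          obtain ⟨⟨i, j⟩, -, h2, h3⟩ := mem_rd.1 hu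
          dsimp only at h2
          have := h.tab.mono hm h3 (by omega) (by omega) (by omega)
          right; omega
      · intro i j y hy hi hj
        rw [upd_ne (by omega)] at hy
        have := h.below i j y hy hi hj
        left; dsimp only; omega
    · intro k hk
      obtain rfl : r = k := by omega
      refine ⟨r, ⟨w.ceil, false⟩, Or.inl rfl, by simp, hlt, ?_⟩
      intro y hy
      rw [tr_apply, upd_ne (by omega)] at hy
      exact (h.tab.mono hm hy le_rfl (by omega) (by omega)).le
    · rintro - k x hk hx he
      obtain rfl : r = k := by omega
      rw [tr_apply, upd_ne (by omega)] at hx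
      have := h.tab.mono hm hx le_rfl (by omega) (by omega)
      dsimp only at he
      omega
  · obtain ⟨M, hM, hM1, hMp, -⟩ := LW_eq hK h.tab hm heq.symm h.word
    have hC : ∀ u ∈ rd (CR N) (fun p => r ≤ p.1 ∧ r + 1 < p.2) F, Far u.ceil w.ceil := by
      intro u hu
      obtain ⟨⟨i, j⟩, -, h2, h3⟩ := mem_rd.1 hu
      dsimp only at h2
      have := h.tab.mono hM h3 (by omega) (by omega) (by omega)
      right; omega
    have em : m = ⟨w.ceil, false⟩ := by rw [← hmp, heq]
    have eM : M = ⟨w.ceil + 1, false⟩ := by rw [← hMp, ← hM1]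
    rcases diag_cols h.tab hM with hc | ⟨t, ht, hc⟩
    · exfalso
      rw [hc] at hword
      have h1 := hK.move_left [m, M] _ w _ hC hword
      rw [em, eM] at h1
      exact front_no_triple (a := w.ceil) (r := w.primed) h1 (Or.inr rfl)
    · have hword' := hword
      rw [hc] at hword
      have h1 := hK.move_left [m, t, M] _ w _ hC hword
      have htM := h.tab.mono hM ht (by omega) (by omega) (by omega)
      obtain ⟨hp, h2⟩ := front_eq_forward (a := w.ceil) h1 em rfl eM (by omega) (h.tab.diag ht)
      refine ⟨_, _, DStep.eq m M hm heq.symm hM hM1 hMp hp, h.tab.tr, ?_, fun _ => Nat.succ_pos r,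
        ?_, ?_⟩
      · rw [diag_post h.tab hm, hc, em]
        · simpa [Letter.succL, hp] using h2
        · intro i j y hy hi hj
          have := h.below i j y hy hi hj
          left; simp only [Letter.succL]; omega
      · intro k hk
        obtain rfl : r = k := by omega
        refine ⟨r, m, Or.inl rfl, hm, by simp only [Letter.succL]; omega, ?_⟩
        intro y hy
        rw [tr_apply, hM] at hy
        cases hy
        simp only [Letter.succL]; omega
      · rintro - k x hk hx he
        obtain rfl : r = k := by omega
        rw [tr_apply, hM] at hx
        cases hx
        exact hMp

theorem undstep (h : Good z N true (r + 1) (tr F) o) {x : Letter} (hx : F (r, r) = some x)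
    (hxo : x.ceil < o.ceil) : ∃ F' w, Good z N false r F' w ∧ DStep F' r w F o := by
  have hK := locCls_RinvPlus z
  have hT : Tab N false F := h.tab.tr
  have hxp := hT.diag hx
  have hbelow : ∀ i j y, F (i, j) = some y → i < r → j ≤ r → y.ceil < x.ceil :=
    fun i j y hy hi hj => hT.mono hy hx hi.le hj (Or.inl hi)
  have hword := h.word
  rw [diag_post hT hx (fun i j y hy hi hj => by
    have := hbelow i j y hy hi hj
    left; omega)] at hword
  have hnext : ∀ y, F (r, r + 1) = some y → o.ceil ≤ y.ceil := by
    intro y hy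
    obtain ⟨j, t, -, ht, h1, h2⟩ := h.wit r rfl
    rw [tr_apply] at ht
    have hj := hT.vd ht
    simp only [Vd] at hj
    obtain ⟨s, hs⟩ := hT.cl hy (i' := j) (j' := r + 1) hj le_rfl (by simp only [Vd]; omega)
    exact (h2 s hs).trans (hT.mono' hs hy hj le_rfl)
  have hwit : ∀ (F' : Fil) (w m : Letter), w.ceil = x.ceil → (∀ i j, i < r → F' (i, j) = F (i, j)) →
      F' (r, r) = some m → w.ceil ≤ m.ceil → ∀ k, r = k + 1 → ∃ j y, (false = true ∨ j ≠ k) ∧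
        F' (k, j) = some y ∧ y.ceil < w.ceil ∧ ∀ y, F' (r, j) = some y → w.ceil ≤ y.ceil := by
    intro F' w m hw hF hm hwm k hk
    obtain ⟨y, hy⟩ := hT.cl hx (i' := k) (j' := r) (by omega) le_rfl (by simp only [Vd]; omega)
    refine ⟨r, y, Or.inr (by omega), by rw [hF _ _ (by omega), hy], ?_, ?_⟩
    · rw [hw]; exact hbelow k r y hy (by omega) le_rfl
    · intro y hy
      rw [hm] at hy
      cases hy
      exact hwm
  by_cases heq : ∃ M, F (r, r + 1) = some M ∧ M.ceil = o.ceil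
  · obtain ⟨M, hM, hMo⟩ := heq
    have hMp : M.primed = false := h.ext rfl r M rfl hM hMo
    have eM : M = ⟨o.ceil, false⟩ := by rw [← hMp, ← hMo]
    rcases diag_cols hT hM with hc | ⟨t, ht, hc⟩
    · rw [hc] at hword
      exact absurd hMo.symm (hK.ne [x] _ _ _ hword)
    · rw [hc] at hword
      have htM := hT.mono hM ht (by omega) (by omega) (by omega)
      obtain ⟨hop, hxo', h2⟩ := front_eq_backward hword hxo eM (by omega) (hT.diag ht) hxp
      have eo : x.succL = o := by
        simp only [Letter.succL, hxp, hxo', ← hop, sub_add_cancel]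
      refine ⟨F, x, ⟨hT, ?_, by simp, ?_, by simp⟩, ?_⟩
      · refine (diag_pre hT hx).2 ?_
        rw [hc]
        refine hK.move_right [x, t, M] _ x _ ?_ h2
        intro u hu
        obtain ⟨⟨i, j⟩, -, h2, h3⟩ := mem_rd.1 hu
        dsimp only at h2
        have := hT.mono hM h3 (by omega) (by omega) (by omega)
        right; omega
      · exact hwit F x x rfl (fun _ _ _ => rfl) hx le_rfl
      · have := DStep.eq (w := x) x M hx rfl hM (by omega) hMp hxp
        rwa [eo] at this
  · push Not at heq
    have hhi : ∀ i' j' y, F (i', j') = some y → r ≤ i' → r ≤ j' → (r < i' ∨ r < j') →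
        o.ceil < y.ceil := by
      intro i' j' y hy hi hj hs
      have hv := hT.vd hy
      simp only [Vd] at hv
      obtain ⟨s, hs⟩ := hT.cl hy (i' := r) (j' := r + 1) hi (by omega) (by simp only [Vd]; omega)
      have h1 := hnext s hs
      have h2 := heq s hs
      have h3 := hT.mono' hs hy hi (by omega)
      omega
    have hT' : Tab N false (upd F r r ⟨o.ceil, false⟩) := by
      refine hT.upd hx ?_ hhi (fun _ => rfl)
      intro i' j' y hy hi hj hs
      exact (hT.mono hy hx hi hj hs).trans hxo
    refine ⟨_, ⟨x.ceil, o.primed⟩, ⟨hT', ?_, by simp, ?_, by simp⟩, ?_⟩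
    · refine (diag_pre hT' (upd_self _ _ _ _)).2 ?_
      rw [rd_upd (by simp), rd_upd (by simp)]
      refine hK.move_right [_] _ _ _ ?_ ?_
      · intro u hu
        obtain ⟨⟨i, j⟩, -, h2, h3⟩ := mem_rd.1 hu
        dsimp only at h2
        have := hhi _ _ _ h3 (by omega) (by omega) (by omega)
        right; dsimp only; omega
      · obtain ⟨oc, op⟩ := o
        obtain ⟨xc, xp⟩ := x
        dsimp only at hxp hxo ⊢
        subst hxp
        by_cases hf : xc + 1 < oc
        · exact hK.comm [] _ _ _ (front_far hword (Or.inl hf) op false) (Or.inl hf)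
        · have h2 := front_adj hword (Or.inr (by omega))
          rw [h2.1]
          exact h2.2
    · exact hwit _ _ ⟨o.ceil, false⟩ rfl (fun i j hi => upd_ne (by omega)) (upd_self _ _ _ _) hxo.le
    · have := DStep.bump (F := upd F r r ⟨o.ceil, false⟩) (w := ⟨x.ceil, o.primed⟩) ⟨o.ceil, false⟩
        (upd_self _ _ _ _) hxo
      rwa [upd_upd, show upd F r r ⟨x.ceil, false⟩ = F from upd_eq_self (by rw [hx, ← hxp]),
        show (⟨o.ceil, o.primed⟩ : Letter) = o from rfl] at this

end Good

theorem DStep.lt {w o : Letter} {F' : Fil} (h : DStep F r w F' o) :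
    ∃ x, F' (r, r) = some x ∧ x.ceil < o.ceil := by
  cases h with
  | bump m hm hw => exact ⟨_, upd_self _ _ _ _, hw⟩
  | eq m M hm hw hM hw' hp hp' => exact ⟨m, hm, by simp only [Letter.succL]; omega⟩

theorem DStep.det {G F₁ F₂ : Fil} {o w₁ w₂ : Letter} (hT₁ : Tab N false F₁) (hT₂ : Tab N false F₂)
    (h₁ : DStep F₁ r w₁ G o) (h₂ : DStep F₂ r w₂ G o) : F₁ = F₂ ∧ w₁ = w₂ := by
  have key : ∀ {F w}, Tab N false F → DStep F r w G o → ∃ x, G (r, r) = some x ∧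
      (((∀ y, G (r, r + 1) = some y → o.ceil < y.ceil) ∧ F = upd G r r ⟨o.ceil, false⟩ ∧
        w = ⟨x.ceil, o.primed⟩) ∨
      (∃ y, G (r, r + 1) = some y ∧ y.ceil = o.ceil ∧ F = G ∧ w = ⟨o.ceil - 1, o.primed⟩)) := by
    intro F w hT h
    cases h with
    | bump m hm hw =>
      refine ⟨_, upd_self _ _ _ _, Or.inl ⟨?_, ?_, rfl⟩⟩
      · intro y hy
        rw [upd_ne (Or.inr (by omega))] at hy
        have : m.ceil < y.ceil := hT.mono hm hy le_rfl (Nat.le_succ r) (Or.inr (Nat.lt_succ_self r))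
        exact this
      · rw [upd_upd, upd_eq_self]
        rw [hm, ← hT.diag hm]
    | eq m M hm hw hM hw' hp hp' =>
      exact ⟨m, hm, Or.inr ⟨M, hM, hw', rfl, by simp [Letter.succL]⟩⟩
  obtain ⟨x, hx, h1⟩ := key hT₁ h₁
  obtain ⟨x', hx', h2⟩ := key hT₂ h₂
  rw [hx] at hx'
  cases hx'
  rcases h1 with ⟨a1, a2, a3⟩ | ⟨y, a1, a2, a3, a4⟩ <;>
    rcases h2 with ⟨b1, b2, b3⟩ | ⟨y', b1, b2, b3, b4⟩
  · exact ⟨a2.trans b2.symm, a3.trans b3.symm⟩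
  · have := a1 _ b1; omega
  · have := b1 _ a1; omega
  · exact ⟨a3.trans b3.symm, a4.trans b4.symm⟩

end Diag

/-- Orient a filling: transposed when `b` is set. -/
def ori (b : Bool) (G : Fil) : Fil := if b then tr G else G

@[simp] theorem ori_true (G : Fil) : ori true G = tr G := rfl

@[simp] theorem ori_false (G : Fil) : ori false G = G := rfl

@[simp] theorem ori_ori (b : Bool) (G : Fil) : ori b (ori b G) = G := by cases b <;> rfl

/-- The last step of an insertion: a box is added at the end of line `i`. -/
inductive Stop : Bool → ℕ → Fil → Letter → Fil → ℕ × ℕ → Bool → Prop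
  | row {i j G w} (hij : i < j) (hG : G (i, j) = none) (hlo : ∀ j' x, G (i, j') = some x → x.ceil < w.ceil)
      (hpr : ∀ j', j' < j → i ≤ j' → ∃ y, G (i, j') = some y) :
      Stop false i G w (upd G i j w) (i, j) false
  | col {i j G w} (hij : j < i) (hG : G (i, j) = none) (hlo : ∀ j' x, G (i, j') = some x → x.ceil < w.ceil)
      (hpr : ∀ j', j' < j → ∃ y, G (i, j') = some y) :
      Stop true i G w (tr (upd G i j w)) (j, i) true
  | diag {i G w} (hG : ∀ j, G (i, j) = none) :
      Stop false i G w (upd G i i ⟨w.ceil, false⟩) (i, i) w.primed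

theorem Tab.add {N : ℕ} {b : Bool} {G : Fil} (h : Tab N b G) {i j : ℕ} {x : Letter}
    (hG : G (i, j) = none) (hv : Vd b i j) (hi : i < N) (hj : j < N)
    (hpr : ∀ i' j', i' ≤ i → j' ≤ j → (i' < i ∨ j' < j) → Vd b i' j' → ∃ y, G (i', j') = some y)
    (hlo : ∀ i' j' y, G (i', j') = some y → i' ≤ i → j' ≤ j → (i' < i ∨ j' < j) → y.ceil < x.ceil)
    (hd : i = j → x.primed = false) : Tab N b (_root_.upd G i j x) := by
  have hno : ∀ {i' j' y}, G (i', j') = some y → i ≤ i' → j ≤ j' → False := by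
    intro i' j' y hy h1 h2
    obtain ⟨t, ht⟩ := h.cl hy h1 h2 hv
    rw [hG] at ht
    cases ht
  constructor
  · intro a c y hy
    rw [upd_apply] at hy
    split_ifs at hy with hp
    · rw [hp.1, hp.2]; exact hv
    · exact h.vd hy
  · intro a c y hy
    rw [upd_apply] at hy
    split_ifs at hy with hp
    · omega
    · exact h.lt hy
  · intro a c a' c' y hy ha hc hv'
    rw [upd_apply]
    split_ifs with hp'
    · exact ⟨x, rfl⟩
    rw [upd_apply] at hy
    split_ifs at hy with hp
    · exact hpr _ _ (by omega) (by omega) (by omega) hv'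
    · exact h.cl hy ha hc hv'
  · intro a c a' c' s t hs ht ha hc hlt
    rw [upd_apply] at hs ht
    split_ifs at hs ht with h1 h2 h2
    · omega
    · exact (hno ht (by omega) (by omega)).elim
    · cases ht
      obtain ⟨rfl, rfl⟩ := h2
      exact hlo _ _ _ hs ha hc hlt
    · exact h.mono hs ht ha hc hlt
  · intro a y hy
    rw [upd_apply] at hy
    split_ifs at hy with hp
    · cases hy; exact hd (by omega)
    · exact h.diag hy

theorem LW_add {N : ℕ} {G : Fil} {i j : ℕ} {w : Letter} (hi : i < N) (hj : j < N)
    (hlo : ∀ j', j ≤ j' → G (i, j') = none) :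
    rd (RR N) (fun _ => True) (upd G i j w) = LW N G i w := by
  rw [LW_split, rd_split (RR_pairwise N) (P := fun _ => True) (P₁ := fun p => i ≤ p.1)
    (P₂ := fun p => p.1 < i), rows_split, line_split (upd_self G i j w) hi hj, rd_upd (by simp),
    rd_upd (by simp), rd_upd (by simp), rd_upd (by simp)]
  · have h1 : rd (RR N) (fun p => p.1 = i ∧ j < p.2) G = [] := by
      refine rd_eq_nil ?_
      rintro ⟨a, c⟩ - ⟨rfl, h⟩
      exact hlo _ (le_of_lt h)
    have h2 : rd (RR N) (fun p => p.1 = i) G = rd (RR N) (fun p => p.1 = i ∧ p.2 < j) G := by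
      refine rd_congr (fun _ _ _ _ => rfl) ?_ ?_
      · rintro ⟨a, c⟩ - h h'
        dsimp only at h h'
        subst h
        exact hlo _ (by omega)
      · rintro ⟨a, c⟩ - h h'
        exact absurd h.1 h'
    rw [h1, h2]
  all_goals intros; first | trivial | omega | (simp only [true_iff]; omega)

/-- Completed stages of insertion. -/
structure Done (z : Equiv.Perm ℤ) (N : ℕ) (F : Fil) : Prop where
  tab : Tab N false F
  word : rd (RR N) (fun _ => True) F ∈ RinvPlus z

theorem KK_ori {z : Equiv.Perm ℤ} {N : ℕ} {b : Bool} {G : Fil} (hT : Tab N b G) :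
    KK z b (rd (RR N) (fun _ => True) G) ↔ rd (RR N) (fun _ => True) (ori b G) ∈ RinvPlus z := by
  cases b with
  | false => rfl
  | true =>
    have h1 := hT.tr.lin (z := z) (l₁ := sel (CR N) fun _ => True) (l₂ := sel (RR N) fun _ => True) ?_
      (linExt_sel (linExt_CR N) _) (linExt_sel (linExt_RR N) _) [] []
    · rw [List.append_nil, List.append_nil] at h1
      change (rd (RR N) (fun _ => True) G).reverse ∈ RinvPlus z ↔ _
      rw [rd_RR_reverse]
      exact h1
    · intro p x _
      rw [mem_sel, mem_sel, mem_CR, mem_RR]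

/-- All boxes stay away from the border of the `N × N` window. -/
def Room (N : ℕ) (G : Fil) : Prop := 0 < N ∧ ∀ i j x, G (i, j) = some x → i + 1 < N ∧ j + 1 < N

/-- Fillings with the same boxes. -/
def SameDom (G G' : Fil) : Prop := ∀ p, G p = none ↔ G' p = none

theorem SameDom.refl (G : Fil) : SameDom G G := fun _ => Iff.rfl

theorem SameDom.trans {G G' G'' : Fil} (h : SameDom G G') (h' : SameDom G' G'') : SameDom G G'' :=
  fun p => (h p).trans (h' p)

theorem SameDom.upd {G : Fil} {i j : ℕ} {m : Letter} (hm : G (i, j) = some m) (x : Letter) :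
    SameDom G (upd G i j x) := by
  rintro ⟨a, c⟩
  rw [upd_apply]
  split_ifs with h
  · rw [h.1, h.2, hm]; simp
  · rfl

theorem SameDom.tr {G G' : Fil} (h : SameDom G G') : SameDom (tr G) (tr G') := fun p => h (p.2, p.1)

theorem Bump.dom {G G' : Fil} {i : ℕ} {w o : Letter} (h : Bump G i w G' o) : SameDom G G' := by
  cases h with
  | bump j m hj hm hlo hw => exact SameDom.upd hm _
  | eq j m M hj hm hM hw hw' hp =>
    exact (SameDom.upd hm _).trans (SameDom.upd (m := M) (by rw [upd_ne (by omega), hM]) _)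

theorem DStep.dom {G G' : Fil} {i : ℕ} {w o : Letter} (h : DStep G i w G' o) : SameDom G G' := by
  cases h with
  | bump m hm hw => exact SameDom.upd hm _
  | eq m M hm hw hM hw' hp hp' => exact SameDom.refl _

theorem SameDom.room {N : ℕ} {G G' : Fil} (h : SameDom G G') (hR : Room N G) : Room N G' := by
  refine ⟨hR.1, fun i j x hx => ?_⟩
  cases hG : G (i, j) with
  | none => rw [(h _).1 hG] at hx; cases hx
  | some y => exact hR.2 _ _ _ hG

theorem Room.tr {N : ℕ} {G : Fil} (hR : Room N G) : Room N (tr G) :=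
  ⟨hR.1, fun i j x hx => (hR.2 j i x hx).symm⟩

theorem Good.lt {z : Equiv.Perm ℤ} {N B : ℕ} {b : Bool} {i : ℕ} {G : Fil} {w : Letter}
    (h : Good z N b i G w) (hR : Room B G) : i < B := by
  cases i with
  | zero => exact hR.1
  | succ k =>
    obtain ⟨j, x, -, hx, -⟩ := h.wit k rfl
    exact (hR.2 _ _ _ hx).1

theorem Good.halt {z : Equiv.Perm ℤ} {N : ℕ} {b : Bool} {i : ℕ} {G : Fil} {w : Letter}
    (h : Good z N b i G w) (hR : Room N G) (hall : ∀ j x, G (i, j) = some x → x.ceil < w.ceil) :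
    ∃ F c f, Stop b i G w F c f := by
  have hiN := h.lt hR
  have hex : ∃ j, Vd b i j ∧ G (i, j) = none := by
    cases b with
    | false =>
      refine ⟨N, hiN.le, ?_⟩
      cases hG : G (i, N) with
      | none => rfl
      | some x => have := h.tab.lt hG; omega
    | true =>
      have hpos := h.pos rfl
      obtain ⟨j, x, -, hx, hxw, hy⟩ := h.wit (i - 1) (by omega)
      refine ⟨j, ?_, ?_⟩
      · have := h.tab.vd hx
        simp only [Vd] at *
        omega
      · cases hG : G (i, j) with
        | none => rfl
        | some y => have := hy _ hG; have := hall _ _ hG; omega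
  classical
  obtain ⟨hv, hG⟩ := Nat.find_spec hex
  set j := Nat.find hex
  have hpr : ∀ j' < j, Vd b i j' → ∃ y, G (i, j') = some y := by
    intro j' hj' hv'
    have := Nat.find_min hex hj'
    rw [not_and] at this
    exact Option.ne_none_iff_exists'.1 (this hv')
  cases b with
  | false =>
    by_cases hij : i = j
    · rw [← hij] at hG
      refine ⟨_, _, _, Stop.diag fun j' => ?_⟩
      cases hG' : G (i, j') with
      | none => rfl
      | some y =>
        obtain ⟨y', hy'⟩ := h.tab.cl hG' le_rfl (h.tab.vd hG') (show i ≤ i from le_rfl)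
        rw [hG] at hy'
        cases hy'
    · exact ⟨_, _, _, Stop.row (lt_of_le_of_ne hv hij) hG hall fun j' hj' hv' => hpr j' hj' hv'⟩
  | true =>
    have hpos := h.pos rfl
    obtain ⟨j₀, x, -, hx, hxw, hy⟩ := h.wit (i - 1) (by omega)
    have hv0 := h.tab.vd hx
    simp only [Vd] at hv hv0
    have hj : j ≤ j₀ := by
      apply Nat.find_min' hex
      refine ⟨?_, ?_⟩
      · simp only [Vd]; omega
      · cases hG : G (i, j₀) with
        | none => rfl
        | some y => have := hy _ hG; have := hall _ _ hG; omega
    exact ⟨_, _, _, Stop.col (by omega) hG hall fun j' hj' => hpr j' hj' (show j' ≤ i by omega)⟩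

theorem Stop.done {z : Equiv.Perm ℤ} {N : ℕ} {b : Bool} {i : ℕ} {G F : Fil} {w : Letter}
    {c : ℕ × ℕ} {f : Bool} (h : Good z N b i G w) (hR : Room N G) (hs : Stop b i G w F c f) :
    Done z N F := by
  have hiN := h.lt hR
  have main : ∀ j w', G (i, j) = none → Vd b i j → (b = true → i ≠ j) → w'.ceil = w.ceil →
      (i = j → w'.primed = false) →
      (∀ j' x, G (i, j') = some x → x.ceil < w.ceil) →
      (∀ j', j' < j → Vd b i j' → ∃ y, G (i, j') = some y) → j < N ∧ Tab N b (upd G i j w') := by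
    intro j w' hG hv hbij hw hd hlo hpr
    have hlo' := h.lo (j := j) (fun j' x _ => hlo j' x) hpr
    have hwit : ∀ k, i = k + 1 → ∃ j₀ x, j ≤ j₀ ∧ G (k, j₀) = some x := by
      intro k hk
      obtain ⟨j₀, x, h1, h2, h3, h4⟩ := h.wit_le hk (fun j' x (_ : j' < j) => hlo j' x) hpr
      exact ⟨j₀, x, h2, h3⟩
    have hjN : j < N := by
      rcases Nat.eq_zero_or_pos i with rfl | hpos
      · rcases Nat.eq_zero_or_pos j with rfl | hj
        · exact hiN
        · cases b with
          | false =>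
            obtain ⟨y, hy⟩ := hpr (j - 1) (by omega) (Nat.zero_le _)
            have := hR.2 _ _ _ hy
            omega
          | true => exact absurd (h.pos rfl) (lt_irrefl 0)
      · obtain ⟨j₀, x, h1, h2⟩ := hwit (i - 1) (by omega)
        have := hR.2 _ _ _ h2
        omega
    refine ⟨hjN, h.tab.add hG hv hiN hjN ?_ ?_ hd⟩
    · intro i' j' hi' hj' hs' hv'
      by_cases he : i' = i
      · subst he
        exact hpr _ (by omega) hv'
      · obtain ⟨j₀, x, h1, h2⟩ := hwit (i - 1) (by omega)
        exact h.tab.cl h2 (by omega) (by omega) hv'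
    · rw [hw]
      exact hlo'
  cases hs with
  | @row _ j _ _ hij hG hlo hpr =>
    obtain ⟨hj, hT⟩ := main j w hG hij.le (by simp) rfl (by omega) hlo hpr
    refine ⟨hT, ?_⟩
    rw [LW_add hiN hj]
    · exact h.word
    · intro j' hj'
      cases hG' : G (i, j') with
      | none => rfl
      | some y =>
        obtain ⟨t, ht⟩ := h.tab.cl hG' le_rfl hj' (show i ≤ j from hij.le)
        rw [hG] at ht
        cases ht
  | @col _ j _ _ hij hG hlo hpr =>
    obtain ⟨hj, hT⟩ := main j w hG hij.le (by omega) rfl (by omega) hlo (fun j' hj' _ => hpr j' hj')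
    refine ⟨hT.tr, ?_⟩
    rw [← ori_true, ← KK_ori hT, LW_add hiN hj]
    · exact h.word
    · intro j' hj'
      cases hG' : G (i, j') with
      | none => rfl
      | some y =>
        obtain ⟨t, ht⟩ := h.tab.cl hG' le_rfl hj' (show j ≤ i from hij.le)
        rw [hG] at ht
        cases ht
  | diag hG =>
    obtain ⟨hj, hT⟩ := main i ⟨w.ceil, false⟩ (hG i) le_rfl (by simp) rfl (fun _ => rfl)
      (fun j x hx => by rw [hG] at hx; cases hx)
      (fun j' hj' hv => absurd hv (by simp only [Vd]; omega))
    refine ⟨hT, ?_⟩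
    rw [LW_add hiN hj (fun j' _ => hG j')]
    have hw := h.word
    have hnil : rd (RR N) (fun p => i ≤ p.1) G = [] := by
      refine rd_eq_nil ?_
      rintro ⟨a, c⟩ - ha
      cases hG' : G (a, c) with
      | none => rfl
      | some y =>
        have hv := h.tab.vd hG'
        simp only [Vd] at hv ha
        obtain ⟨t, ht⟩ := h.tab.cl hG' ha le_rfl (show i ≤ c by omega)
        rw [hG] at ht
        cases ht
    rw [LW, hnil] at hw ⊢
    exact front_toggle hw false

/-- Remove a box. -/
def del (F : Fil) (p : ℕ × ℕ) : Fil := fun q => if q = p then none else F q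

theorem del_apply (F : Fil) (i j a b : ℕ) :
    del F (i, j) (a, b) = if a = i ∧ b = j then none else F (a, b) := by
  simp [del]

theorem upd_del {F : Fil} {i j : ℕ} {x : Letter} (h : F (i, j) = some x) :
    upd (del F (i, j)) i j x = F := by
  funext p
  simp only [upd, del]
  split_ifs with hp
  · rw [hp, h]
  · rfl

theorem del_upd {G : Fil} {i j : ℕ} {x : Letter} (h : G (i, j) = none) :
    del (upd G i j x) (i, j) = G := by
  funext p
  simp only [upd, del]
  split_ifs with hp
  · rw [hp, h]
  · rfl

theorem tr_del (F : Fil) (i j : ℕ) : tr (del F (i, j)) = del (tr F) (j, i) := by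
  funext ⟨a, b⟩
  simp only [tr_apply, del_apply, and_comm]

theorem Tab.del {N : ℕ} {b : Bool} {F : Fil} (h : Tab N b F) {i j : ℕ}
    (h1 : F (i + 1, j) = none) (h2 : F (i, j + 1) = none) : Tab N b (del F (i, j)) := by
  have sub : ∀ {a c y}, _root_.del F (i, j) (a, c) = some y → F (a, c) = some y := by
    intro a c y hy
    rw [del_apply] at hy
    split_ifs at hy
    exact hy
  constructor
  · intro a c y hy; exact h.vd (sub hy)
  · intro a c y hy; exact h.lt (sub hy)
  · intro a c a' c' y hy ha hc hv
    obtain ⟨t, ht⟩ := h.cl (sub hy) ha hc hv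
    rw [del_apply]
    split_ifs with hp
    · exfalso
      have hv' := h.vd (sub hy)
      obtain ⟨rfl, rfl⟩ := hp
      have hne : a ≠ a' ∨ c ≠ c' := by
        by_contra hcon
        rw [del_apply, if_pos (by omega)] at hy
        cases hy
      by_cases hb : a' < a ∧ Vd b (a' + 1) c'
      · obtain ⟨t', ht'⟩ := h.cl (sub hy) (show a' + 1 ≤ a by omega) hc hb.2
        rw [h1] at ht'
        cases ht'
      · have : c' + 1 ≤ c ∧ Vd b a' (c' + 1) := by
          cases b <;> simp only [Vd] at * <;> omega
        obtain ⟨t', ht'⟩ := h.cl (sub hy) ha this.1 this.2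
        rw [h2] at ht'
        cases ht'
    · exact ⟨t, ht⟩
  · intro a c a' c' s t hs ht ha hc hlt
    exact h.mono (sub hs) (sub ht) ha hc hlt
  · intro a y hy
    exact h.diag (sub hy)

/-- Boxes that can be removed. -/
structure Corner (F : Fil) (c : ℕ × ℕ) : Prop where
  mem : ∃ x, F c = some x
  up : F (c.1 + 1, c.2) = none
  right : F (c.1, c.2 + 1) = none

theorem Stop.back {z : Equiv.Perm ℤ} {N : ℕ} {F : Fil} {c : ℕ × ℕ} (h : Done z N F)
    (hc : Corner F c) (f : Bool) : ∃ b i G w, Good z N b i G w ∧ Stop b i G w F c f := by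
  obtain ⟨r, s⟩ := c
  obtain ⟨⟨x, hx⟩, h1, h2⟩ := hc
  dsimp only at hx h1 h2
  have hT := h.tab.del h1 h2
  have hv := h.tab.vd hx
  have hN := h.tab.lt hx
  simp only [Vd] at hv
  have hdel : del F (r, s) (r, s) = none := by rw [del_apply, if_pos ⟨rfl, rfl⟩]
  have hrow : ∀ j', s < j' → F (r, j') = none := by
    intro j' hj'
    cases hF : F (r, j') with
    | none => rfl
    | some y =>
      obtain ⟨t, ht⟩ := h.tab.cl hF le_rfl hj' (show r ≤ s + 1 by omega)
      rw [h2] at ht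
      cases ht
  have hcol : ∀ i', r < i' → F (i', s) = none := by
    intro i' hi'
    cases hF : F (i', s) with
    | none => rfl
    | some y =>
      have hv' := h.tab.vd hF
      simp only [Vd] at hv'
      obtain ⟨t, ht⟩ := h.tab.cl hF hi' le_rfl (show r + 1 ≤ s by omega)
      rw [h1] at ht
      cases ht
  by_cases hrs : r = s
  · subst hrs
    have hG : ∀ j, del F (r, r) (r, j) = none := by
      intro j
      rw [del_apply]
      split_ifs with hj
      · rfl
      · cases hF : F (r, j) with
        | none => rfl
        | some y =>
          have hv' := h.tab.vd hF
          simp only [Vd] at hv'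
          rw [hrow j (by omega)] at hF
          cases hF
    have hu : upd (del F (r, r)) r r ⟨x.ceil, false⟩ = F := by
      rw [← h.tab.diag hx]
      exact upd_del hx
    refine ⟨false, r, del F (r, r), ⟨x.ceil, f⟩, ⟨hT, ?_, by simp, ?_, by simp⟩, ?_⟩
    · have hw := h.word
      have hnil : rd (RR N) (fun p => r ≤ p.1) (del F (r, r)) = [] := by
        refine rd_eq_nil ?_
        rintro ⟨a, c⟩ - ha
        cases hG' : del F (r, r) (a, c) with
        | none => rfl
        | some y =>
          have hv := hT.vd hG'
          simp only [Vd] at hv ha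
          obtain ⟨t, ht⟩ := hT.cl hG' ha le_rfl (show r ≤ c by omega)
          rw [hG] at ht
          cases ht
      rw [← hu, LW_add hN.1 hN.2 (fun j' _ => hG j'), LW, hnil] at hw
      change LW _ _ _ _ ∈ _
      rw [LW, hnil]
      exact front_toggle hw f
    · rintro k rfl
      obtain ⟨y, hy⟩ := h.tab.cl hx (Nat.le_succ k) le_rfl (Nat.le_succ k)
      refine ⟨k + 1, y, Or.inr (by omega), ?_, ?_, ?_⟩
      · rw [del_apply, if_neg (by omega)]; exact hy
      · have : y.ceil < x.ceil := h.tab.mono hy hx (Nat.le_succ _) le_rfl (Or.inl (Nat.lt_succ_self _))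
        exact this
      · intro t ht
        rw [hG] at ht
        cases ht
    · have := Stop.diag (i := r) (G := del F (r, r)) (w := ⟨x.ceil, f⟩) hG
      dsimp only at this
      rwa [hu] at this
  · cases f with
    | false =>
      refine ⟨false, r, del F (r, s), x, ⟨hT, ?_, by simp, ?_, by simp⟩, ?_⟩
      · change LW _ _ _ _ ∈ _
        rw [← LW_add (j := s) hN.1 hN.2, upd_del hx]
        · exact h.word
        · intro j' hj'
          rw [del_apply]
          split_ifs with hp
          · rfl
          · exact hrow _ (by omega)
      · rintro k rfl
        obtain ⟨y, hy⟩ := h.tab.cl hx (Nat.le_succ k) le_rfl (show k ≤ s by omega)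
        refine ⟨s, y, Or.inr (by omega), ?_, ?_, ?_⟩
        · rw [del_apply, if_neg (by omega)]; exact hy
        · exact h.tab.mono hy hx (Nat.le_succ _) le_rfl (Or.inl (Nat.lt_succ_self _))
        · intro t ht
          rw [hdel] at ht
          cases ht
      · have := Stop.row (i := r) (j := s) (G := del F (r, s)) (w := x) (by omega) hdel ?_ ?_
        · rwa [upd_del hx] at this
        · intro j' y hy
          rw [del_apply] at hy
          split_ifs at hy with hp
          have : j' < s := by
            by_contra hcon
            rw [hrow j' (by omega)] at hy
            cases hy
          exact h.tab.mono hy hx le_rfl this.le (Or.inr this)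
        · intro j' hj' hrj
          rw [del_apply, if_neg (by omega)]
          exact h.tab.cl hx le_rfl hj'.le hrj
    | true =>
      have hdel' : del (tr F) (s, r) (s, r) = none := by rw [del_apply, if_pos ⟨rfl, rfl⟩]
      refine ⟨true, s, del (tr F) (s, r), x, ⟨?_, ?_, by omega, ?_, ?_⟩, ?_⟩
      · rw [← tr_del]
        exact hT.tr
      · rw [← LW_add (j := r) hN.2 hN.1, upd_del (by exact hx)]
        · rw [KK_ori (by exact h.tab.tr)]
          exact h.word
        · intro j' hj'
          rw [del_apply]
          split_ifs with hp
          · rfl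
          · exact hcol _ (by omega)
      · rintro k rfl
        obtain ⟨y, hy⟩ := h.tab.cl hx le_rfl (Nat.le_succ k) (show r ≤ k by omega)
        refine ⟨r, y, Or.inl rfl, ?_, ?_, ?_⟩
        · rw [del_apply, if_neg (by omega)]; exact hy
        · exact h.tab.mono hy hx le_rfl (by omega) (Or.inr (by omega))
        · intro t ht
          rw [hdel'] at ht
          cases ht
      · rintro - k y rfl hy
        rw [del_apply] at hy
        split_ifs at hy with hp
        rw [tr_apply, hcol _ (by omega)] at hy
        cases hy
      · have := Stop.col (i := s) (j := r) (G := del (tr F) (s, r)) (w := x) (by omega) hdel' ?_ ?_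
        · rwa [upd_del (by exact hx)] at this
        · intro j' y hy
          rw [del_apply] at hy
          split_ifs at hy with hp
          have : j' < r := by
            by_contra hcon
            rw [tr_apply, hcol j' (by omega)] at hy
            cases hy
          exact h.tab.mono hy hx this.le le_rfl (Or.inl this)
        · intro j' hj'
          rw [del_apply, if_neg (by omega)]
          exact h.tab.cl hx hj'.le le_rfl (show j' ≤ s by omega)

theorem Stop.det {b₁ b₂ : Bool} {i₁ i₂ : ℕ} {G₁ G₂ F : Fil} {w₁ w₂ : Letter} {c : ℕ × ℕ} {f : Bool}
    (h₁ : Stop b₁ i₁ G₁ w₁ F c f) (h₂ : Stop b₂ i₂ G₂ w₂ F c f) :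
    b₁ = b₂ ∧ i₁ = i₂ ∧ G₁ = G₂ ∧ w₁ = w₂ := by
  have key : ∀ {b i G w F c f}, Stop b i G w F c f →
      (c.1 = c.2 → b = false ∧ f = w.primed) ∧ (c.1 ≠ c.2 → b = f) ∧
      (i = if b then c.2 else c.1) ∧ ori b G = del F c ∧ ∃ x, F c = some x ∧ w.ceil = x.ceil ∧
      (c.1 ≠ c.2 → w = x) := by
    intro b i G w F c f h
    cases h with
    | row hij hG hlo hpr =>
      refine ⟨fun h => absurd h (by omega), fun _ => rfl, rfl, (del_upd hG).symm, _, upd_self _ _ _ _,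
        rfl, fun _ => rfl⟩
    | col hij hG hlo hpr =>
      refine ⟨fun h => absurd h (by omega), fun _ => rfl, rfl, ?_, _, upd_self _ _ _ _,
        rfl, fun _ => rfl⟩
      rw [← tr_del, del_upd hG, ori_true]
    | diag hG =>
      refine ⟨fun _ => ⟨rfl, rfl⟩, fun h => absurd rfl h, rfl, (del_upd (hG _)).symm, _,
        upd_self _ _ _ _, rfl, fun h => absurd rfl h⟩
  obtain ⟨a1, a2, a3, a4, x, a5, a6, a7⟩ := key h₁
  obtain ⟨b1, b2, b3, b4, y, b5, b6, b7⟩ := key h₂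
  rw [a5] at b5
  cases b5
  have hb : b₁ = b₂ := by
    by_cases hc : c.1 = c.2
    · rw [(a1 hc).1, (b1 hc).1]
    · rw [a2 hc, b2 hc]
  subst hb
  refine ⟨rfl, a3.trans b3.symm, ?_, ?_⟩
  · rw [← ori_ori b₁ G₁, a4, ← b4, ori_ori]
  · by_cases hc : c.1 = c.2
    · have h1 := (a1 hc).2
      have h2 := (b1 hc).2
      obtain ⟨_, _⟩ := w₁
      obtain ⟨_, _⟩ := w₂
      simp_all
    · rw [a7 hc, b7 hc]

/-- The stages reached while inserting `u` into `F`. -/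
inductive Reach (F : Fil) (u : Letter) : Bool → ℕ → Fil → Letter → Prop
  | refl : Reach F u false 0 F u
  | bump {b i G w G' o} (h : Reach F u b i G w) (hB : Bump G i w G' o) : Reach F u b (i + 1) G' o
  | diag {i G w G' o} (h : Reach F u false i G w) (hD : DStep G i w G' o) :
      Reach F u true (i + 1) (tr G') o

inductive Run : Bool → ℕ → Fil → Letter → Fil → ℕ × ℕ → Bool → Prop
  | halt {b i G w F c f} (h : Stop b i G w F c f) : Run b i G w F c f
  | bump {b i G w G' o F c f} (hB : Bump G i w G' o) (h : Run b (i + 1) G' o F c f) :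
      Run b i G w F c f
  | diag {i G w G' o F c f} (hD : DStep G i w G' o) (h : Run true (i + 1) (tr G') o F c f) :
      Run false i G w F c f

theorem Reach.path {F : Fil} {u : Letter} {b : Bool} {i : ℕ} {G : Fil} {w : Letter}
    (h : Reach F u b i G w) {F' : Fil} {c : ℕ × ℕ} {f : Bool} (h' : Run b i G w F' c f) :
    Run false 0 F u F' c f := by
  induction h with
  | refl => exact h'
  | bump h hB ih => exact ih (.bump hB h')
  | diag h hD ih => exact ih (.diag hD h')

theorem Run.reach {F : Fil} {u : Letter} {b : Bool} {i : ℕ} {G : Fil} {w : Letter} {F' : Fil}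
    {c : ℕ × ℕ} {f : Bool} (h' : Run b i G w F' c f) (h : Reach F u b i G w) :
    ∃ b' i' G' w', Reach F u b' i' G' w' ∧ Stop b' i' G' w' F' c f := by
  induction h' with
  | halt hs => exact ⟨_, _, _, _, h, hs⟩
  | bump hB _ ih => exact ih (.bump h hB)
  | diag hD _ ih => exact ih (.diag h hD)

section Main

variable {z : Equiv.Perm ℤ} {N : ℕ}

theorem Good.dstep {i : ℕ} {G G' : Fil} {w o : Letter} (h : Good z N false i G w)
    (hD : DStep G i w G' o) : Good z N true (i + 1) (tr G') o := by
  obtain ⟨m, hm, hw⟩ : ∃ m, G (i, i) = some m ∧ w.ceil ≤ m.ceil := by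
    cases hD with
    | bump m hm hw => exact ⟨m, hm, hw.le⟩
    | eq m M hm hw => exact ⟨m, hm, hw.ge⟩
  obtain ⟨F', o', hD', hg⟩ := h.dprogress hm hw
  cases hD with
  | bump m' hm' hw' =>
    rw [hm] at hm'
    cases hm'
    cases hD' with
    | bump m' hm' hw' =>
      rw [hm] at hm'
      cases hm'
      exact hg
    | eq m' M hm' hw'' =>
      rw [hm] at hm'
      cases hm'
      omega
  | eq m' M hm' hw' hM hM' hp hp' =>
    rw [hm] at hm'
    cases hm'
    cases hD' with
    | bump m' hm' hw'' =>
      rw [hm] at hm'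
      cases hm'
      omega
    | eq => exact hg

theorem Reach.good {F : Fil} {u : Letter} {b : Bool} {i : ℕ} {G : Fil} {w : Letter}
    (h : Reach F u b i G w) (h0 : Good z N false 0 F u) : Good z N b i G w := by
  induction h with
  | refl => exact h0
  | bump h hB ih => exact ih.bump hB
  | diag h hD ih => exact ih.dstep hD

theorem Run.exists {n : ℕ} {b : Bool} {i : ℕ} {G : Fil} {w : Letter} (h : Good z N b i G w)
    (hR : Room N G) (hn : N ≤ i + n) : ∃ F c f, Run b i G w F c f := by
  induction n generalizing b i G w with
  | zero => exact absurd (h.lt hR) (by omega)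
  | succ n ih =>
    rcases h.progress with hall | ⟨G', o, hB⟩ | ⟨rfl, m, hm, hw⟩
    · obtain ⟨F, c, f, hs⟩ := h.halt hR hall
      exact ⟨F, c, f, .halt hs⟩
    · obtain ⟨F, c, f, hp⟩ := ih (h.bump hB) (hB.dom.room hR) (by omega)
      exact ⟨F, c, f, .bump hB hp⟩
    · obtain ⟨G', o, hD, hg⟩ := h.dprogress hm hw
      obtain ⟨F, c, f, hp⟩ := ih hg (hD.dom.room hR).tr (by omega)
      exact ⟨F, c, f, .diag hD hp⟩

theorem Run.done {b : Bool} {i : ℕ} {G : Fil} {w : Letter} {F : Fil} {c : ℕ × ℕ} {f : Bool}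
    (h : Run b i G w F c f) (hg : Good z N b i G w) (hR : Room N G) : Done z N F := by
  induction h with
  | halt hs => exact hs.done hg hR
  | bump hB _ ih => exact ih (hg.bump hB) (hB.dom.room hR)
  | diag hD _ ih => exact ih (hg.dstep hD) (hD.dom.room hR).tr

theorem Reach.back {i : ℕ} {b : Bool} {G : Fil} {w : Letter} (h : Good z N b i G w) :
    ∃ F u, Good z N false 0 F u ∧ Reach F u b i G w := by
  induction i generalizing b G w with
  | zero =>
    cases b with
    | false => exact ⟨G, w, h, .refl⟩
    | true => exact absurd (h.pos rfl) (lt_irrefl 0)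
  | succ k ih =>
    by_cases hd : b = true → ∀ x, G (k, k) = some x → w.ceil ≤ x.ceil
    · obtain ⟨G', u, hg, hB⟩ := h.unbump hd
      obtain ⟨F, u, h0, hr⟩ := ih hg
      exact ⟨F, u, h0, .bump hr hB⟩
    · push Not at hd
      obtain ⟨rfl, x, hx, hlt⟩ := hd
      obtain ⟨F', w', hg, hD⟩ := Good.undstep (F := tr G) h hx hlt
      obtain ⟨F, u, h0, hr⟩ := ih hg
      exact ⟨F, u, h0, .diag hr hD⟩

theorem Bump.diag_le {k : ℕ} {G G' : Fil} {u w : Letter} (hT : Tab N true G) (hB : Bump G k u G' w) :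
    ∀ x, G' (k, k) = some x → w.ceil ≤ x.ceil := by
  intro x hx
  cases hB with
  | bump j m hj hm hlo hw =>
    rw [upd_ne (by omega)] at hx
    have hv := hT.vd hm
    exact hT.mono' hm hx le_rfl hv
  | eq j m M hj hm hM hw hw' hp =>
    have hv := hT.vd hM
    simp only [Vd] at hv
    simp only [Letter.succL]
    rw [upd_apply] at hx
    split_ifs at hx with hp
    · cases hx
      exact hw'.ge
    · rw [upd_ne (by omega)] at hx
      have := hT.mono' hM hx le_rfl hv
      omega

theorem Reach.det {F₁ F₂ : Fil} {u₁ u₂ : Letter} {b : Bool} {i : ℕ} {G : Fil} {w : Letter}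
    (h₁ : Good z N false 0 F₁ u₁) (h₂ : Good z N false 0 F₂ u₂)
    (r₁ : Reach F₁ u₁ b i G w) (r₂ : Reach F₂ u₂ b i G w) : F₁ = F₂ ∧ u₁ = u₂ := by
  induction i generalizing b G w with
  | zero =>
    cases r₁
    cases r₂
    exact ⟨rfl, rfl⟩
  | succ k ih =>
    cases r₁ with
    | bump r₁ hB₁ =>
      cases r₂ with
      | bump r₂ hB₂ =>
        obtain ⟨rfl, rfl⟩ := Bump.det (r₁.good h₁ |>.bump hB₁).tab (r₁.good h₁).tab (r₂.good h₂).tab hB₁ hB₂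
        exact ih r₁ r₂
      | diag r₂ hD₂ =>
        obtain ⟨x, hx, hlt⟩ := hD₂.lt
        have := hB₁.diag_le (r₁.good h₁).tab x hx
        omega
    | @diag _ _ _ G' _ r₁ hD₁ =>
      generalize hGG : tr G' = G'' at r₂
      cases r₂ with
      | bump r₂ hB₂ =>
        obtain ⟨x, hx, hlt⟩ := hD₁.lt
        have := hB₂.diag_le (r₂.good h₂).tab x (by rw [← hGG]; exact hx)
        omega
      | @diag _ _ _ H' _ r₂ hD₂ =>
        obtain rfl : G' = H' := by rw [← tr_tr G', hGG, tr_tr]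
        obtain ⟨rfl, rfl⟩ := DStep.det (r₁.good h₁).tab (r₂.good h₂).tab hD₁ hD₂
        exact ih r₁ r₂

theorem good_zero {F : Fil} {u : Letter} : Good z N false 0 F u ↔
    Tab N false F ∧ rd (RR N) (fun _ => True) F ++ [u] ∈ RinvPlus z := by
  have h1 : LW N F 0 u = rd (RR N) (fun _ => True) F ++ [u] := by
    rw [LW]
    congr 1
    · congr 1; funext p; simp
    · congr 1
      exact rd_eq_nil fun q _ h => absurd h (Nat.not_lt_zero _)
  constructor
  · intro h
    exact ⟨h.tab, by rw [← h1]; exact h.word⟩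
  · rintro ⟨hT, hw⟩
    refine ⟨hT, ?_, by simp, fun k hk => by omega, by simp⟩
    change LW N F 0 u ∈ _
    rwa [h1]

/-- Reverse insertion exists. -/
theorem Run.back {F : Fil} (h : Done z N F) {c : ℕ × ℕ} (hc : Corner F c) (f : Bool) :
    ∃ G u, Good z N false 0 G u ∧ Run false 0 G u F c f := by
  obtain ⟨b, i, G, w, hg, hs⟩ := Stop.back h hc f
  obtain ⟨F₀, u, h0, hr⟩ := Reach.back hg
  exact ⟨F₀, u, h0, hr.path (.halt hs)⟩

/-- Reverse insertion is unique. -/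
theorem Run.det {F F₁ F₂ : Fil} {u₁ u₂ : Letter} {c : ℕ × ℕ} {f : Bool}
    (h₁ : Good z N false 0 F₁ u₁) (h₂ : Good z N false 0 F₂ u₂)
    (p₁ : Run false 0 F₁ u₁ F c f) (p₂ : Run false 0 F₂ u₂ F c f) : F₁ = F₂ ∧ u₁ = u₂ := by
  obtain ⟨b, i, G, w, r₁, s₁⟩ := p₁.reach .refl
  obtain ⟨b', i', G', w', r₂, s₂⟩ := p₂.reach .refl
  obtain ⟨rfl, rfl, rfl, rfl⟩ := s₁.det s₂
  exact r₁.det h₁ h₂ r₂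

theorem Stop.newbox {b : Bool} {i : ℕ} {G : Fil} {w : Letter} {F : Fil} {c : ℕ × ℕ} {f : Bool}
    (h : Stop b i G w F c f) : ori b G c = none ∧ SameDom (ori b G) (del F c) ∧ ∃ x, F c = some x := by
  cases h with
  | row hij hG hlo hpr =>
    exact ⟨hG, by rw [del_upd hG]; exact SameDom.refl _, _, upd_self _ _ _ _⟩
  | col hij hG hlo hpr =>
    exact ⟨hG, by rw [← tr_del, del_upd hG]; exact SameDom.refl _, _, upd_self _ _ _ _⟩
  | diag hG =>
    exact ⟨hG _, by rw [del_upd (hG _)]; exact SameDom.refl _, _, upd_self _ _ _ _⟩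

theorem Run.newbox {b : Bool} {i : ℕ} {G : Fil} {w : Letter} {F : Fil} {c : ℕ × ℕ} {f : Bool}
    (h : Run b i G w F c f) : ori b G c = none ∧ SameDom (ori b G) (del F c) ∧ ∃ x, F c = some x := by
  have hdom : ∀ {b G G'}, SameDom G G' → SameDom (ori b G) (ori b G') := by
    intro b G G' h
    cases b
    · exact h
    · exact h.tr
  induction h with
  | halt hs => exact hs.newbox
  | bump hB _ ih =>
    exact ⟨(hdom hB.dom _).2 ih.1, (hdom hB.dom).trans ih.2.1, ih.2.2⟩
  | diag hD _ ih =>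
    exact ⟨(hD.dom _).2 ih.1, hD.dom.trans ih.2.1, ih.2.2⟩

end Main

section Lists

variable {α : Type*}

theorem findIdx?_of {l : List α} {p : α → Bool} {k : ℕ} {x : α} (hx : l[k]? = some x)
    (hp : p x = true) (hlt : ∀ k' y, k' < k → l[k']? = some y → p y = false) :
    l.findIdx? p = some k := by
  rw [List.findIdx?_eq_some_iff_getElem]
  obtain ⟨h, rfl⟩ := List.getElem?_eq_some_iff.1 hx
  refine ⟨h, hp, fun j hj => ?_⟩
  rw [Bool.not_eq_true]
  exact hlt j _ hj (List.getElem?_eq_getElem (hj.trans h))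

theorem findIdx?_none {l : List α} {p : α → Bool} (h : ∀ (k : ℕ) (y : α), l[k]? = some y → p y = false) :
    l.findIdx? p = none := by
  rw [List.findIdx?_eq_none_iff]
  intro x hx
  obtain ⟨k, hk⟩ := List.mem_iff_getElem?.1 hx
  exact h k x hk

theorem length_eq_of_getElem? {l : List α} {n : ℕ} (h1 : ∀ k, k < n → l[k]? ≠ none)
    (h2 : l[n]? = none) : l.length = n := by
  apply le_antisymm (List.getElem?_eq_none_iff.1 h2)
  by_contra hlt
  exact h1 l.length (by omega) (List.getElem?_eq_none le_rfl)

theorem getElem?_filterMap_range {f : ℕ → Option α} {n h : ℕ} (hn : h ≤ n)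
    (h1 : ∀ r, r < h → f r ≠ none) (h2 : ∀ r, h ≤ r → f r = none) (k : ℕ) :
    ((List.range n).filterMap fun r => (f r).map fun x => (r, x))[k]? =
      (f k).map fun x => (k, x) := by
  have key : (List.range n).filterMap (fun r => (f r).map fun x => (r, x)) =
      (List.range h).filterMap (fun r => (f r).map fun x => (r, x)) := by
    obtain ⟨m, rfl⟩ := Nat.exists_eq_add_of_le hn
    rw [List.range_add, List.filterMap_append]
    conv_rhs => rw [← List.append_nil ((List.range h).filterMap _)]
    congr 1
    rw [List.filterMap_eq_nil_iff]
    intro a ha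
    obtain ⟨b, -, rfl⟩ := List.mem_map.1 ha
    rw [h2 _ (Nat.le_add_right _ _)]
    rfl
  rw [key]
  clear key hn
  have aux : ∀ h, (∀ r, r < h → f r ≠ none) → ∀ k,
      ((List.range h).filterMap fun r => (f r).map fun x => (r, x))[k]? =
        if k < h then (f k).map fun x => (k, x) else none := by
    intro h
    induction h with
    | zero => intro _ k; simp
    | succ h ih =>
      intro h1 k
      have ih := ih fun r hr => h1 r (by omega)
      obtain ⟨x, hx⟩ := Option.ne_none_iff_exists'.1 (h1 h (Nat.lt_succ_self _))
      have hlen : ((List.range h).filterMap fun r => (f r).map fun x => (r, x)).length = h := by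
        refine length_eq_of_getElem? (fun k hk => ?_) ?_
        · rw [ih, if_pos hk]
          simpa using h1 k (by omega)
        · rw [ih, if_neg (lt_irrefl _)]
      rw [List.range_succ, List.filterMap_append]
      rcases lt_trichotomy k h with hk | rfl | hk
      · rw [List.getElem?_append_left (by omega), ih, if_pos hk, if_pos (by omega)]
      · rw [List.getElem?_append_right (by omega), hlen]
        simp [hx]
      · rw [List.getElem?_append_right (by omega), hlen, if_neg (by omega),
          List.getElem?_eq_none (by simp [hx]; omega)]
  rw [aux h h1]
  split_ifs with hk
  · rfl
  · rw [h2 k (by omega)]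
    rfl

theorem filterMap_getElem?_range (l : List α) {n : ℕ} (h : l.length ≤ n) :
    (List.range n).filterMap (fun k => l[k]?) = l := by
  induction l generalizing n with
  | nil => simp
  | cons a l ih =>
    obtain ⟨m, rfl⟩ : ∃ m, n = m + 1 := ⟨n - 1, by simp at h; omega⟩
    rw [List.range_succ_eq_map, List.filterMap_cons]
    simp only [List.getElem?_cons_zero, List.filterMap_map]
    congr 1
    have := ih (n := m) (by simpa using h)
    simpa [Function.comp_def] using this

end Lists

/-- The filling of a shifted tableau. -/
def ent (T : STab) : Fil := fun p => entry? T p.1 p.2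

theorem ent_apply (T : STab) (r c : ℕ) :
    ent T (r, c) = if r ≤ c then (T.getD r [])[c - r]? else none := by
  unfold ent entry? entryG?
  dsimp only
  rw [List.getD_eq_getElem?_getD]
  cases T[r]? <;> simp

theorem ent_row (T : STab) (r k : ℕ) : (T.getD r [])[k]? = ent T (r, r + k) := by
  rw [ent_apply, if_pos (Nat.le_add_right _ _), Nat.add_sub_cancel_left]

theorem IsShifted.row_pos {T : STab} (h : IsShifted T) {r : ℕ} (hr : r < T.length) :
    0 < (T.getD r []).length := by
  rw [List.getD_eq_getElem _ _ hr]
  exact h.2 _ (List.mem_map_of_mem (List.getElem_mem hr))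

theorem ent_diag {T : STab} (h : IsShifted T) {r : ℕ} : ent T (r, r) = none ↔ T.length ≤ r := by
  have := ent_row T r 0
  rw [Nat.add_zero] at this
  rw [← this, List.getElem?_eq_none_iff]
  constructor
  · intro h1
    by_contra h2
    have := h.row_pos (r := r) (by omega)
    omega
  · intro h1
    rw [List.getD_eq_default _ _ h1]
    exact le_rfl

theorem ent_inj {T T' : STab} (h : IsShifted T) (h' : IsShifted T') (he : ent T = ent T') :
    T = T' := by
  have hl : T.length = T'.length := by
    apply le_antisymm
    · rw [← ent_diag h, he, ent_diag h']
    · rw [← ent_diag h', ← he, ent_diag h]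
  refine List.ext_getElem hl fun r h1 h2 => ?_
  have hr : T.getD r [] = T'.getD r [] := by
    refine List.ext_getElem? fun k => ?_
    rw [ent_row, ent_row, he]
  rwa [List.getD_eq_getElem _ _ h1, List.getD_eq_getElem _ _ h2] at hr

theorem isShifted_of_closed {T : STab} (hne : ∀ row ∈ T, row ≠ [])
    (hcl : ∀ r c x, ent T (r + 1, c) = some x → ∃ y, ent T (r, c) = some y) : IsShifted T := by
  refine ⟨?_, ?_⟩
  · rw [List.Chain', List.isChain_iff_getElem]
    intro r hr
    simp only [shapeOf, List.length_map, List.getElem_map] at hr ⊢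
    have h1 : T[r + 1] ≠ [] := hne _ (List.getElem_mem _)
    have h2 := List.length_pos_iff.2 h1
    obtain ⟨y, hy⟩ := hcl r (r + T[r + 1].length) (T[r + 1][T[r + 1].length - 1]) (by
      rw [ent_apply, if_pos (by omega), List.getD_eq_getElem _ _ hr,
        show r + T[r + 1].length - (r + 1) = T[r + 1].length - 1 by omega,
        List.getElem?_eq_getElem])
    rw [← ent_row, List.getD_eq_getElem _ _ (by omega)] at hy
    exact (List.getElem?_eq_some_iff.1 hy).1
  · intro m hm
    obtain ⟨row, hrow, rfl⟩ := List.mem_map.1 hm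
    exact List.length_pos_iff.2 (hne _ hrow)

theorem ent_setEntryG {T : STab} {r c : ℕ} {m : Letter} (hm : ent T (r, c) = some m) (x : Letter) :
    ent (setEntryG T r c x) = upd (ent T) r c x ∧ shapeOf (setEntryG T r c x) = shapeOf T := by
  rw [ent_apply] at hm
  split_ifs at hm with hrc
  have hlen := (List.getElem?_eq_some_iff.1 hm).1
  have hr : r < T.length := by
    by_contra h
    rw [List.getD_eq_default _ _ (by omega)] at hlen
    exact absurd hlen (Nat.not_lt_zero _)
  unfold setEntryG
  constructor
  · funext ⟨a, b⟩
    rw [upd_apply, ent_apply, ent_apply]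
    by_cases ha : a = r
    · subst ha
      rw [show ∀ l : List Letter, (T.set a l).getD a [] = l by
        intro l; simp [List.getD_eq_getElem?_getD, hr]]
      by_cases hb : b = c
      · subst hb
        rw [if_pos hrc, if_pos ⟨rfl, rfl⟩, List.getElem?_set_self hlen]
      · rw [if_neg (c := a = a ∧ b = c) (by tauto)]
        split_ifs with hab
        · rw [List.getElem?_set_ne (by omega)]
        · rfl
    · rw [if_neg (c := a = r ∧ b = c) (by tauto)]
      rw [show ∀ l : List Letter, (T.set r l).getD a [] = T.getD a [] by
        intro l
        rw [List.getD_eq_getElem?_getD, List.getElem?_set_ne (by omega), ← List.getD_eq_getElem?_getD]]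
  · unfold shapeOf
    rw [List.map_set, List.length_set]
    refine List.ext_getElem? fun k => ?_
    rw [List.getElem?_set]
    split_ifs with h1 h2
    · subst h1
      simp [hr]
    · subst h1
      simp at h2
      omega
    · rfl

theorem setRowG_set {T : STab} {r k : ℕ} (hr : r < T.length) (x : Letter) :
    setRowG T r ((T.getD r []).set k x) = setEntryG T r (r + k) x := by
  unfold setRowG setEntryG
  rw [if_pos hr, Nat.add_sub_cancel_left]

theorem ent_setRowG {T : STab} {r : ℕ} (hr : r ≤ T.length) (x : Letter) :
    ent (setRowG T r (T.getD r [] ++ [x])) = upd (ent T) r (r + (T.getD r []).length) x := by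
  have key : ∀ a, (setRowG T r (T.getD r [] ++ [x])).getD a [] =
      if a = r then T.getD r [] ++ [x] else T.getD a [] := by
    intro a
    unfold setRowG
    split_ifs with h1 h2 h2
    · subst h2
      simp [List.getD_eq_getElem?_getD, h1]
    · rw [List.getD_eq_getElem?_getD, List.getElem?_set_ne (by omega), ← List.getD_eq_getElem?_getD]
    · subst h2
      obtain rfl : a = T.length := by omega
      simp [List.getD_eq_getElem?_getD]
    · rcases lt_or_ge a T.length with h3 | h3
      · simp [List.getD_eq_getElem?_getD, List.getElem?_append_left h3]
      · rw [List.getD_eq_default _ _ (by simp; omega), List.getD_eq_default _ _ h3]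
  funext ⟨a, b⟩
  rw [upd_apply, ent_apply, ent_apply, key]
  by_cases ha : a = r
  · subst ha
    rw [if_pos rfl]
    by_cases hb : b = a + (T.getD a []).length
    · subst hb
      simp
    · rw [if_neg (c := a = a ∧ b = a + (T.getD a []).length) (by tauto)]
      split_ifs with hab
      · rcases lt_or_ge (b - a) (T.getD a []).length with h3 | h3
        · rw [List.getElem?_append_left h3]
        · rw [List.getElem?_eq_none (l := T.getD a []) h3, List.getElem?_eq_none (by
            rw [List.length_append, List.length_singleton]; omega)]
      · rfl
  · rw [if_neg ha, if_neg (c := a = r ∧ b = r + (T.getD r []).length) (by tauto)]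

theorem setRowG_ne_nil {T : STab} (h : ∀ row ∈ T, row ≠ []) {r : ℕ} (l : List Letter) (x : Letter) :
    ∀ row ∈ setRowG T r (l ++ [x]), row ≠ [] := by
  intro row hrow
  unfold setRowG at hrow
  split_ifs at hrow
  · rcases List.mem_or_eq_of_mem_set hrow with h1 | rfl
    · exact h _ h1
    · simp
  · rcases List.mem_append.1 hrow with h1 | h1
    · exact h _ h1
    · rw [List.mem_singleton] at h1; subst h1; simp

theorem IsShifted.ne_nil {T : STab} (h : IsShifted T) : ∀ row ∈ T, row ≠ [] := by
  intro row hrow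
  exact List.length_pos_iff.1 (h.2 _ (List.mem_map_of_mem hrow))

theorem row_length {T : STab} {r s : ℕ} (h : ∀ c, r ≤ c → c < s → ∃ y, ent T (r, c) = some y)
    (hs : ent T (r, s) = none) (hrs : r ≤ s) : (T.getD r []).length = s - r := by
  refine length_eq_of_getElem? (fun k hk => ?_) ?_
  · rw [ent_row]
    obtain ⟨y, hy⟩ := h (r + k) (by omega) (by omega)
    simp [hy]
  · rw [ent_row, show r + (s - r) = s by omega, hs]

theorem add_shifted {T : STab} (h : IsShifted T) {N r s : ℕ} {x : Letter} (hs : ent T (r, s) = none)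
    (hrs : r ≤ s) (hT : Tab N false (upd (ent T) r s x)) :
    (T.getD r []).length = s - r ∧ IsShifted (setRowG T r (T.getD r [] ++ [x])) ∧
      ent (setRowG T r (T.getD r [] ++ [x])) = upd (ent T) r s x := by
  have sub : ∀ {a b}, a ≤ r → b ≤ s → (a < r ∨ b < s) → a ≤ b → ∃ y, ent T (a, b) = some y := by
    intro a b h1 h2 h3 h4
    obtain ⟨y, hy⟩ := hT.cl (upd_self (ent T) r s x) h1 h2 h4
    rw [upd_ne (by omega)] at hy
    exact ⟨y, hy⟩
  have hlen := row_length (fun c h1 h2 => sub le_rfl h2.le (Or.inr h2) h1) hs hrs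
  have hr : r ≤ T.length := by
    by_contra hlt
    obtain ⟨y, hy⟩ := sub (a := T.length) (b := T.length) (by omega) (by omega) (by omega) le_rfl
    rw [(ent_diag h).2 le_rfl] at hy
    cases hy
  have he : ent (setRowG T r (T.getD r [] ++ [x])) = upd (ent T) r s x := by
    rw [ent_setRowG hr, hlen, show r + (s - r) = s by omega]
  refine ⟨hlen, isShifted_of_closed (setRowG_ne_nil h.ne_nil _ _) ?_, he⟩
  intro a c y hy
  rw [he] at hy ⊢
  exact hT.cl hy (by omega) le_rfl (show a ≤ c by have := hT.vd hy; simp only [Vd] at this; omega)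

theorem IsShifted.setEntry {T : STab} (h : IsShifted T) {r c : ℕ} {m : Letter}
    (hm : ent T (r, c) = some m) (x : Letter) :
    IsShifted (setEntryG T r c x) ∧ ent (setEntryG T r c x) = upd (ent T) r c x := by
  obtain ⟨h1, h2⟩ := ent_setEntryG hm x
  refine ⟨?_, h1⟩
  unfold IsShifted
  rw [h2]
  exact h

theorem lt_length_of_ent {T : STab} {r c : ℕ} {m : Letter} (hm : ent T (r, c) = some m) :
    r < T.length := by
  rw [ent_apply] at hm
  split_ifs at hm
  by_contra h
  rw [List.getD_eq_default _ _ (by omega)] at hm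
  simp at hm

theorem switchPrimes_eq {m M : Letter} (h : M.primed = false) :
    switchPrimes m M = (⟨m.ceil, false⟩, ⟨M.ceil, m.primed⟩) := by
  obtain ⟨a, p⟩ := m
  obtain ⟨b, q⟩ := M
  simp only at h
  subst h
  cases p <;> simp [switchPrimes]

theorem ent_getElem? {T : STab} {i j : ℕ} {m : Letter} (hm : ent T (i, j) = some m) (hij : i ≤ j) :
    (T.getD i [])[j - i]? = some m := by
  rw [ent_row, show i + (j - i) = j by omega, hm]

theorem findIdx?_row {T : STab} {i j : ℕ} {m : Letter} (hm : ent T (i, j) = some m) (hij : i ≤ j)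
    {p : Letter → Bool} (hp : p m = true) (hlo : ∀ j' x, j' < j → ent T (i, j') = some x → p x = false) :
    (T.getD i []).findIdx? p = some (j - i) := by
  refine findIdx?_of (ent_getElem? hm hij) hp fun k y hk hy => ?_
  rw [ent_row] at hy
  exact hlo _ y (by omega) hy

theorem egRow_bump {T : STab} (h : IsShifted T) {N i : ℕ} {w o : Letter} {G' : Fil}
    (hT : Tab N false (ent T)) (hB : Bump (ent T) i w G' o) :
    ∃ T', IsShifted T' ∧ ent T' = G' ∧ ∀ n, egRow (n + 1) T i w = egRow n T' (i + 1) o := by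
  cases hB with
  | bump j m hj hm hlo hw =>
    have hij : i ≤ j := hT.vd hm
    obtain ⟨h1, h2⟩ := h.setEntry hm w
    refine ⟨_, h1, h2, fun n => ?_⟩
    have e1 := findIdx?_row hm hij (p := fun x => decide (w.ceil < x.ceil)) (by simpa using hw)
      fun j' x h1 h2 => by have := hlo j' x h1 h2; simp; omega
    have e2 := findIdx?_row hm hij (p := fun x => decide (w.ceil ≤ x.ceil)) (by simpa using hw.le)
      fun j' x h1 h2 => by have := hlo j' x h1 h2; simpa using this
    have e3 : (T.getD i []).getD (j - i) default = o := by
      rw [List.getD_eq_getElem?_getD, ent_getElem? hm hij, Option.getD_some]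
    rw [egRow, e1]
    dsimp only
    rw [e2, Option.getD_some, if_pos rfl, if_neg (by omega), e3, setRowG_set (lt_length_of_ent hm),
      show i + (j - i) = j by omega]
  | eq j m M hj hm hM hw hw' hp =>
    have hij : i ≤ j := hT.vd hm
    obtain ⟨h1, h2⟩ := h.setEntry hm ⟨m.ceil, false⟩
    have hM' : ent (setEntryG T i j ⟨m.ceil, false⟩) (i, j + 1) = some M := by
      rw [h2, upd_ne (by omega), hM]
    obtain ⟨h3, h4⟩ := h1.setEntry hM' ⟨M.ceil, m.primed⟩
    refine ⟨_, h3, h2 ▸ h4, fun n => ?_⟩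
    have e1 := findIdx?_row hM (by omega) (p := fun x => decide (w.ceil < x.ceil)) (by simp; omega)
      fun j' x g1 g2 => by
        have : x.ceil ≤ m.ceil := by
          rcases (Nat.lt_succ_iff.1 g1).eq_or_lt with rfl | h3
          · rw [hm] at g2; cases g2; exact le_rfl
          · exact (hT.mono g2 hm le_rfl h3.le (Or.inr h3)).le
        simp; omega
    have e2 := findIdx?_row hm hij (p := fun x => decide (w.ceil ≤ x.ceil)) (by simp; omega)
      fun j' x h1 h2 => by
        have := hT.mono h2 hm le_rfl h1.le (Or.inr h1)
        simp; omega
    have e3 : (T.getD i []).getD (j - i) default = m := by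
      rw [List.getD_eq_getElem?_getD, ent_getElem? hm hij, Option.getD_some]
    have e4 : (T.getD i []).getD (j + 1 - i) default = M := by
      rw [List.getD_eq_getElem?_getD, ent_getElem? hM (by omega), Option.getD_some]
    have e5 : setRowG T i (((T.getD i []).set (j - i) ⟨m.ceil, false⟩).set (j + 1 - i)
        ⟨M.ceil, m.primed⟩) = setEntryG (setEntryG T i j ⟨m.ceil, false⟩) i (j + 1) ⟨M.ceil, m.primed⟩ := by
      have hi := lt_length_of_ent hm
      unfold setRowG setEntryG
      rw [if_pos hi, List.set_set]
      congr 2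
      simp [List.getD_eq_getElem?_getD, hi]
    rw [egRow, e1]
    dsimp only
    rw [e2, Option.getD_some, if_neg (by omega), if_neg (by omega), e3, e4, switchPrimes_eq hp, e5]

theorem egRow_diag {T : STab} (h : IsShifted T) {N i : ℕ} {w o : Letter} {G' : Fil}
    (hT : Tab N false (ent T)) (hD : DStep (ent T) i w G' o) :
    ∃ T', IsShifted T' ∧ ent T' = G' ∧ ∀ n, egRow (n + 1) T i w = egCol n T' (i + 1) o := by
  have hlo : ∀ {j' x}, j' < i → ent T (i, j') = some x → False := fun h1 h2 => by
    have := hT.vd h2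
    simp only [Vd] at this
    omega
  cases hD with
  | bump m hm hw =>
    obtain ⟨h1, h2⟩ := h.setEntry hm ⟨w.ceil, false⟩
    refine ⟨_, h1, h2, fun n => ?_⟩
    have e1 := findIdx?_row hm le_rfl (p := fun x => decide (w.ceil < x.ceil)) (by simpa using hw)
      fun j' x h1 h2 => (hlo h1 h2).elim
    have e2 := findIdx?_row hm le_rfl (p := fun x => decide (w.ceil ≤ x.ceil)) (by simpa using hw.le)
      fun j' x h1 h2 => (hlo h1 h2).elim
    rw [Nat.sub_self] at e1 e2
    have e3 : (T.getD i []).getD 0 default = m := by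
      have := ent_getElem? hm le_rfl
      rw [Nat.sub_self] at this
      rw [List.getD_eq_getElem?_getD, this, Option.getD_some]
    rw [egRow, e1]
    dsimp only
    rw [e2, Option.getD_some, if_pos rfl, if_pos rfl, e3, setRowG_set (lt_length_of_ent hm)]
    rfl
  | eq m M hm hw hM hw' hp hp' =>
    refine ⟨T, h, rfl, fun n => ?_⟩
    have e1 := findIdx?_row hM (by omega) (p := fun x => decide (w.ceil < x.ceil)) (by simp; omega)
      fun j' x h1 h2 => by
        rcases (Nat.lt_succ_iff.1 h1).eq_or_lt with rfl | h3
        · rw [hm] at h2; cases h2; simp; omega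
        · exact (hlo h3 h2).elim
    have e2 := findIdx?_row hm le_rfl (p := fun x => decide (w.ceil ≤ x.ceil)) (by simp; omega)
      fun j' x h1 h2 => (hlo h1 h2).elim
    rw [Nat.sub_self] at e2
    rw [Nat.add_sub_cancel_left] at e1
    have e0 := ent_getElem? hm le_rfl
    have e0' := ent_getElem? hM (by omega)
    rw [Nat.sub_self] at e0
    rw [Nat.add_sub_cancel_left] at e0'
    have e3 : (T.getD i []).getD 0 default = m := by
      rw [List.getD_eq_getElem?_getD, e0, Option.getD_some]
    have e4 : (T.getD i []).getD 1 default = M := by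
      rw [List.getD_eq_getElem?_getD, e0', Option.getD_some]
    have hmp := hT.diag hm
    have e5 : setRowG T i (((T.getD i []).set 0 ⟨m.ceil, false⟩).set 1 ⟨M.ceil, m.primed⟩) = T := by
      have hi := lt_length_of_ent hm
      unfold setRowG
      rw [if_pos hi]
      have f1 : (⟨m.ceil, false⟩ : Letter) = m := by rw [← hmp]
      have f2 : (⟨M.ceil, m.primed⟩ : Letter) = M := by rw [hmp, ← hp]
      rw [f1, f2]
      refine List.ext_getElem? fun k => ?_
      rw [List.getElem?_set]
      split_ifs with hk
      · subst hk
        rw [List.getElem?_eq_getElem hi]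
        congr 1
        rw [List.getD_eq_getElem _ _ hi] at e0 e0' ⊢
        refine List.ext_getElem? fun k => ?_
        rw [List.getElem?_set, List.getElem?_set]
        have g0 := (List.getElem?_eq_some_iff.1 e0).1
        have g1 := (List.getElem?_eq_some_iff.1 e0').1
        split_ifs with h1 h2 h3
        · subst h1; exact e0'.symm
        · rw [List.length_set] at h2; omega
        · subst h3; exact e0.symm
        · rfl
      · rfl
    rw [egRow, e1]
    dsimp only
    rw [e2, Option.getD_some, if_neg (by omega), if_pos rfl, e3, e4, switchPrimes_eq hp, e5]

/-- The entries of column `c` of a shifted tableau, with their rows. -/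
def occ (T : STab) (c : ℕ) : List (ℕ × Letter) :=
  (List.range (c + 1)).filterMap fun r => (entry? T r c).map fun x => (r, x)

theorem occ_getElem? {T : STab} {N c : ℕ} (hT : Tab N false (ent T)) (k : ℕ) :
    (occ T c)[k]? = (ent T (k, c)).map fun x => (k, x) := by
  have hex : ∃ r, ent T (r, c) = none := by
    refine ⟨c + 1, ?_⟩
    cases h : ent T (c + 1, c) with
    | none => rfl
    | some x =>
      have := hT.vd h
      simp only [Vd] at this
      omega
  classical
  have hle : ∀ r, Nat.find hex ≤ r → ent T (r, c) = none := by
    intro r hr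
    cases h : ent T (r, c) with
    | none => rfl
    | some x =>
      have hv := hT.vd h
      simp only [Vd] at hv
      obtain ⟨y, hy⟩ := hT.cl h hr le_rfl (show _ ≤ c by omega)
      rw [Nat.find_spec hex] at hy
      cases hy
  refine getElem?_filterMap_range (f := fun r => entry? T r c) (h := Nat.find hex) ?_ ?_ hle k
  · apply Nat.find_min' hex
    cases h : ent T (c + 1, c) with
    | none => rfl
    | some x =>
      have := hT.vd h
      simp only [Vd] at this
      omega
  · exact fun r hr => Nat.find_min hex hr

theorem findIdx?_occ {T : STab} {N c r : ℕ} (hT : Tab N false (ent T)) {m : Letter}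
    (hm : ent T (r, c) = some m) {p : ℕ × Letter → Bool} (hp : p (r, m) = true)
    (hlo : ∀ r' x, r' < r → ent T (r', c) = some x → p (r', x) = false) :
    (occ T c).findIdx? p = some r := by
  refine findIdx?_of (x := (r, m)) (by rw [occ_getElem? hT, hm]; rfl) hp fun k y hk hy => ?_
  rw [occ_getElem? hT] at hy
  obtain ⟨x, hx, rfl⟩ := Option.map_eq_some_iff.1 hy
  exact hlo k x hk hx

theorem occ_getD {T : STab} {N c r : ℕ} (hT : Tab N false (ent T)) {m : Letter}
    (hm : ent T (r, c) = some m) : (occ T c).getD r (0, default) = (r, m) := by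
  rw [List.getD_eq_getElem?_getD, occ_getElem? hT, hm]
  rfl

theorem egCol_bump {T : STab} (h : IsShifted T) {N i : ℕ} {w o : Letter} {G' : Fil}
    (hT : Tab N false (ent T)) (hB : Bump (tr (ent T)) i w G' o) :
    ∃ T', IsShifted T' ∧ ent T' = tr G' ∧ ∀ n, egCol (n + 1) T i w = egCol n T' (i + 1) o := by
  cases hB with
  | bump j m hj hm hlo hw =>
    rw [tr_apply] at hm
    obtain ⟨h1, h2⟩ := h.setEntry hm w
    refine ⟨_, h1, by rw [h2, tr_upd, tr_tr], fun n => ?_⟩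
    have e1 := findIdx?_occ hT hm (p := fun x => decide (w.ceil < x.2.ceil)) (by simpa using hw)
      fun j' x h1 h2 => by have := hlo j' x h1 h2; simp; omega
    have e2 := findIdx?_occ hT hm (p := fun x => decide (w.ceil ≤ x.2.ceil)) (by simpa using hw.le)
      fun j' x h1 h2 => by have := hlo j' x h1 h2; simpa using this
    have e3 := occ_getD hT hm
    unfold occ at e1 e2 e3
    rw [egCol, e1]
    dsimp only
    rw [e2, Option.getD_some, if_pos rfl, e3, if_neg (Ne.symm hj)]
  | eq j m M hj hm hM hw hw' hp =>
    rw [tr_apply] at hm hM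
    obtain ⟨h1, h2⟩ := h.setEntry hm ⟨m.ceil, false⟩
    have hM' : ent (setEntryG T j i ⟨m.ceil, false⟩) (j + 1, i) = some M := by
      rw [h2, upd_ne (by omega), hM]
    obtain ⟨h3, h4⟩ := h1.setEntry hM' ⟨M.ceil, m.primed⟩
    refine ⟨_, h3, by rw [h4, h2, tr_upd, tr_upd, tr_tr], fun n => ?_⟩
    have e1 := findIdx?_occ hT hM (p := fun x => decide (w.ceil < x.2.ceil)) (by simp; omega)
      fun j' x g1 g2 => by
        have : x.ceil ≤ m.ceil := by
          rcases (Nat.lt_succ_iff.1 g1).eq_or_lt with rfl | h3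
          · rw [hm] at g2; cases g2; exact le_rfl
          · exact (hT.mono g2 hm h3.le le_rfl (Or.inl h3)).le
        simp; omega
    have e2 := findIdx?_occ hT hm (p := fun x => decide (w.ceil ≤ x.2.ceil)) (by simp; omega)
      fun j' x h1 h2 => by
        have := hT.mono h2 hm h1.le le_rfl (Or.inl h1)
        simp; omega
    have e3 := occ_getD hT hm
    have e4 := occ_getD hT hM
    unfold occ at e1 e2 e3 e4
    rw [egCol, e1]
    dsimp only
    rw [e2, Option.getD_some, if_neg (by omega), e3, e4, switchPrimes_eq hp]

theorem egRow_halt {T : STab} (h : IsShifted T) {N i : ℕ} {w : Letter} {F : Fil} {c : ℕ × ℕ} {f : Bool}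
    (hs : Stop false i (ent T) w F c f) (hF : Tab N false F) :
    ∃ T', IsShifted T' ∧ ent T' = F ∧ ∀ n, egRow (n + 1) T i w = (T', f) := by
  cases hs with
  | @row i j G w hij hG hlo hpr =>
    obtain ⟨h1, h2, h3⟩ := add_shifted h hG hij.le hF
    refine ⟨_, h2, h3, fun n => ?_⟩
    have e1 : (T.getD i []).findIdx? (fun x => decide (w.ceil < x.ceil)) = none := by
      refine findIdx?_none fun k y hy => ?_
      rw [ent_row] at hy
      have := hlo _ _ hy
      simp; omega
    rw [egRow, e1]
    dsimp only
    rw [if_neg]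
    rintro ⟨h4, -⟩
    rw [List.isEmpty_iff] at h4
    rw [h4] at h1
    simp at h1
    omega
  | @diag i G w hG =>
    obtain ⟨h1, h2, h3⟩ := add_shifted h (hG i) le_rfl hF
    have h4 : T.getD i [] = [] := by
      rw [Nat.sub_self] at h1
      exact List.length_eq_zero_iff.1 h1
    rw [h4, List.nil_append] at h2 h3
    refine ⟨_, h2, h3, fun n => ?_⟩
    rw [egRow, h4]
    obtain ⟨a, p⟩ := w
    cases p <;> rfl

theorem egCol_halt {T : STab} (h : IsShifted T) {N i : ℕ} {w : Letter} {F : Fil} {c : ℕ × ℕ} {f : Bool}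
    (hT : Tab N false (ent T)) (hs : Stop true i (tr (ent T)) w F c f) (hF : Tab N false F) :
    ∃ T', IsShifted T' ∧ ent T' = F ∧ ∀ n, egCol (n + 1) T i w = (T', f) := by
  cases hs with
  | @col i j G w hij hG hlo hpr =>
    rw [tr_upd, tr_tr] at hF ⊢
    rw [tr_apply] at hG
    obtain ⟨h1, h2, h3⟩ := add_shifted h hG hij.le hF
    refine ⟨_, h2, h3, fun n => ?_⟩
    have e1 : (occ T i).findIdx? (fun x => decide (w.ceil < x.2.ceil)) = none := by
      refine findIdx?_none fun k y hy => ?_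
      rw [occ_getElem? hT] at hy
      obtain ⟨x, hx, rfl⟩ := Option.map_eq_some_iff.1 hy
      have := hlo _ _ hx
      simp; omega
    have e2 : (occ T i).length = j := by
      refine length_eq_of_getElem? (fun k hk => ?_) ?_
      · rw [occ_getElem? hT]
        obtain ⟨y, hy⟩ := hpr k hk
        rw [tr_apply] at hy
        simp [hy]
      · rw [occ_getElem? hT, hG]
        rfl
    unfold occ at e1 e2
    rw [egCol, e1]
    dsimp only
    rw [e2, if_neg (by omega), if_neg (by omega)]

theorem eg_run {z : Equiv.Perm ℤ} {N B : ℕ} {b : Bool} {i : ℕ} {G : Fil} {w : Letter} {F : Fil}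
    {c : ℕ × ℕ} {f : Bool} (hr : Run b i G w F c f) (hg : Good z N b i G w) (hR : Room N G)
    (hB : Room B G) {n : ℕ} (hn : B ≤ n + i) {T : STab} (hS : IsShifted T) (hE : ent T = ori b G) :
    ∃ T', IsShifted T' ∧ ent T' = F ∧ (if b then egCol n T i w else egRow n T i w) = (T', f) := by
  have fuel : ∀ {b i G w n}, Good z N b i G w → Room B G → B ≤ n + i → ∃ k, n = k + 1 := by
    intro b i G w n hg hB hn
    have := hg.lt hB
    exact ⟨n - 1, by omega⟩
  induction hr generalizing n T with
  | @halt b i G w F c f hs =>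
    obtain ⟨n, rfl⟩ := fuel hg hB hn
    have hF := (hs.done hg hR).tab
    cases b with
    | false =>
      rw [ori_false] at hE
      subst hE
      obtain ⟨T', h1, h2, h3⟩ := egRow_halt hS hs hF
      exact ⟨T', h1, h2, h3 n⟩
    | true =>
      obtain rfl : G = tr (ent T) := by rw [hE]; rfl
      obtain ⟨T', h1, h2, h3⟩ := egCol_halt hS (by simpa using hg.tab.tr) hs hF
      exact ⟨T', h1, h2, h3 n⟩
  | @bump b i G w G' o F c f hBu h ih =>
    obtain ⟨n, rfl⟩ := fuel hg hB hn
    cases b with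
    | false =>
      rw [ori_false] at hE
      subst hE
      obtain ⟨T', h1, h2, h3⟩ := egRow_bump hS hg.tab hBu
      obtain ⟨T'', h4, h5, h6⟩ := ih (hg.bump hBu) (hBu.dom.room hR) (hBu.dom.room hB) (n := n)
        (by omega) h1 h2
      exact ⟨T'', h4, h5, (h3 n).trans h6⟩
    | true =>
      obtain rfl : G = tr (ent T) := by rw [hE]; rfl
      obtain ⟨T', h1, h2, h3⟩ := egCol_bump hS (by simpa using hg.tab.tr) hBu
      obtain ⟨T'', h4, h5, h6⟩ := ih (hg.bump hBu) (hBu.dom.room hR) (hBu.dom.room hB) (n := n)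
        (by omega) h1 h2
      exact ⟨T'', h4, h5, (h3 n).trans h6⟩
  | @diag i G w G' o F c f hD h ih =>
    obtain ⟨n, rfl⟩ := fuel hg hB hn
    rw [ori_false] at hE
    subst hE
    obtain ⟨T', h1, h2, h3⟩ := egRow_diag hS hg.tab hD
    obtain ⟨T'', h4, h5, h6⟩ := ih (hg.dstep hD) (hD.dom.room hR).tr (hD.dom.room hB).tr (n := n)
      (by omega) h1 h2
    exact ⟨T'', h4, h5, (h3 n).trans h6⟩

/-- The side of a square window with room for one more box. -/
def side (T : STab) : ℕ := T.flatten.length + T.length + 2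

theorem room_side (T : STab) : Room (side T) (ent T) := by
  refine ⟨by unfold side; omega, fun r c x hx => ?_⟩
  have hr := lt_length_of_ent hx
  rw [ent_apply] at hx
  split_ifs at hx with hrc
  have h1 := (List.getElem?_eq_some_iff.1 hx).1
  rw [List.getD_eq_getElem _ _ hr] at h1
  have h2 : T[r].length ≤ T.flatten.length :=
    (List.sublist_flatten_of_mem (List.getElem_mem hr)).length_le
  unfold side
  omega

theorem egInsert_run {z : Equiv.Perm ℤ} {N : ℕ} {T : STab} {u : Letter} {F : Fil} {c : ℕ × ℕ} {f : Bool}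
    (hS : IsShifted T) (hg : Good z N false 0 (ent T) u) (hR : Room N (ent T))
    (hr : Run false 0 (ent T) u F c f) :
    IsShifted (egInsert T u).1 ∧ ent (egInsert T u).1 = F ∧ (egInsert T u).2 = f := by
  obtain ⟨T', h1, h2, h3⟩ := eg_run hr hg hR (room_side T) (n := side T) (by omega) hS rfl
  have : egInsert T u = (T', f) := h3
  rw [this]
  exact ⟨h1, h2, rfl⟩

theorem getElem?_filterMap_range' {α : Type*} {f : ℕ → Option α} {n h : ℕ} (hn : h ≤ n)
    (h1 : ∀ r, r < h → f r ≠ none) (h2 : ∀ r, h ≤ r → f r = none) (k : ℕ) :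
    ((List.range n).filterMap f)[k]? = f k := by
  have h3 := getElem?_filterMap_range hn h1 h2 k
  have h4 : (List.range n).filterMap f =
      ((List.range n).filterMap fun r => (f r).map fun x => (r, x)).map Prod.snd := by
    rw [List.map_filterMap]
    congr 1
    funext r
    cases f r <;> rfl
  rw [h4, List.getElem?_map, h3]
  cases f k <;> rfl

theorem rowWord_eq {T : STab} {N : ℕ} (hS : IsShifted T)
    (hN : ∀ r c x, ent T (r, c) = some x → r < N ∧ c < N) :
    rowWord T = rd (RR N) (fun _ => True) (ent T) := by
  have hrow : ∀ r, r < N → (List.range N).filterMap (fun c => ent T (r, c)) = T.getD r [] := by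
    intro r hr
    obtain ⟨m, rfl⟩ := Nat.exists_eq_add_of_le hr.le
    rw [List.range_add, List.filterMap_append]
    have h1 : (List.range r).filterMap (fun c => ent T (r, c)) = [] := by
      rw [List.filterMap_eq_nil_iff]
      intro c hc
      rw [ent_apply, if_neg (by have := List.mem_range.1 hc; omega)]
    rw [h1, List.nil_append, List.filterMap_map]
    have h2 : ((fun c => ent T (r, c)) ∘ fun x => r + x) = fun k => (T.getD r [])[k]? := by
      funext k
      exact (ent_row T r k).symm
    rw [h2]
    apply filterMap_getElem?_range
    by_contra hlt
    have h3 : (T.getD r [])[m]? = some _ := List.getElem?_eq_getElem (by omega)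
    rw [ent_row] at h3
    have := (hN _ _ _ h3).2
    omega
  have hlen : T.length ≤ N := by
    by_contra hlt
    have h1 := hS.row_pos (r := N) (by omega)
    have h3 : (T.getD N [])[0]? = some _ := List.getElem?_eq_getElem h1
    rw [ent_row] at h3
    have := (hN _ _ _ h3).1
    omega
  have hT : (List.range N).flatMap (fun r => [T.getD r []]) =
      T ++ List.replicate (N - T.length) [] := by
    obtain ⟨m, rfl⟩ := Nat.exists_eq_add_of_le hlen
    rw [← List.map_eq_flatMap]
    refine List.ext_getElem? fun k => ?_
    rw [List.getElem?_map, Nat.add_sub_cancel_left]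
    rcases lt_or_ge k T.length with hk | hk
    · rw [List.getElem?_append_left hk, List.getElem?_range (by omega), Option.map_some,
        List.getD_eq_getElem _ _ hk, List.getElem?_eq_getElem hk]
    · rw [List.getElem?_append_right hk, List.getElem?_replicate]
      split_ifs with h1
      · rw [List.getElem?_range (by omega), Option.map_some, List.getD_eq_default _ _ hk]
      · rw [List.getElem?_eq_none (by simp; omega)]
        rfl
  have e1 : rd (RR N) (fun _ => True) (ent T) =
      ((List.range N).reverse.map fun r => T.getD r []).flatten := by
    unfold rd sel RR
    rw [List.filter_eq_self.2 (by simp), List.filterMap_flatMap, List.flatMap_def]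
    congr 1
    refine List.map_congr_left fun r hr => ?_
    rw [List.filterMap_map]
    exact hrow r (by simpa using hr)
  rw [e1, List.map_reverse]
  rw [← List.map_eq_flatMap] at hT
  rw [hT]
  unfold rowWord
  rw [List.reverse_append, List.flatten_append, List.reverse_replicate]
  simp

theorem exists_ent_of {N : ℕ} {G : Fil} (hvd : ∀ {i j x}, G (i, j) = some x → i ≤ j)
    (hlt : ∀ {i j x}, G (i, j) = some x → i < N ∧ j < N)
    (hcl : ∀ {i j i' j' x}, G (i, j) = some x → i' ≤ i → j' ≤ j → i' ≤ j' → ∃ y, G (i', j') = some y) :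
    ∃ T, IsShifted T ∧ ent T = G := by
  classical
  have hex : ∃ r, G (r, r) = none := by
    refine ⟨N, ?_⟩
    cases h : G (N, N) with
    | none => rfl
    | some x => have := hlt h; omega
  have hnone : ∀ r c, Nat.find hex ≤ r → G (r, c) = none := by
    intro r c hr
    cases h : G (r, c) with
    | none => rfl
    | some x =>
      have hv := hvd h
      obtain ⟨y, hy⟩ := hcl h hr (hr.trans hv) (show Nat.find hex ≤ Nat.find hex from le_rfl)
      rw [Nat.find_spec hex] at hy
      cases hy
  have hrow : ∀ r k, ((List.range N).filterMap fun k => G (r, r + k))[k]? = G (r, r + k) := by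
    intro r k
    have hex : ∃ k, G (r, r + k) = none := by
      refine ⟨N, ?_⟩
      cases h : G (r, r + N) with
      | none => rfl
      | some x => have := hlt h; omega
    refine getElem?_filterMap_range' (f := fun k => G (r, r + k)) (h := Nat.find hex) ?_ ?_ ?_ k
    · apply Nat.find_min' hex
      cases h : G (r, r + N) with
      | none => rfl
      | some x => have := hlt h; omega
    · exact fun r hr => Nat.find_min hex hr
    · intro k hk
      cases h : G (r, r + k) with
      | none => rfl
      | some x =>
        obtain ⟨y, hy⟩ := hcl h le_rfl (show r + Nat.find hex ≤ r + k by omega) (show r ≤ _ by omega)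
        rw [Nat.find_spec hex] at hy
        cases hy
  set T : STab := (List.range (Nat.find hex)).map fun r => (List.range N).filterMap fun k => G (r, r + k)
    with hTdef
  have hE : ent T = G := by
    funext ⟨r, c⟩
    rw [ent_apply]
    split_ifs with hrc
    · rcases lt_or_ge r (Nat.find hex) with hr | hr
      · rw [hTdef, List.getD_eq_getElem _ _ (by simpa using hr)]
        rw [List.getElem_map, List.getElem_range, hrow, show r + (c - r) = c by omega]
      · rw [List.getD_eq_default _ _ (by simpa [hTdef] using hr), hnone _ _ hr]
        rfl
    · cases h : G (r, c) with
      | none => rfl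
      | some x => exact absurd (hvd h) hrc
  refine ⟨T, isShifted_of_closed ?_ ?_, hE⟩
  · intro row hrow' hnil
    obtain ⟨r, hr, rfl⟩ := List.mem_map.1 hrow'
    have h1 := hrow r 0
    rw [hnil] at h1
    exact Nat.find_min hex (List.mem_range.1 hr) h1.symm
  · intro r c x hx
    rw [hE] at hx ⊢
    exact hcl hx (Nat.le_succ r) le_rfl (show r ≤ c by have := hvd hx; omega)

theorem exists_ent {N : ℕ} {G : Fil} (hT : Tab N false G) : ∃ T, IsShifted T ∧ ent T = G :=
  exists_ent_of hT.vd hT.lt hT.cl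

theorem Tab.resize {N N' : ℕ} {b : Bool} {G : Fil} (h : Tab N b G)
    (hN : ∀ i j x, G (i, j) = some x → i < N' ∧ j < N') : Tab N' b G :=
  ⟨h.vd, fun hx => hN _ _ _ hx, h.cl, h.mono, h.diag⟩

theorem Room.lt {N : ℕ} {G : Fil} (h : Room N G) : ∀ i j x, G (i, j) = some x → i < N ∧ j < N :=
  fun i j x hx => by have := h.2 i j x hx; omega

/-- Insertion tableaux of primed involution words of `z`. -/
structure PT (z : Equiv.Perm ℤ) (T : STab) : Prop where
  shifted : IsShifted T
  tab : ∃ N, Tab N false (ent T)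
  word : rowWord T ∈ RinvPlus z

theorem Done.toPT {z : Equiv.Perm ℤ} {N : ℕ} {T : STab} (h : Done z N (ent T)) (hS : IsShifted T) :
    PT z T :=
  ⟨hS, ⟨N, h.tab⟩, by rw [rowWord_eq hS fun _ _ _ hx => h.tab.lt hx]; exact h.word⟩

theorem PT.done {z : Equiv.Perm ℤ} {N : ℕ} {T : STab} (h : PT z T) (hR : Room N (ent T)) :
    Done z N (ent T) := by
  obtain ⟨M, hM⟩ := h.tab
  exact ⟨hM.resize hR.lt, by rw [← rowWord_eq h.shifted hR.lt]; exact h.word⟩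

theorem SameDom.length {T Q : STab} {r : ℕ} (h : ∀ c, ent T (r, c) = none ↔ ent Q (r, c) = none) :
    (T.getD r []).length = (Q.getD r []).length := by
  have key : ∀ k, (T.getD r []).length ≤ k ↔ (Q.getD r []).length ≤ k := by
    intro k
    rw [← List.getElem?_eq_none_iff, ← List.getElem?_eq_none_iff, ent_row, ent_row, h]
  exact le_antisymm ((key _).2 le_rfl) ((key _).1 le_rfl)

theorem SameDom.shapeOf {T Q : STab} (hT : IsShifted T) (hQ : IsShifted Q) (h : SameDom (ent T) (ent Q)) :
    shapeOf T = shapeOf Q := by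
  have hl : T.length = Q.length := by
    apply le_antisymm
    · rw [← ent_diag hT, h, ent_diag hQ]
    · rw [← ent_diag hQ, ← h, ent_diag hT]
  refine List.ext_getElem (by simpa [_root_.shapeOf] using hl) fun r h1 h2 => ?_
  have h3 : r < T.length := by simpa [_root_.shapeOf] using h1
  have := SameDom.length (r := r) fun c => h (r, c)
  rw [List.getD_eq_getElem _ _ h3, List.getD_eq_getElem _ _ (hl ▸ h3)] at this
  simpa [_root_.shapeOf] using this

theorem sameDom_of_shapeOf {T Q : STab} (h : shapeOf T = shapeOf Q) : SameDom (ent T) (ent Q) := by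
  rintro ⟨r, c⟩
  rw [ent_apply, ent_apply]
  have h1 : (T.getD r []).length = (Q.getD r []).length := by
    have h2 := congrArg (fun l => (l[r]?).getD 0) h
    simp only [shapeOf, List.getElem?_map] at h2
    rw [List.getD_eq_getElem?_getD, List.getD_eq_getElem?_getD]
    cases hT : T[r]? <;> cases hQ : Q[r]? <;> simp [hT, hQ] at h2 ⊢ <;> omega
  split_ifs
  · rw [List.getElem?_eq_none_iff, List.getElem?_eq_none_iff, h1]
  · rfl

theorem addBox_eq {Q T T' : STab} {N : ℕ} {c : ℕ × ℕ} {x y : Letter} (hT' : Tab N false (ent T'))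
    (hQ : SameDom (ent Q) (ent T)) (hc : ent T' c = some y) (hd : SameDom (ent T) (del (ent T') c))
    (hQS : IsShifted Q) :
    IsShifted (addBox Q T T' x) ∧ ent (addBox Q T T' x) = upd (ent Q) c.1 c.2 x ∧
      SameDom (ent (addBox Q T T' x)) (ent T') := by
  obtain ⟨r, s⟩ := c
  dsimp only
  have hrs : r ≤ s := hT'.vd hc
  have hdom : ∀ a b, (a, b) ≠ (r, s) → (ent Q (a, b) = none ↔ ent T' (a, b) = none) := by
    intro a b hab
    rw [hQ, hd]
    simp only [del, if_neg hab]
  have hTc : ent T (r, s) = none := by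
    rw [hd]
    simp [del]
  have hQc : ent Q (r, s) = none := (hQ _).2 hTc
  have hr : r ≤ Q.length := by
    by_contra hlt
    obtain ⟨y', hy'⟩ := hT'.cl hc (i' := Q.length) (j' := Q.length) (by omega) (by omega)
      (show Q.length ≤ Q.length from le_rfl)
    have h1 := (ent_diag hQS).2 (le_refl Q.length)
    rw [hdom _ _ (by simp; omega), hy'] at h1
    cases h1
  have hlen : (Q.getD r []).length = s - r := by
    refine row_length (fun b h1 h2 => ?_) hQc hrs
    obtain ⟨y', hy'⟩ := hT'.cl hc (i' := r) (j' := b) le_rfl h2.le (show r ≤ b from h1)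
    apply Option.ne_none_iff_exists'.1
    rw [ne_eq, hdom _ _ (by simp; omega), hy']
    simp
  have hfind : addBox Q T T' x = setRowG Q r (Q.getD r [] ++ [x]) := by
    have hp : ∀ a, (T.getD a []).length ≠ (T'.getD a []).length ↔ a = r := by
      intro a
      constructor
      · intro h1
        by_contra h2
        apply h1
        refine SameDom.length fun b => ?_
        rw [← hQ, hdom _ _ (by simp; omega)]
      · rintro rfl h1
        have h2 := ent_getElem? hc hrs
        have h3 : (T.getD a [])[s - a]? = none := by
          rw [ent_row, show a + (s - a) = s by omega, hTc]
        rw [List.getElem?_eq_none_iff, h1, ← List.getElem?_eq_none_iff, h2] at h3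
        cases h3
    unfold addBox
    split
    · next a ha =>
      have h1 := List.find?_some ha
      rw [decide_eq_true_iff] at h1
      rw [(hp a).1 h1]
    · next ha =>
      rw [List.find?_eq_none] at ha
      have := ha r (List.mem_range.2 (lt_length_of_ent hc))
      rw [decide_eq_true_iff] at this
      exact absurd ((hp r).2 rfl) this
  have hE : ent (addBox Q T T' x) = upd (ent Q) r s x := by
    rw [hfind, ent_setRowG hr, hlen, show r + (s - r) = s by omega]
  have hD : SameDom (ent (addBox Q T T' x)) (ent T') := by
    rintro ⟨a, b⟩
    rw [hE]
    by_cases hab : (a, b) = (r, s)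
    · rw [hab, hc, upd_self]
      simp
    · rw [upd_ne (by simp at hab; omega), hdom _ _ hab]
  refine ⟨?_, hE, hD⟩
  rw [hfind] at hD ⊢
  refine isShifted_of_closed (setRowG_ne_nil hQS.ne_nil _ _) fun a b t ht => ?_
  apply Option.ne_none_iff_exists'.1
  rw [ne_eq, hD]
  obtain ⟨t', ht'⟩ : ∃ t', ent T' (a + 1, b) = some t' := by
    apply Option.ne_none_iff_exists'.1
    rw [ne_eq, ← hD, ht]
    simp
  obtain ⟨t'', hlen₂⟩ := hT'.cl ht' (Nat.le_succ a) le_rfl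
    (show a ≤ b by have := hT'.vd ht'; simp only [Vd] at this; omega)
  rw [hlen₂]
  simp

/-- Insertion of `u` into `T` adds the box `c` and has flag `f`. -/
structure Ins (z : Equiv.Perm ℤ) (T : STab) (u : Letter) (T' : STab) (c : ℕ × ℕ) (f : Bool) : Prop where
  shifted : IsShifted T
  good : ∀ N, Room N (ent T) → Good z N false 0 (ent T) u
  run : Run false 0 (ent T) u (ent T') c f
  eq : egInsert T u = (T', f)
  pt : PT z T'

theorem Ins.word {z : Equiv.Perm ℤ} {T T' : STab} {u : Letter} {c : ℕ × ℕ} {f : Bool}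
    (h : Ins z T u T' c f) : (∃ N, Tab N false (ent T)) ∧ rowWord T ++ [u] ∈ RinvPlus z := by
  have h1 := good_zero.1 (h.good _ (room_side T))
  rw [rowWord_eq h.shifted (room_side T).lt]
  exact ⟨⟨_, h1.1⟩, h1.2⟩

theorem Ins.exists {z : Equiv.Perm ℤ} {T : STab} {u : Letter} (hS : IsShifted T)
    (hT : ∃ N, Tab N false (ent T)) (hw : rowWord T ++ [u] ∈ RinvPlus z) :
    ∃ T' c f, Ins z T u T' c f := by
  obtain ⟨M, hM⟩ := hT
  have hg : ∀ N, Room N (ent T) → Good z N false 0 (ent T) u := fun N hR =>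
    good_zero.2 ⟨hM.resize hR.lt, by rw [← rowWord_eq hS hR.lt]; exact hw⟩
  have hR := room_side T
  obtain ⟨F, c, f, hr⟩ := Run.exists (hg _ hR) hR (n := side T) (by omega)
  obtain ⟨h1, h2, h3⟩ := egInsert_run hS (hg _ hR) hR hr
  rw [← h2] at hr
  exact ⟨_, c, f, hS, hg, hr, Prod.ext rfl h3, (hr.done (hg _ hR) hR).toPT h1⟩

theorem Ins.back {z : Equiv.Perm ℤ} {T' : STab} (h : PT z T') {c : ℕ × ℕ} (hc : Corner (ent T') c)
    (f : Bool) : ∃ T u, Ins z T u T' c f := by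
  have hR' := room_side T'
  obtain ⟨G, u, hg, hr⟩ := Run.back (h.done hR') hc f
  obtain ⟨T, hS, rfl⟩ := exists_ent hg.tab
  have hR : Room (side T') (ent T) := by
    refine ⟨hR'.1, fun i j x hx => ?_⟩
    obtain ⟨y, hy⟩ : ∃ y, ent T' (i, j) = some y := by
      apply Option.ne_none_iff_exists'.1
      intro h0
      have h1 := (hr.newbox.2.1 (i, j)).2 (by simp [del, h0])
      rw [ori_false, hx] at h1
      cases h1
    exact hR'.2 _ _ _ hy
  have hw := (good_zero.1 hg).2
  rw [← rowWord_eq hS hR.lt] at hw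
  have hg' : ∀ N, Room N (ent T) → Good z N false 0 (ent T) u := fun N hR =>
    good_zero.2 ⟨hg.tab.resize hR.lt, by rw [← rowWord_eq hS hR.lt]; exact hw⟩
  obtain ⟨h1, h2, h3⟩ := egInsert_run hS (hg' _ hR) hR hr
  refine ⟨T, u, hS, hg', hr, ?_, h⟩
  exact Prod.ext (ent_inj h1 h.shifted h2) h3

theorem Ins.det {z : Equiv.Perm ℤ} {T₁ T₂ T' : STab} {u₁ u₂ : Letter} {c : ℕ × ℕ} {f : Bool}
    (h₁ : Ins z T₁ u₁ T' c f) (h₂ : Ins z T₂ u₂ T' c f) : T₁ = T₂ ∧ u₁ = u₂ := by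
  set N := side T₁ + side T₂
  have hR₁ : Room N (ent T₁) := ⟨by have := (room_side T₁).1; omega, fun i j x hx => by
    have := (room_side T₁).2 i j x hx; omega⟩
  have hR₂ : Room N (ent T₂) := ⟨by have := (room_side T₁).1; omega, fun i j x hx => by
    have := (room_side T₂).2 i j x hx; omega⟩
  obtain ⟨h, rfl⟩ := Run.det (h₁.good N hR₁) (h₂.good N hR₂) h₁.run h₂.run
  exact ⟨ent_inj h₁.shifted h₂.shifted h, rfl⟩

theorem Letter.lt_def {x y : Letter} :
    x < y ↔ x.ceil < y.ceil ∨ x.ceil = y.ceil ∧ x.primed = true ∧ y.primed = false := by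
  change toLex (x.ceil, !x.primed) < toLex (y.ceil, !y.primed) ↔ _
  rw [Prod.Lex.toLex_lt_toLex]
  cases x.primed <;> cases y.primed <;> simp

theorem Letter.lt_of_ceil {x y : Letter} (h : x.ceil < y.ceil) : x < y :=
  Letter.lt_def.2 (Or.inl h)

theorem Letter.ceil_le {x y : Letter} (h : x ≤ y) : x.ceil ≤ y.ceil := by
  by_contra hlt
  exact absurd h (not_le.2 (Letter.lt_of_ceil (by omega)))

/-- Fillings of shifted shapes with no primes on the diagonal, whose reading words are primed
involution words, and with increasing rows and columns. -/
structure Pre (z : Equiv.Perm ℤ) (N : ℕ) (F : Fil) : Prop where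
  vd : ∀ {i j x}, F (i, j) = some x → i ≤ j
  lt : ∀ {i j x}, F (i, j) = some x → i < N ∧ j < N
  cl : ∀ {i j i' j' x}, F (i, j) = some x → i' ≤ i → j' ≤ j → i' ≤ j' → ∃ y, F (i', j') = some y
  row : ∀ {i j x y}, F (i, j) = some x → F (i, j + 1) = some y → x < y
  col : ∀ {i j x y}, F (i, j) = some x → F (i + 1, j) = some y → x < y
  diag : ∀ {i x}, F (i, i) = some x → x.primed = false
  word : rd (RR N) (fun _ => True) F ∈ RinvPlus z

theorem split_row (N i : ℕ) (F : Fil) : rd (RR N) (fun _ => True) F =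
    rd (RR N) (fun p => i + 1 ≤ p.1) F ++ rd (RR N) (fun p => p.1 = i) F ++
      rd (RR N) (fun p => p.1 < i) F := by
  rw [← rows_split]
  exact rd_split (RR_pairwise N) F (by intros; omega) (fun p => by simpa using le_or_gt i p.1)
    (by intros; omega)

namespace Pre

theorem row_lt {z : Equiv.Perm ℤ} {N : ℕ} {F : Fil} (h : Pre z N F)
    {i j : ℕ} {x y : Letter} (hx : F (i, j) = some x) (hy : F (i, j + 1) = some y) :
    x.ceil < y.ceil := by
  rcases Letter.lt_def.1 (h.row hx hy) with h1 | h1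
  · exact h1
  · exfalso
    refine (locCls_RinvPlus z).ne (rd (RR N) (fun p => i + 1 ≤ p.1) F ++
      rd (RR N) (fun p => p.1 = i ∧ p.2 < j) F) x y (rd (RR N) (fun p => p.1 = i ∧ j + 1 < p.2) F ++
      rd (RR N) (fun p => p.1 < i) F) ?_ h1.1
    have := h.word
    rw [split_row N i, line_split hx (h.lt hx).1 (h.lt hx).2, line_split_eq hy (h.lt hy).1 (h.lt hy).2]
      at this
    simpa using this

theorem row_mono {z : Equiv.Perm ℤ} {N : ℕ} {F : Fil} (h : Pre z N F)
    {i j j' : ℕ} {x y : Letter} (hx : F (i, j) = some x) (hy : F (i, j') = some y)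
    (hj : j < j') : x.ceil < y.ceil := by
  induction j', hj using Nat.le_induction generalizing y with
  | base => exact h.row_lt hx hy
  | succ k hk ih =>
    obtain ⟨t, ht⟩ := h.cl hy le_rfl (Nat.le_succ k) (by have := h.vd hx; omega)
    exact (ih ht).trans (h.row_lt ht hy)

theorem row_le {z : Equiv.Perm ℤ} {N : ℕ} {F : Fil} (h : Pre z N F)
    {i j j' : ℕ} {x y : Letter} (hx : F (i, j) = some x) (hy : F (i, j') = some y)
    (hj : j ≤ j') : x.ceil ≤ y.ceil := by
  rcases hj.eq_or_lt with rfl | hj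
  · rw [hx] at hy
    cases hy
    exact le_rfl
  · exact (h.row_mono hx hy hj).le

theorem col_le {z : Equiv.Perm ℤ} {N : ℕ} {F : Fil} (h : Pre z N F)
    {i i' j : ℕ} {x y : Letter} (hx : F (i, j) = some x) (hy : F (i', j) = some y)
    (hi : i ≤ i') : x.ceil ≤ y.ceil := by
  induction i', hi using Nat.le_induction generalizing y with
  | base =>
    rw [hx] at hy
    cases hy
    exact le_rfl
  | succ k hk ih =>
    obtain ⟨t, ht⟩ := h.cl hy (Nat.le_succ k) le_rfl (by have := h.vd hy; omega)
    exact (ih ht).trans (Letter.ceil_le (h.col ht hy).le)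

theorem inc_row {z : Equiv.Perm ℤ} {N : ℕ} {F : Fil} (h : Pre z N F)
    (i : ℕ) (P : ℕ × ℕ → Prop) (hP : ∀ p, P p → p.1 = i) : Inc (rd (RR N) P F) := by
  rw [rd, Inc, List.pairwise_filterMap]
  refine List.Pairwise.imp_of_mem ?_ (sel_pairwise (RR_pairwise N) P)
  rintro ⟨a1, a2⟩ ⟨b1, b2⟩ ha hb hab x hx y hy
  have h1 := hP _ (mem_sel.1 ha).2
  have h2 := hP _ (mem_sel.1 hb).2
  dsimp only at h1 h2 hab
  subst h1 h2
  exact h.row_mono hx hy (by omega)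

theorem col_lt_of_right {z : Equiv.Perm ℤ} {N : ℕ} {F : Fil} (h : Pre z N F)
    {r c : ℕ} {x y : Letter} (hx : F (r, c) = some x)
    (hy : F (r + 1, c) = some y)
    (hR : ∀ x' y', F (r, c + 1) = some x' → F (r + 1, c + 1) = some y' → x'.ceil < y'.ceil) :
    x.ceil < y.ceil := by
  rcases Letter.lt_def.1 (h.col hx hy) with h1 | ⟨hb, hpx, hpy⟩
  · exact h1
  exfalso
  have hright : ∀ d t, F (r + 1, d) = some t → c < d → y.ceil + 2 ≤ t.ceil := by
    intro d t ht hd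
    have := h.vd hy
    obtain ⟨y', hy'⟩ := h.cl ht le_rfl (Nat.succ_le_of_lt hd) (by omega)
    obtain ⟨x', hx'⟩ := h.cl hy' (Nat.le_succ r) le_rfl (by omega)
    have := hR x' y' hx' hy'
    have := h.row_lt hx hx'
    have := h.row_le hy' ht (by omega)
    omega
  set X := rd (RR N) (fun p => r + 1 + 1 ≤ p.1) F with hX
  set Pr := rd (RR N) (fun p => p.1 = r + 1 ∧ p.2 < c) F with hPr
  set Po := rd (RR N) (fun p => p.1 = r + 1 ∧ c < p.2) F with hPo
  set A := rd (RR N) (fun p => p.1 = r ∧ p.2 < c) F with hA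
  set B := rd (RR N) (fun p => p.1 = r ∧ c < p.2) F with hB
  set Z := rd (RR N) (fun p => p.1 < r) F with hZ
  have hline : rd (RR N) (fun p => p.1 = r) F = A ++ x :: B :=
    line_split hx (h.lt hx).1 (h.lt hx).2
  have hw := h.word
  rw [split_row N r, rows_split, line_split hy (h.lt hy).1 (h.lt hy).2, hline] at hw
  have hfar : ∀ t ∈ Po, Far t.ceil y.ceil := by
    intro t ht
    obtain ⟨⟨a, d⟩, -, ⟨ha, hd⟩, ht⟩ := mem_rd.1 ht
    dsimp only at ha hd
    subst ha
    have := hright _ _ ht hd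
    right; omega
  have h2 := (locCls_RinvPlus z).move_right (X ++ Pr) Po y (A ++ x :: B ++ Z) hfar
    (by simpa only [List.append_assoc, List.cons_append] using hw)
  have hI := h.inc_row r (fun p => p.1 = r) fun p hp => hp
  rw [hline] at hI
  obtain ⟨A', m, hAm, hm, hmp, -⟩ := uninsert_eq ((locCls_RinvPlus z).context (X ++ Pr ++ Po) Z)
    (o := y) hI hb.symm (by simpa using h2)
  have hmA : m ∈ A := by rw [hAm]; simp
  obtain ⟨⟨a, d⟩, -, ⟨ha, hd⟩, hmF⟩ := mem_rd.1 hmA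
  dsimp only at ha hd
  subst ha
  obtain ⟨m', hm'⟩ := h.cl hx le_rfl (Nat.sub_le c 1) (by have := h.vd hmF; omega)
  obtain rfl : d = c - 1 := by
    by_contra hne
    have := h.row_mono hmF hm' (by omega)
    have := h.row_mono hm' hx (by omega)
    omega
  rcases (h.vd hmF).eq_or_lt with hcr | hcr
  · have hX2 : ∀ t ∈ X ++ Po, y.ceil + 2 ≤ t.ceil := by
      intro t ht
      rcases List.mem_append.1 ht with ht | ht
      · obtain ⟨⟨b, e⟩, -, hb', ht⟩ := mem_rd.1 ht
        dsimp only at hb'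
        have := h.vd ht
        obtain ⟨s, hs⟩ := h.cl ht (show a + 1 ≤ b by omega) le_rfl (by omega)
        have := hright _ _ hs (by omega)
        have := h.col_le hs ht (by omega)
        omega
      · obtain ⟨⟨b, e⟩, -, ⟨hb', he⟩, ht⟩ := mem_rd.1 ht
        dsimp only at hb' he
        subst hb'
        exact hright _ _ ht he
    have hPr0 : Pr = [] := by
      refine rd_eq_nil fun q _ hq => ?_
      obtain ⟨q1, q2⟩ := q
      by_contra hne
      obtain ⟨t, ht⟩ := Option.ne_none_iff_exists'.1 hne
      have := h.vd ht
      dsimp only at hq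
      omega
    have hA0 : A = [m] := by
      rw [hA, ← rd_single (RR_nodup N) (mem_RR.2 (h.lt hmF)) hmF fun _ => Iff.rfl]
      refine rd_congr (fun _ _ _ _ => rfl) ?_ ?_
      · rintro ⟨q1, q2⟩ - hq hq'
        by_contra hne
        obtain ⟨t, ht⟩ := Option.ne_none_iff_exists'.1 hne
        have := h.vd ht
        simp only [Prod.mk.injEq] at hq hq'
        omega
      · rintro ⟨q1, q2⟩ - hq hq'
        simp only [Prod.mk.injEq] at hq hq'
        omega
    rw [hPr0, hA0] at h2
    have h3 := (locCls_RinvPlus z).move_left [] (X ++ Po) y (m :: x :: B ++ Z)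
      (fun t ht => Or.inr (by have := hX2 t ht; omega)) (by simpa using h2)
    have h4 := (locCls_RinvPlus z).move_left [y] (X ++ Po) m (x :: B ++ Z)
      (fun t ht => Or.inr (by have := hX2 t ht; omega)) (by simpa using h3)
    have h5 := (locCls_RinvPlus z).move_left [y, m] (X ++ Po) x (B ++ Z)
      (fun t ht => Or.inr (by have := hX2 t ht; omega)) (by simpa using h4)
    obtain ⟨xc, xp⟩ := x
    obtain ⟨yc, yp⟩ := y
    dsimp only at hb
    subst hb
    exact front_no_triple (b := m.ceil) (q := m.primed) h5 (Or.inl (by dsimp only at hm ⊢; omega))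
  · have := h.vd hx
    obtain ⟨t, ht⟩ := h.cl hy le_rfl (Nat.sub_le c 1) (by omega)
    have h6 := h.row_mono ht hy (by omega)
    rcases Letter.lt_def.1 (h.col hmF ht) with h7 | h7
    · omega
    · rw [hmp] at h7
      simp at h7

theorem col_lt {z : Equiv.Perm ℤ} {N : ℕ} {F : Fil} (h : Pre z N F)
    {r c : ℕ} {x y : Letter} (hx : F (r, c) = some x) (hy : F (r + 1, c) = some y) :
    x.ceil < y.ceil := by
  obtain ⟨k, hk⟩ : ∃ k, N ≤ c + k := ⟨N, by omega⟩
  induction k generalizing c x y with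
  | zero => exact absurd (h.lt hx).2 (by omega)
  | succ k ih => exact h.col_lt_of_right hx hy fun x' y' hx' hy' => ih hx' hy' (by omega)

theorem col_mono {z : Equiv.Perm ℤ} {N : ℕ} {F : Fil} (h : Pre z N F)
    {i i' j : ℕ} {x y : Letter} (hx : F (i, j) = some x) (hy : F (i', j) = some y)
    (hi : i < i') : x.ceil < y.ceil := by
  obtain ⟨t, ht⟩ := h.cl hy (Nat.succ_le_of_lt hi) le_rfl (by have := h.vd hy; omega)
  have := h.col_lt hx ht
  have := h.col_le ht hy (Nat.succ_le_of_lt hi)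
  omega

theorem toTab {z : Equiv.Perm ℤ} {N : ℕ} {F : Fil} (h : Pre z N F) : Tab N false F where
  vd := h.vd
  lt := h.lt
  cl := h.cl
  mono := by
    intro i j i' j' x y hx hy hi hj hs
    obtain ⟨t, ht⟩ := h.cl hy hi le_rfl (by have := h.vd hx; omega)
    rcases hs with hs | hs
    · exact (h.row_le hx ht hj).trans_lt (h.col_mono ht hy hs)
    · exact (h.row_mono hx ht hs).trans_le (h.col_le ht hy hi)
  diag := h.diag

end Pre

theorem IsShifted.closed {T : STab} (hS : IsShifted T) {i j i' j' : ℕ} {x : Letter}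
    (hx : ent T (i, j) = some x) (hi : i' ≤ i) (hj : j' ≤ j) (h : i' ≤ j') :
    ∃ y, ent T (i', j') = some y := by
  have hij : i ≤ j := by
    by_contra hlt
    rw [ent_apply, if_neg hlt] at hx
    cases hx
  have step : ∀ k, k ≤ i → (T.getD i []).length + (i - k) ≤ (T.getD k []).length := by
    intro k hk
    induction hk using Nat.decreasingInduction with
    | self => omega
    | of_succ k hk ih =>
      have hl := lt_length_of_ent hx
      have h1 := List.isChain_iff_getElem.1 hS.1 k (by simp [shapeOf]; omega)
      simp only [shapeOf, List.getElem_map] at h1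
      rw [List.getD_eq_getElem _ _ (show k + 1 < T.length by omega)] at ih
      rw [List.getD_eq_getElem _ _ (show k < T.length by omega)]
      omega
  have h1 : j - i < (T.getD i []).length := by
    have := ent_getElem? hx hij
    exact (List.getElem?_eq_some_iff.1 this).1
  have h2 := step i' hi
  rw [ent_apply, if_pos h]
  exact ⟨_, List.getElem?_eq_getElem (by omega)⟩

theorem pt_iff {z : Equiv.Perm ℤ} {T : STab} : PT z T ↔
    IsShifted T ∧ IsIncreasing T ∧ NoDiagPrimes T ∧ rowWord T ∈ RinvPlus z := by
  constructor
  · rintro ⟨hS, ⟨N, hT⟩, hw⟩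
    exact ⟨hS, ⟨fun r c x y hx hy => Letter.lt_of_ceil (hT.mono hx hy le_rfl (Nat.le_succ c) (by omega)),
      fun r c x y hx hy => Letter.lt_of_ceil (hT.mono hx hy (Nat.le_succ r) le_rfl (by omega))⟩,
      fun r x hx => hT.diag hx, hw⟩
  · rintro ⟨hS, hI, hD, hw⟩
    have hp : Pre z (side T) (ent T) := 
      { vd := fun {i j x} hx => by
          rw [ent_apply] at hx
          by_contra hlt
          rw [if_neg hlt] at hx
          cases hx
        lt := fun hx => (room_side T).lt _ _ _ hx
        cl := hS.closed
        row := fun hx hy => hI.1 _ _ _ _ hx hy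
        col := fun hx hy => hI.2 _ _ _ _ hx hy
        diag := fun hx => hD _ _ hx
        word := by rwa [rowWord_eq hS (room_side T).lt] at hw }
    exact ⟨hS, ⟨_, hp.toTab⟩, hw⟩

section Steps

variable {N : ℕ} {b : Bool} {i : ℕ} {G G' : Fil} {w o : Letter}

theorem Bump.lt (h : Bump G i w G' o) : w.ceil < o.ceil := by
  cases h with
  | bump j m hj hm hlo hw => exact hw
  | eq j m M hj hm hM hw hw' hp => simp [Letter.succL]

theorem Bump.mem (h : Bump G i w G' o) : ∃ j x, G (i, j) = some x ∧ x.ceil = o.ceil := by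
  cases h with
  | bump j m hj hm hlo hw => exact ⟨j, _, hm, rfl⟩
  | eq j m M hj hm hM hw hw' hp => exact ⟨j + 1, _, hM, hw'⟩

theorem Bump.put (h : Bump G i w G' o) : ∃ j x, G' (i, j) = some x ∧ x.ceil = w.ceil := by
  cases h with
  | bump j m hj hm hlo hw => exact ⟨j, w, upd_self _ _ _ _, rfl⟩
  | eq j m M hj hm hM hw hw' hp => exact ⟨j, ⟨m.ceil, false⟩, by rw [upd_ne (by omega), upd_self], hw⟩

theorem Bump.old (h : Bump G i w G' o) {a e : ℕ} {y : Letter} (hy : G (a, e) = some y) :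
    ∃ y', G' (a, e) = some y' ∧ (y'.ceil = y.ceil ∨ a = i ∧ y'.ceil = w.ceil ∧ w.ceil ≤ y.ceil) := by
  cases h with
  | bump j m hj hm hlo hw =>
    rw [upd_apply]
    split_ifs with hp
    · rw [hp.1, hp.2, hm] at hy
      cases hy
      exact ⟨w, rfl, Or.inr ⟨hp.1, rfl, hw.le⟩⟩
    · exact ⟨y, hy, Or.inl rfl⟩
  | eq j m M hj hm hM hw hw' hp =>
    rw [upd_apply, upd_apply]
    split_ifs with h1 h2
    · rw [h1.1, h1.2, hM] at hy
      cases hy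
      exact ⟨_, rfl, Or.inl rfl⟩
    · rw [h2.1, h2.2, hm] at hy
      cases hy
      exact ⟨_, rfl, Or.inl rfl⟩
    · exact ⟨y, hy, Or.inl rfl⟩

theorem Bump.min (h : Bump G i w G' o) (hT : Tab N b G) {e : ℕ} {x : Letter}
    (hx : G (i, e) = some x) (hw : w.ceil < x.ceil) : o.ceil ≤ x.ceil := by
  cases h with
  | bump j m hj hm hlo hw =>
    by_contra hlt
    rcases lt_or_ge e j with h1 | h1
    · have := hlo _ _ h1 hx
      omega
    · exact hlt (hT.mono' hm hx le_rfl h1)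
  | eq j m M hj hm hM hw hw' hp =>
    simp only [Letter.succL]
    omega

theorem Bump.min' (h : Bump G i w G' o) (hT : Tab N b G) {e : ℕ} {x : Letter}
    (hx : G' (i, e) = some x) (hw : w.ceil < x.ceil) : o.ceil < x.ceil ∨ o.ceil = w.ceil + 1 := by
  cases h with
  | bump j m hj hm hlo hw =>
    rw [upd_apply] at hx
    split_ifs at hx with hp
    · cases hx
      omega
    · rcases lt_or_ge e j with h1 | h1
      · have := hlo _ _ h1 hx
        omega
      · exact Or.inl (hT.mono hm hx le_rfl h1 (by omega))
  | eq j m M hj hm hM hw hw' hp => exact Or.inr rfl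

theorem Bump.diag_lt (h : Bump G i w G' o) (hT : Tab N false G) :
    ∃ x, G (i, i) = some x ∧ x.ceil < w.ceil := by
  cases h with
  | bump j m hj hm hlo hw =>
    have hij : i < j := lt_of_le_of_ne (hT.vd hm) hj
    obtain ⟨x, hx⟩ := hT.cl hm le_rfl hij.le (show i ≤ i from le_rfl)
    exact ⟨x, hx, hlo _ _ hij hx⟩
  | eq j m M hj hm hM hw hw' hp =>
    have hij : i < j := lt_of_le_of_ne (hT.vd hm) hj
    obtain ⟨x, hx⟩ := hT.cl hm le_rfl hij.le (show i ≤ i from le_rfl)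
    exact ⟨x, hx, hw ▸ hT.mono hx hm le_rfl hij.le (Or.inr hij)⟩

theorem Bump.le_diag (h : Bump G i w G' o) (hT : Tab N true G) {y : Letter}
    (hy : G (i, i) = some y) : o.ceil < y.ceil ∨
      y.ceil = w.ceil + 1 ∧ o.ceil = y.ceil ∧ ∃ k x, i = k + 1 ∧ G (i, k) = some x ∧ x.ceil = w.ceil := by
  cases h with
  | bump j m hj hm hlo hw =>
    have hij : j < i := lt_of_le_of_ne (hT.vd hm) hj.symm
    exact Or.inl (hT.mono hm hy le_rfl hij.le (Or.inr hij))
  | eq j m M hj hm hM hw hw' hp =>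
    have hij : j < i := lt_of_le_of_ne (hT.vd hm) hj.symm
    by_cases he : i = j + 1
    · rw [← he, hy] at hM
      cases hM
      exact Or.inr ⟨hw', hw'.symm, j, m, he, hm, hw⟩
    · refine Or.inl ?_
      have := hT.mono hM hy le_rfl (by omega) (by omega)
      simp only [Letter.succL]
      omega

theorem DStep.spec (h : DStep G i w G' o) : w.ceil < o.ceil ∧ ∃ m, G (i, i) = some m ∧
    (w.ceil < m.ceil ∧ o.ceil = m.ceil ∨ m.ceil = w.ceil ∧ o.ceil = w.ceil + 1) := by
  cases h with
  | bump m hm hw => exact ⟨hw, m, hm, Or.inl ⟨hw, rfl⟩⟩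
  | eq m M hm hw hM hw' hp hp' => exact ⟨by simp [Letter.succL], m, hm, Or.inr ⟨hw, rfl⟩⟩

theorem DStep.put (h : DStep G i w G' o) : ∃ x, G' (i, i) = some x ∧ x.ceil = w.ceil := by
  cases h with
  | bump m hm hw => exact ⟨_, upd_self _ _ _ _, rfl⟩
  | eq m M hm hw hM hw' hp hp' => exact ⟨m, hm, hw⟩

theorem DStep.old (h : DStep G i w G' o) {a e : ℕ} {y : Letter} (hy : G (a, e) = some y) :
    ∃ y', G' (a, e) = some y' ∧
      (y'.ceil = y.ceil ∨ a = i ∧ e = i ∧ y'.ceil = w.ceil ∧ w.ceil ≤ y.ceil) := by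
  cases h with
  | bump m hm hw =>
    rw [upd_apply]
    split_ifs with hp
    · rw [hp.1, hp.2, hm] at hy
      cases hy
      exact ⟨_, rfl, Or.inr ⟨hp.1, hp.2, rfl, hw.le⟩⟩
    · exact ⟨y, hy, Or.inl rfl⟩
  | eq m M hm hw hM hw' hp hp' => exact ⟨y, hy, Or.inl rfl⟩

end Steps

theorem Stop.spec {b : Bool} {i : ℕ} {G F : Fil} {w : Letter} {c : ℕ × ℕ} {f : Bool}
    (h : Stop b i G w F c f) : ∃ j w', w'.ceil = w.ceil ∧ ori b F = upd G i j w' ∧ G (i, j) = none ∧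
      (∀ j' x, G (i, j') = some x → x.ceil < w.ceil) ∧ c = (if b then (j, i) else (i, j)) ∧
      (b = true → f = true ∧ j < i) ∧ (b = false → i ≤ j) := by
  cases h with
  | @row i j G w hij hG hlo hpr => exact ⟨j, w, rfl, rfl, hG, hlo, rfl, by simp, fun _ => hij.le⟩
  | @col i j G w hij hG hlo hpr => exact ⟨j, w, rfl, rfl, hG, hlo, rfl, by simp [hij], by simp⟩
  | @diag i G w hG =>
    refine ⟨i, ⟨w.ceil, false⟩, rfl, rfl, hG _, ?_, rfl, by simp, by simp⟩
    intro j' x hx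
    rw [hG] at hx
    cases hx

section Future

variable {z : Equiv.Perm ℤ} {N : ℕ} {b : Bool} {i : ℕ} {G F : Fil} {w : Letter} {c : ℕ × ℕ} {f : Bool}

theorem Run.position (h : Run b i G w F c f) :
    c.1 ≤ c.2 ∧ (b = true → f = true ∧ i ≤ c.2) ∧ (f = false → i ≤ c.1) := by
  induction h with
  | halt hs =>
    obtain ⟨j, w', -, -, -, -, rfl, h1, h2⟩ := hs.spec
    split_ifs with hb
    · exact ⟨(h1 hb).2.le, fun _ => ⟨(h1 hb).1, le_rfl⟩, fun hf => by simp [(h1 hb).1] at hf⟩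
    · exact ⟨h2 (by simpa using hb), fun hb' => absurd hb' hb, fun _ => le_rfl⟩
  | bump hB _ ih => exact ⟨ih.1, fun hb => ⟨(ih.2.1 hb).1, by have := (ih.2.1 hb).2; omega⟩,
      fun hf => by have := ih.2.2 hf; omega⟩
  | diag hD _ ih => exact ⟨ih.1, by simp, fun hf => by simp [(ih.2.1 rfl).1] at hf⟩

theorem SameDom.symm {G G' : Fil} (h : SameDom G G') : SameDom G' G := fun p => (h p).symm

/-- How the rest of an insertion changes the tableau. -/
theorem Run.old (h : Run b i G w F c f) {a e : ℕ} {y : Letter} (hy : G (a, e) = some y) :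
    ∃ x, ori b F (a, e) = some x ∧
      (x.ceil = y.ceil ∨ w.ceil ≤ x.ceil ∧ (a < i → w.ceil < x.ceil) ∧ x.ceil ≤ y.ceil) := by
  induction h generalizing a e y with
  | halt hs =>
    obtain ⟨j, w', hw, hF, hj, -⟩ := hs.spec
    rw [hF, upd_apply]
    split_ifs with hp
    · rw [← hp.1, ← hp.2, hy] at hj
      cases hj
    · exact ⟨y, hy, Or.inl rfl⟩
  | bump hB _ ih =>
    have := hB.lt
    obtain ⟨y', hy', h1⟩ := hB.old hy
    obtain ⟨x, hx, h2⟩ := ih hy'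
    exact ⟨x, hx, by omega⟩
  | diag hD _ ih =>
    have := hD.spec.1
    obtain ⟨y', hy', h1⟩ := hD.old hy
    obtain ⟨x, hx, h2⟩ := ih (a := e) (e := a) hy'
    exact ⟨x, hx, by omega⟩

theorem Run.new (h : Run b i G w F c f) {a e : ℕ} {x : Letter} (hx : ori b F (a, e) = some x)
    (hG : G (a, e) = none) : w.ceil ≤ x.ceil ∧ (a < i → w.ceil < x.ceil) := by
  induction h generalizing a e with
  | halt hs =>
    obtain ⟨j, w', hw, hF, hj, -⟩ := hs.spec
    rw [hF, upd_apply] at hx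
    split_ifs at hx with hp
    · cases hx
      omega
    · rw [hG] at hx
      cases hx
  | bump hB _ ih =>
    have := hB.lt
    have := ih hx ((hB.dom _).1 hG)
    omega
  | diag hD _ ih =>
    have := hD.spec.1
    have := ih (a := e) (e := a) hx ((hD.dom _).1 hG)
    omega

end Future

/-- `H` is obtained from `F` during an insertion that has reached the letter `w`. -/
structure After (b : Bool) (F H : Fil) (w : Letter) : Prop where
  dom : SameDom H (ori b F)
  le : ∀ a e x y, ori b F (a, e) = some x → H (a, e) = some y →
    y.ceil = x.ceil ∨ x.ceil ≤ w.ceil ∧ y.ceil < w.ceil ∧ y.ceil ≤ x.ceil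

namespace After

variable {b : Bool} {F H H' : Fil} {w o : Letter} {i : ℕ}

theorem refl (F : Fil) (w : Letter) : After false F F w :=
  ⟨SameDom.refl _, fun a e x y hx hy => by
    change F (a, e) = some x at hx
    rw [hx] at hy
    cases hy
    exact Or.inl rfl⟩

theorem ex (h : After b F H w) {p : ℕ × ℕ} {x : Letter} (hx : ori b F p = some x) :
    ∃ y, H p = some y := by
  apply Option.ne_none_iff_exists'.1
  rw [ne_eq, h.dom, hx]
  simp

theorem ex' (h : After b F H w) {p : ℕ × ℕ} {y : Letter} (hy : H p = some y) :
    ∃ x, ori b F p = some x := by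
  apply Option.ne_none_iff_exists'.1
  rw [ne_eq, ← h.dom, hy]
  simp

theorem bump (h : After b F H w) (hB : Bump H i w H' o) : After b F H' o := by
  refine ⟨hB.dom.symm.trans h.dom, fun a e x y hx hy => ?_⟩
  have := hB.lt
  obtain ⟨y₀, hy₀⟩ := h.ex hx
  have h1 := h.le _ _ _ _ hx hy₀
  obtain ⟨y', hy', h2⟩ := hB.old hy₀
  rw [hy] at hy'
  cases hy'
  by_cases h3 : y.ceil = y₀.ceil
  · omega
  · have h4 : a = i := by omega
    subst h4
    have h5 : y₀.ceil ≤ o.ceil := by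
      cases hB with
      | bump j m hj hm hlo hw =>
        rw [upd_apply] at hy
        split_ifs at hy with hp
        · rw [hp.2, hm] at hy₀
          cases hy₀
          exact le_rfl
        · rw [hy] at hy₀
          cases hy₀
          exact absurd rfl h3
      | eq j m M hj hm hM hw hw' hp =>
        exfalso
        rw [upd_apply, upd_apply] at hy
        split_ifs at hy with hp hp
        · rw [hp.2, hM] at hy₀
          cases hy₀
          cases hy
          exact h3 rfl
        · rw [hp.2, hm] at hy₀
          cases hy₀
          cases hy
          exact h3 rfl
        · rw [hy] at hy₀
          cases hy₀
          exact h3 rfl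
    omega

theorem dstep (h : After false F H w) (hD : DStep H i w H' o) : After true F (_root_.tr H') o := by
  refine ⟨?_, ?_⟩
  · exact (hD.dom.symm.trans h.dom).tr
  · intro a e x y hx hy
    change F (e, a) = some x at hx
    change H' (e, a) = some y at hy
    obtain ⟨hlt, m, hm, h0⟩ := hD.spec
    obtain ⟨y₀, hy₀⟩ := h.ex hx
    have h1 := h.le _ _ _ _ hx hy₀
    obtain ⟨y', hy', h2⟩ := hD.old hy₀
    rw [hy] at hy'
    cases hy'
    by_cases h3 : y.ceil = y₀.ceil
    · omega
    · have h4 : e = i := by omega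
      have h5 : a = i := by omega
      rw [h4, h5, hm] at hy₀
      cases hy₀
      omega

end After

section Final

variable {N : ℕ} {b : Bool} {i : ℕ} {G G' F : Fil} {w o : Letter} {c : ℕ × ℕ} {f : Bool}

theorem Bump.diag_keep (h : Bump G i w G' o) {y : Letter} (hy : G (i, i) = some y) :
    ∃ y', G' (i, i) = some y' ∧ y'.ceil = y.ceil := by
  cases h with
  | bump j m hj hm hlo hw => exact ⟨y, by rw [upd_ne (Or.inr hj), hy], rfl⟩
  | eq j m M hj hm hM hw hw' hp =>
    rw [upd_apply, upd_ne (Or.inr hj)]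
    split_ifs with h1
    · rw [← h1.2, hy] at hM
      cases hM
      exact ⟨_, rfl, rfl⟩
    · exact ⟨y, hy, rfl⟩

theorem Bump.final (h : Bump G i w G' o) (hR : Run b (i + 1) G' o F c f) :
    ∃ j x, ori b F (i, j) = some x ∧ x.ceil = w.ceil := by
  obtain ⟨j, y, hy, hw⟩ := h.put
  have := h.lt
  obtain ⟨x, hx, h1⟩ := hR.old hy
  exact ⟨j, x, hx, by omega⟩

theorem DStep.final (h : DStep G i w G' o) (hR : Run true (i + 1) (tr G') o F c f) :
    ∃ x, F (i, i) = some x ∧ x.ceil = w.ceil := by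
  obtain ⟨y, hy, hw⟩ := h.put
  have := h.spec.1
  obtain ⟨x, hx, h1⟩ := hR.old (a := i) (e := i) hy
  exact ⟨x, hx, by omega⟩

theorem Stop.final (h : Stop b i G w F c f) : ∃ j x, ori b F (i, j) = some x ∧ x.ceil = w.ceil ∧
    G (i, j) = none ∧ c = (if b then (j, i) else (i, j)) ∧ (b = true → f = true ∧ j < i) ∧
    (b = false → i ≤ j) ∧ ∀ j' x, ori b F (i, j') = some x → x.ceil ≤ w.ceil := by
  obtain ⟨j, w', hw, hF, hG, hlo, hc, h1, h2⟩ := h.spec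
  refine ⟨j, w', by rw [hF, upd_self], hw, hG, hc, h1, h2, fun j' x hx => ?_⟩
  rw [hF, upd_apply] at hx
  split_ifs at hx
  · cases hx
    exact hw.le
  · exact (hlo _ _ hx).le

theorem After.big {H : Fil} (hA : After b F H w) {p : ℕ × ℕ} {x : Letter} (hx : ori b F p = some x)
    (hw : w.ceil < x.ceil) : ∃ y, H p = some y ∧ y.ceil = x.ceil := by
  obtain ⟨y, hy⟩ := hA.ex hx
  have := hA.le p.1 p.2 _ _ hx hy
  exact ⟨y, hy, by omega⟩

end Final

section Descents

variable {z₁ z₂ : Equiv.Perm ℤ} {N₁ N₂ : ℕ} {b : Bool} {i : ℕ} {G F H F₂ G' H' : Fil} {w₁ w₂ o₁ o₂ : Letter}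
  {c₁ c₂ : ℕ × ℕ} {f₁ f₂ : Bool}

theorem Bump.lt_of_lt (hT : Tab N₁ b G) (hB : Bump G i w₁ G' o₁) (hR : Run b (i + 1) G' o₁ F c₁ f₁)
    (hA : After b F H w₂) (hB' : Bump H i w₂ H' o₂) (hw : w₁.ceil < w₂.ceil) : o₁.ceil < o₂.ceil := by
  obtain ⟨j, x, hx, hxo⟩ := hB'.mem
  have h1 := hB'.lt
  obtain ⟨y, hy⟩ := hA.ex' hx
  have h2 := hA.le _ _ _ _ hy hx
  rcases hG : G' (i, j) with _ | y'
  · have := (hR.new hy hG).2 (Nat.lt_succ_self i)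
    omega
  · obtain ⟨y'', hy'', h3⟩ := hR.old hG
    rw [hy] at hy''
    cases hy''
    by_cases h4 : o₁.ceil < y.ceil
    · omega
    · have := hB.min' hT hG (by omega)
      omega

theorem Bump.gt_of_gt (hB : Bump G i w₁ G' o₁) (hR : Run b (i + 1) G' o₁ F c₁ f₁) (hT : Tab N₂ b H)
    (hA : After b F H w₂) (hB' : Bump H i w₂ H' o₂) (hw : w₂.ceil < w₁.ceil) : o₂.ceil < o₁.ceil := by
  obtain ⟨j, x, hx, hxw⟩ := hB.final hR
  obtain ⟨y, hy, hyx⟩ := hA.big hx (by omega)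
  have := hB'.min hT hy (by omega)
  have := hB.lt
  omega

/-- The second of two successive insertions ends further right or above the first. -/
def Ascends (c₁ : ℕ × ℕ) (f₁ : Bool) (c₂ : ℕ × ℕ) (f₂ : Bool) : Prop :=
  (f₁ = false → f₂ = false ∧ c₁.2 < c₂.2) ∧ (f₁ = true → f₂ = false ∨ c₁.1 < c₂.1)

/-- The condition opposite to `Ascends`. -/
def Descends (c₁ : ℕ × ℕ) (f₁ : Bool) (c₂ : ℕ × ℕ) (f₂ : Bool) : Prop :=
  (f₁ = false → f₂ = true ∨ c₁.1 < c₂.1) ∧ (f₁ = true → f₂ = true ∧ c₁.2 < c₂.2)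

theorem Run.ascends_col (h : Run b i G w₁ F c₁ f₁) (hb : b = true) (hg : Good z₁ N₁ b i G w₁)
    (hg' : Good z₂ N₂ b i H w₂) (hA : After b F H w₂) (h' : Run b i H w₂ F₂ c₂ f₂)
    (hs : c₁.1 < c₂.1 ∨ c₁.2 < c₂.2) (hw : w₁.ceil < w₂.ceil) : c₁.1 < c₂.1 := by
  induction h generalizing H w₂ with
  | halt hS =>
    subst hb
    obtain ⟨j, x, hx, hxw, -, rfl, -, -, hle⟩ := hS.final
    cases h' with
    | halt hS' =>
      obtain ⟨j', -, -, -, -, rfl, -⟩ := hS'.final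
      simpa using hs
    | bump hB' h' =>
      obtain ⟨j', x', hx', hxo⟩ := hB'.mem
      have := hB'.lt
      obtain ⟨y, hy⟩ := hA.ex' hx'
      have := hA.le _ _ _ _ hy hx'
      have := hle _ _ hy
      omega
  | bump hB h ih =>
    subst hb
    cases h' with
    | halt hS' =>
      obtain ⟨j', -, -, -, -, rfl, -⟩ := hS'.final
      have := (h.position.2.1 rfl).2
      simp only [if_true] at hs ⊢
      omega
    | bump hB' h' =>
      exact ih rfl (hg.bump hB) (hg'.bump hB') (hA.bump hB') h' hs
        (hB.lt_of_lt hg.tab h hA hB' hw)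
  | diag => cases hb

theorem Run.ascends_cross (h : Run b i G w₁ F c₁ f₁) (hb : b = true) (hg : Good z₁ N₁ b i G w₁)
    (hg' : Good z₂ N₂ false i H w₂) (hA : After false F H w₂) (h' : Run false i H w₂ F₂ c₂ f₂)
    (hs : c₁.1 < c₂.1 ∨ c₁.2 < c₂.2)
    (hw : ∀ k x, i = k + 1 → G (i, k) = some x → x.ceil = w₁.ceil → w₁.ceil < w₂.ceil) :
    f₂ = false ∨ c₁.1 < c₂.1 := by
  induction h generalizing H w₂ with
  | @halt b i G w₁ F c₁ f₁ hS =>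
    subst hb
    obtain ⟨j, w', -, hF, hG, -, rfl, h1, -⟩ := hS.spec
    have hji := (h1 rfl).2
    have hnone : ∀ y, H (i, i) ≠ some y := by
      intro y hy
      obtain ⟨x, hx⟩ := hA.ex' hy
      have hx' : ori true F (i, i) = some x := hx
      rw [hF, upd_ne (by omega)] at hx'
      obtain ⟨y', hy'⟩ := hg.tab.cl hx' le_rfl hji.le (show j ≤ i by omega)
      rw [hG] at hy'
      cases hy'
    cases h' with
    | halt hS' =>
      obtain ⟨j', -, -, -, -, rfl, -⟩ := hS'.final
      exact Or.inr (by simpa using hji)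
    | bump hB' h' =>
      obtain ⟨y, hy, -⟩ := hB'.diag_lt hg'.tab
      exact absurd hy (hnone y)
    | diag hD' h' =>
      obtain ⟨-, y, hy, -⟩ := hD'.spec
      exact absurd hy (hnone y)
  | @bump b i G w₁ G' o₁ F c₁ f₁ hB h ih =>
    subst hb
    have hlt := hB.lt
    have key : ∀ x, F (i, i) = some x → o₁.ceil < x.ceil ∨ x.ceil = o₁.ceil ∧ o₁.ceil = w₁.ceil + 1 ∧
        ∃ k x, i = k + 1 ∧ G (i, k) = some x ∧ x.ceil = w₁.ceil := by
      intro x hx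
      rcases hG' : G' (i, i) with _ | y'
      · exact Or.inl ((h.new (a := i) (e := i) hx hG').2 (Nat.lt_succ_self i))
      · rcases hG : G (i, i) with _ | y
        · rw [(hB.dom _).1 hG] at hG'
          cases hG'
        · obtain ⟨y'', hy'', h1⟩ := hB.diag_keep hG
          rw [hG'] at hy''
          cases hy''
          obtain ⟨x', hx', h2⟩ := h.old hG'
          change F (i, i) = some x' at hx'
          rw [hx] at hx'
          cases hx'
          by_cases h3 : o₁.ceil < x.ceil
          · exact Or.inl h3
          · rcases hB.le_diag hg.tab hG with h4 | ⟨h4, h5, h6⟩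
            · omega
            · exact Or.inr ⟨by omega, by omega, h6⟩
    cases h' with
    | halt hS' =>
      have := (h.position.2.1 rfl).2
      cases hS' with
      | row => exact Or.inl rfl
      | diag =>
        simp only at hs ⊢
        omega
    | bump hB' h' =>
      obtain ⟨y, hy, hyw⟩ := hB'.diag_lt hg'.tab
      obtain ⟨x, hx⟩ := hA.ex' hy
      have h1 := hA.le _ _ _ _ hx hy
      have h2 := key x hx
      have h3 := hB'.lt
      exact ih rfl (hg.bump hB) (hg'.bump hB') (hA.bump hB') h' hs fun _ _ _ _ _ => by omega
    | diag hD' h' =>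
      refine Or.inr (h.ascends_col rfl (hg.bump hB) (hg'.dstep hD') (hA.dstep hD') h' hs ?_)
      obtain ⟨h1, m, hm, h2⟩ := hD'.spec
      obtain ⟨x, hx⟩ := hA.ex' hm
      have h3 := hA.le _ _ _ _ hx hm
      rcases key x hx with h4 | ⟨h4, h5, k, x', hk, hx', hxw⟩
      · omega
      · have := hw k x' hk hx' hxw
        omega
  | diag => cases hb

theorem Run.ascends_row (h : Run b i G w₁ F c₁ f₁) (hb : b = false) (hg : Good z₁ N₁ b i G w₁)
    (hg' : Good z₂ N₂ b i H w₂) (hA : After b F H w₂) (h' : Run b i H w₂ F₂ c₂ f₂)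
    (hs : c₁.1 < c₂.1 ∨ c₁.2 < c₂.2) (hw : w₁.ceil < w₂.ceil) : Ascends c₁ f₁ c₂ f₂ := by
  induction h generalizing H w₂ with
  | @halt b i G w₁ F c₁ f₁ hS =>
    subst hb
    obtain ⟨j, x, hx, hxw, -, rfl, -, -, hle⟩ := hS.final
    have hlt : ∀ j y, H (i, j) = some y → y.ceil < w₂.ceil := by
      intro j y hy
      obtain ⟨x, hx⟩ := hA.ex' hy
      have := hA.le _ _ _ _ hx hy
      have := hle _ _ hx
      omega
    cases h' with
    | halt hS' =>
      cases hS' with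
      | row =>
        simp only [Bool.false_eq_true, if_false] at hs
        refine ⟨fun _ => ⟨rfl, ?_⟩, fun _ => Or.inl rfl⟩
        simp only [Bool.false_eq_true, if_false]
        omega
      | diag hH =>
        obtain ⟨y, hy⟩ := hA.ex hx
        rw [hH] at hy
        cases hy
    | bump hB' h' =>
      obtain ⟨j', x', hx', hxo⟩ := hB'.mem
      have := hB'.lt
      have := hlt _ _ hx'
      omega
    | diag hD' h' =>
      obtain ⟨h1, m, hm, h2⟩ := hD'.spec
      have := hlt _ _ hm
      omega
  | @bump b i G w₁ G' o₁ F c₁ f₁ hB h ih =>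
    subst hb
    have hlt := hB.lt
    obtain ⟨y, hy, hyw⟩ := hB.diag_lt hg.tab
    obtain ⟨y', hy', hyy⟩ := hB.diag_keep hy
    obtain ⟨x, hx, hxy⟩ := h.old hy'
    obtain ⟨v, hv⟩ := hA.ex hx
    have hvx := hA.le _ _ _ _ hx hv
    cases h' with
    | halt hS' =>
      cases hS' with
      | row =>
        have := h.position.2.2
        refine ⟨fun hf => ⟨rfl, ?_⟩, fun _ => Or.inl rfl⟩
        have := this hf
        simp only at hs ⊢
        omega
      | diag hH =>
        rw [hH] at hv
        cases hv
    | bump hB' h' =>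
      exact ih rfl (hg.bump hB) (hg'.bump hB') (hA.bump hB') h' hs
        (hB.lt_of_lt hg.tab h hA hB' hw)
    | diag hD' h' =>
      obtain ⟨h1, m, hm, h2⟩ := hD'.spec
      rw [hv] at hm
      cases hm
      omega
  | @diag i G w₁ G' o₁ F c₁ f₁ hD h ih =>
    obtain ⟨x, hx, hxw⟩ := hD.final h
    obtain ⟨v, hv⟩ := hA.ex (p := (i, i)) hx
    have hvx := hA.le _ _ _ _ hx hv
    have hf := (h.position.2.1 rfl).1
    refine ⟨fun hf' => by simp [hf] at hf', fun _ => ?_⟩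
    cases h' with
    | halt hS' =>
      cases hS' with
      | row => exact Or.inl rfl
      | diag hH =>
        rw [hH] at hv
        cases hv
    | bump hB' h' =>
      refine h.ascends_cross rfl (hg.dstep hD) (hg'.bump hB') (hA.bump hB') h' hs ?_
      intro k y hk hy hyo
      obtain rfl : i = k := by omega
      have := hB'.lt
      change G' (i, i + 1) = some y at hy
      cases hD with
      | bump m hm hwm =>
        rw [upd_ne (by omega)] at hy
        have := hg.tab.mono hm hy le_rfl (Nat.le_succ i) (Or.inr (Nat.lt_succ_self i))
        simp only at hyo
        omega
      | eq m M hm hw hM hw' hp hp' =>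
        simp only [Letter.succL]
        omega
    | diag hD' h' =>
      obtain ⟨h1, m, hm, h2⟩ := hD'.spec
      rw [hv] at hm
      cases hm
      omega

theorem Run.descends_col (h : Run b i G w₁ F c₁ f₁) (hb : b = true)
    (hg' : Good z₂ N₂ b i H w₂) (hA : After b F H w₂) (h' : Run b i H w₂ F₂ c₂ f₂)
    (hw : w₂.ceil < w₁.ceil) : f₂ = true ∧ c₁.2 < c₂.2 := by
  have hf := (h'.position.2.1 hb).1
  refine ⟨hf, ?_⟩
  induction h generalizing H w₂ with
  | halt hS =>
    subst hb
    obtain ⟨j, x, hx, hxw, -, rfl, -⟩ := hS.final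
    obtain ⟨y, hy, hyx⟩ := hA.big hx (by omega)
    cases h' with
    | halt hS' =>
      obtain ⟨-, -, -, -, -, hlo, -⟩ := hS'.spec
      have := hlo _ _ hy
      omega
    | bump hB' h' =>
      have := (h'.position.2.1 rfl).2
      simp only [if_true]
      omega
  | bump hB h ih =>
    subst hb
    obtain ⟨j, x, hx, hxw⟩ := hB.final h
    obtain ⟨y, hy, hyx⟩ := hA.big hx (by omega)
    cases h' with
    | halt hS' =>
      obtain ⟨-, -, -, -, -, hlo, -⟩ := hS'.spec
      have := hlo _ _ hy
      omega
    | bump hB' h' =>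
      exact ih rfl (hg'.bump hB') (hA.bump hB') h' (hB.gt_of_gt h hg'.tab hA hB' hw)
  | diag => cases hb

theorem Stop.not_diag (hg' : Good z₂ N₂ true i H w₂) (hS : Stop true i H w₂ F₂ c₂ f₂) {y : Letter}
    (hy : H (i, i) = some y) : False := by
  obtain ⟨j, -, -, -, hj, -, -, h1, -⟩ := hS.spec
  have hji := (h1 rfl).2
  obtain ⟨y', hy'⟩ := hg'.tab.cl hy le_rfl hji.le (show j ≤ i by omega)
  rw [hj] at hy'
  cases hy'

theorem Run.descends_cross (h : Run b i G w₁ F c₁ f₁) (hb : b = false) (hg : Good z₁ N₁ b i G w₁)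
    (hg' : Good z₂ N₂ true i H w₂) (hA : After true F H w₂) (h' : Run true i H w₂ F₂ c₂ f₂) :
    Descends c₁ f₁ c₂ f₂ := by
  have hf := (h'.position.2.1 rfl).1
  refine ⟨fun _ => Or.inl hf, fun hf₁ => ⟨hf, ?_⟩⟩
  induction h generalizing H w₂ with
  | @halt b i G w₁ F c₁ f₁ hS =>
    cases hS with
    | row => cases hf₁
    | col => cases hb
    | diag =>
      obtain ⟨y, hy⟩ := hA.ex (p := (i, i)) (upd_self _ _ _ _)
      cases h' with
      | halt hS' => exact (hS'.not_diag hg' hy).elim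
      | bump hB' h' => exact (h'.position.2.1 rfl).2
  | @bump b i G w₁ G' o₁ F c₁ f₁ hB h ih =>
    subst hb
    obtain ⟨y, hy, -⟩ := hB.diag_lt hg.tab
    obtain ⟨y', hy', -⟩ := hB.old hy
    obtain ⟨x, hx, -⟩ := h.old hy'
    obtain ⟨v, hv⟩ := hA.ex (p := (i, i)) hx
    cases h' with
    | halt hS' => exact (hS'.not_diag hg' hv).elim
    | bump hB' h' => exact ih rfl (hg.bump hB) (hg'.bump hB') (hA.bump hB') h' hf₁
  | @diag i G w₁ G' o₁ F c₁ f₁ hD h ih =>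
    obtain ⟨x, hx, hxw⟩ := hD.final h
    obtain ⟨v, hv⟩ := hA.ex (p := (i, i)) hx
    have hvx := hA.le i i _ _ hx hv
    cases h' with
    | halt hS' => exact (hS'.not_diag hg' hv).elim
    | bump hB' h' =>
      refine (h.descends_col rfl (hg'.bump hB') (hA.bump hB') h' ?_).2
      have := hD.spec.1
      have := hB'.le_diag hg'.tab hv
      omega

theorem Run.descends_row (h : Run b i G w₁ F c₁ f₁) (hb : b = false) (hg : Good z₁ N₁ b i G w₁)
    (hg' : Good z₂ N₂ b i H w₂) (hA : After b F H w₂) (h' : Run b i H w₂ F₂ c₂ f₂)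
    (hw : w₂.ceil < w₁.ceil) : Descends c₁ f₁ c₂ f₂ := by
  induction h generalizing H w₂ with
  | @halt b i G w₁ F c₁ f₁ hS =>
    subst hb
    obtain ⟨j, x, hx, hxw, -, hc, -⟩ := hS.final
    obtain ⟨y, hy, hyx⟩ := hA.big hx (by omega)
    cases h' with
    | halt hS' =>
      obtain ⟨-, -, -, -, -, hlo, -⟩ := hS'.spec
      have := hlo _ _ hy
      omega
    | bump hB' h' =>
      refine ⟨fun _ => ?_, fun hf => ?_⟩
      · rcases f₂ with _ | _
        · have := h'.position.2.2 rfl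
          right
          simp only [hc, Bool.false_eq_true, if_false]
          omega
        · exact Or.inl rfl
      · exfalso
        cases hS with
        | row => cases hf
        | diag =>
          simp only [Bool.false_eq_true, if_false, Prod.mk.injEq, true_and] at hc
          subst hc
          obtain ⟨v, hv, hvw⟩ := hB'.diag_lt hg'.tab
          rw [hy] at hv
          cases hv
          omega
    | diag hD' h' =>
      have hp := h'.position.2.1 rfl
      refine ⟨fun _ => Or.inl hp.1, fun hf => ⟨hp.1, ?_⟩⟩
      cases hS with
      | row => cases hf
      | diag => exact hp.2
  | @bump b i G w₁ G' o₁ F c₁ f₁ hB h ih =>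
    subst hb
    obtain ⟨j, x, hx, hxw⟩ := hB.final h
    obtain ⟨y, hy, hyx⟩ := hA.big hx (by omega)
    cases h' with
    | halt hS' =>
      obtain ⟨-, -, -, -, -, hlo, -⟩ := hS'.spec
      have := hlo _ _ hy
      omega
    | bump hB' h' =>
      exact ih rfl (hg.bump hB) (hg'.bump hB') (hA.bump hB') h' (hB.gt_of_gt h hg'.tab hA hB' hw)
    | diag hD' h' =>
      exact h.descends_cross rfl (hg.bump hB) (hg'.dstep hD') (hA.dstep hD') h'
  | @diag i G w₁ G' o₁ F c₁ f₁ hD h ih =>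
    obtain ⟨x, hx, hxw⟩ := hD.final h
    obtain ⟨v, hv, hvx⟩ := hA.big (p := (i, i)) hx (by omega)
    have hf := (h.position.2.1 rfl).1
    cases h' with
    | halt hS' =>
      obtain ⟨-, -, -, -, -, hlo, -⟩ := hS'.spec
      have := hlo _ _ hv
      omega
    | bump hB' h' =>
      obtain ⟨y, hy, hyw⟩ := hB'.diag_lt hg'.tab
      rw [hv] at hy
      cases hy
      omega
    | diag hD' h' =>
      refine ⟨fun hf' => by simp [hf] at hf', fun _ => ?_⟩
      refine h.descends_col rfl (hg'.dstep hD') (hA.dstep hD') h' ?_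
      obtain ⟨h1, m, hm, h2⟩ := hD'.spec
      rw [hv] at hm
      cases hm
      have := hD.spec.1
      omega

end Descents

theorem Ins.separate {z₁ z₂ : Equiv.Perm ℤ} {T T₁ T₂ : STab} {u v : Letter} {c₁ c₂ : ℕ × ℕ} {f₁ f₂ : Bool}
    (h₁ : Ins z₁ T u T₁ c₁ f₁) (h₂ : Ins z₂ T₁ v T₂ c₂ f₂) : c₁.1 < c₂.1 ∨ c₁.2 < c₂.2 := by
  obtain ⟨N, hT⟩ := h₁.pt.tab
  obtain ⟨-, -, x, hx⟩ := h₁.run.newbox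
  have hn := h₂.run.newbox.1
  have hp := h₂.run.position.1
  by_contra hlt
  obtain ⟨y, hy⟩ := hT.cl (i := c₁.1) (j := c₁.2) hx (i' := c₂.1) (j' := c₂.2) (by omega) (by omega) hp
  have hn' : ent T₁ (c₂.1, c₂.2) = none := hn
  rw [hn'] at hy
  cases hy

theorem Ins.ascends {z₁ z₂ : Equiv.Perm ℤ} {T T₁ T₂ : STab} {u v : Letter} {c₁ c₂ : ℕ × ℕ} {f₁ f₂ : Bool}
    (h₁ : Ins z₁ T u T₁ c₁ f₁) (h₂ : Ins z₂ T₁ v T₂ c₂ f₂) (h : u.ceil < v.ceil) :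
    Ascends c₁ f₁ c₂ f₂ :=
  h₁.run.ascends_row rfl (h₁.good _ (room_side _)) (h₂.good _ (room_side _)) (After.refl _ _) h₂.run
    (h₁.separate h₂) h

theorem Ins.descends {z₁ z₂ : Equiv.Perm ℤ} {T T₁ T₂ : STab} {u v : Letter} {c₁ c₂ : ℕ × ℕ} {f₁ f₂ : Bool}
    (h₁ : Ins z₁ T u T₁ c₁ f₁) (h₂ : Ins z₂ T₁ v T₂ c₂ f₂) (h : v.ceil < u.ceil) :
    Descends c₁ f₁ c₂ f₂ :=
  h₁.run.descends_row rfl (h₁.good _ (room_side _)) (h₂.good _ (room_side _)) (After.refl _ _) h₂.run h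

theorem Letter.le_def {x y : Letter} :
    x ≤ y ↔ x.ceil < y.ceil ∨ x.ceil = y.ceil ∧ (y.primed = true → x.primed = true) := by
  rw [← not_lt, Letter.lt_def]
  cases x.primed <;> cases y.primed <;> simp <;> omega

theorem Letter.eq_of {x y : Letter} (h : x.ceil = y.ceil) (h' : x.primed = y.primed) : x = y := by
  cases x
  cases y
  simp_all

/-- Semistandard fillings. -/
structure SS (F : Fil) : Prop where
  pos : ∀ {p x}, F p = some x → 0 < x.ceil
  row : ∀ {r c c' x y}, F (r, c) = some x → F (r, c') = some y → c ≤ c' → x ≤ y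
  col : ∀ {r r' c x y}, F (r, c) = some x → F (r', c) = some y → r ≤ r' → x ≤ y
  row_ne : ∀ {r c c' x}, F (r, c) = some x → F (r, c') = some x → c < c' → x.primed = false
  col_ne : ∀ {r r' c x}, F (r, c) = some x → F (r', c) = some x → r < r' → x.primed = true

/-- The box of `F` filled last, with its entry. -/
structure Final (F : Fil) (c : ℕ × ℕ) (x : Letter) : Prop where
  mem : F c = some x
  le : ∀ {p y}, F p = some y → y.ceil ≤ x.ceil
  primed : x.primed = true → ∀ {p y}, F p = some y → y.ceil = x.ceil → y.primed = true ∧ p.1 ≤ c.1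
  unprimed : x.primed = false → ∀ {p}, F p = some x → p.2 ≤ c.2

theorem Final.unique {F : Fil} (hF : SS F) {c c' : ℕ × ℕ} {x x' : Letter} (h : Final F c x)
    (h' : Final F c' x') : c = c' ∧ x = x' := by
  obtain ⟨a, b⟩ := c
  obtain ⟨a', b'⟩ := c'
  have he : x.ceil = x'.ceil := le_antisymm (h'.le h.mem) (h.le h'.mem)
  have hp : x.primed = x'.primed := by
    cases hx : x.primed <;> cases hx' : x'.primed
    · rfl
    · rw [(h'.primed hx' h.mem he).1] at hx
      cases hx
    · rw [(h.primed hx h'.mem he.symm).1] at hx'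
      cases hx'
    · rfl
  obtain rfl := Letter.eq_of he hp
  refine ⟨?_, rfl⟩
  cases hx : x.primed
  · obtain rfl : b = b' := le_antisymm (h'.unprimed hx h.mem) (h.unprimed hx h'.mem)
    rcases lt_trichotomy a a' with h1 | rfl | h1
    · rw [hF.col_ne h.mem h'.mem h1] at hx
      cases hx
    · rfl
    · rw [hF.col_ne h'.mem h.mem h1] at hx
      cases hx
  · obtain rfl : a = a' := le_antisymm (h'.primed hx h.mem rfl).2 (h.primed hx h'.mem rfl).2
    rcases lt_trichotomy b b' with h1 | rfl | h1
    · rw [hF.row_ne h.mem h'.mem h1] at hx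
      cases hx
    · rfl
    · rw [hF.row_ne h'.mem h.mem h1] at hx
      cases hx

theorem SS.del {F : Fil} (hF : SS F) (c : ℕ × ℕ) : SS (del F c) := by
  have key : ∀ {p x}, _root_.del F c p = some x → F p = some x := by
    intro p x hx
    simp only [_root_.del] at hx
    split_ifs at hx
    exact hx
  exact ⟨fun hx => hF.pos (key hx), fun hx hy => hF.row (key hx) (key hy),
    fun hx hy => hF.col (key hx) (key hy), fun hx hy => hF.row_ne (key hx) (key hy),
    fun hx hy => hF.col_ne (key hx) (key hy)⟩

theorem Final.exists {F : Fil} {N : ℕ} (hF : SS F) (hN : ∀ i j x, F (i, j) = some x → i < N ∧ j < N)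
    (hne : ∃ p x, F p = some x) : ∃ c x, Final F c x ∧ Corner F c := by
  classical
  let S : Finset (ℕ × ℕ) := (Finset.range N ×ˢ Finset.range N).filter fun p => F p ≠ none
  have hS : ∀ p, p ∈ S ↔ ∃ x, F p = some x := by
    rintro ⟨i, j⟩
    simp only [S, Finset.mem_filter, Finset.mem_product, Finset.mem_range, Option.ne_none_iff_exists']
    exact ⟨fun h => h.2, fun ⟨x, hx⟩ => ⟨hN _ _ _ hx, x, hx⟩⟩
  let key : ℕ × ℕ → ℤ ×ₗ (Bool ×ₗ ℕ) := fun p =>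
    let x := (F p).getD default
    toLex (x.ceil, toLex (!x.primed, if x.primed then p.1 else p.2))
  obtain ⟨c, hc, hmax⟩ := S.exists_max_image key (by
    obtain ⟨p, hp⟩ := hne
    exact ⟨p, (hS p).2 hp⟩)
  obtain ⟨x, hx⟩ := (hS c).1 hc
  have hkey : ∀ p y, F p = some y → y.ceil < x.ceil ∨ y.ceil = x.ceil ∧
      (y.primed = true ∧ x.primed = false ∨
        y.primed = x.primed ∧ (if x.primed then p.1 ≤ c.1 else p.2 ≤ c.2)) := by
    intro p y hy
    have h1 := hmax p ((hS p).2 ⟨y, hy⟩)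
    simp only [key, hx, hy, Option.getD_some, Prod.Lex.toLex_le_toLex] at h1
    rcases h1 with h1 | ⟨h1, h2⟩
    · exact Or.inl h1
    · refine Or.inr ⟨h1, ?_⟩
      rcases h2 with h2 | ⟨h2, h3⟩
      · left
        have h3 := h2
        cases hyp : y.primed <;> cases hxp : x.primed <;> rw [hyp, hxp] at h3 <;>
          first | exact ⟨rfl, rfl⟩ | exact absurd h3 (by decide)
      · right
        cases hyp : y.primed <;> cases hxp : x.primed <;> simp_all
  have hfin : Final F c x := by
    refine ⟨hx, fun hy => ?_, fun hxp p y hy he => ?_, fun hxp p hp => ?_⟩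
    · have := hkey _ _ hy
      omega
    · have h1 := hkey _ _ hy
      simp only [hxp, if_true] at h1
      rcases h1 with h1 | ⟨-, ⟨-, h1⟩ | ⟨h1, h2⟩⟩
      · omega
      · cases h1
      · exact ⟨h1, h2⟩
    · have h1 := hkey _ _ hp
      simp only [hxp] at h1
      simpa using h1
  refine ⟨c, x, hfin, ⟨x, hx⟩, ?_, ?_⟩
  · rcases hy : F (c.1 + 1, c.2) with _ | y
    · rfl
    · exfalso
      have h1 := Letter.le_def.1 (hF.col (r := c.1) hx hy (Nat.le_succ _))
      have h2 := hfin.le hy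
      have h3 : y.ceil = x.ceil := by omega
      cases hxp : x.primed
      · have h4 : y.primed = false := by
          rw [← Bool.not_eq_true]
          intro h5
          have : x.primed = true := by
            rcases h1 with h1 | h1
            · omega
            · exact h1.2 h5
          simp [hxp] at this
        obtain rfl := Letter.eq_of h3 (h4.trans hxp.symm)
        have := hF.col_ne (r := c.1) hx hy (Nat.lt_succ_self _)
        simp [hxp] at this
      · have := (hfin.primed hxp hy h3).2
        simp at this
  · rcases hy : F (c.1, c.2 + 1) with _ | y
    · rfl
    · exfalso
      have h1 := Letter.le_def.1 (hF.row (c := c.2) hx hy (Nat.le_succ _))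
      have h2 := hfin.le hy
      have h3 : y.ceil = x.ceil := by omega
      cases hxp : x.primed
      · have h4 : y.primed = false := by
          rw [← Bool.not_eq_true]
          intro h5
          have : x.primed = true := by
            rcases h1 with h1 | h1
            · omega
            · exact h1.2 h5
          simp [hxp] at this
        obtain rfl := Letter.eq_of h3 (h4.trans hxp.symm)
        have := hfin.unprimed hxp hy
        simp at this
      · have h4 := (hfin.primed hxp hy h3).1
        obtain rfl := Letter.eq_of h3 (h4.trans hxp.symm)
        have := hF.row_ne (c := c.2) hx hy (Nat.lt_succ_self _)
        simp [hxp] at this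

/-- Recording one more insertion. -/
theorem Final.add {F₀ : Fil} (hF : SS F₀) {c : ℕ × ℕ} {x : Letter} (hpos : 0 < x.ceil)
    (hn : ∀ i j y, F₀ (i, j) = some y → ¬ (c.1 ≤ i ∧ c.2 ≤ j))
    (hle : ∀ p y, F₀ p = some y → y.ceil ≤ x.ceil)
    (hasc : ∀ c₀ x₀, Final F₀ c₀ x₀ → x₀.ceil = x.ceil → Ascends c₀ x₀.primed c x.primed)
    (hex : ∀ p y, F₀ p = some y → ∃ c₀ x₀, Final F₀ c₀ x₀) :
    SS (upd F₀ c.1 c.2 x) ∧ Final (upd F₀ c.1 c.2 x) c x := by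
  obtain ⟨a, b⟩ := c
  dsimp only at *
  have hprim : x.primed = true → ∀ {p y}, F₀ p = some y → y.ceil = x.ceil → y.primed = true ∧ p.1 < a := by
    intro hx p y hy he
    obtain ⟨c₀, x₀, h₀⟩ := hex p y hy
    have h1 : x₀.ceil = x.ceil := le_antisymm (hle _ _ h₀.mem) (he ▸ h₀.le hy)
    obtain ⟨h2, h3⟩ := hasc _ _ h₀ h1
    have h4 : x₀.primed = true := by
      by_contra h
      have := (h2 (by simpa using h)).1
      simp [hx] at this
    have h5 := h3 h4
    have h6 := h₀.primed h4 hy (by omega)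
    simp only [hx, Bool.true_eq_false, false_or] at h5
    exact ⟨h6.1, by omega⟩
  have hunp : x.primed = false → ∀ {p}, F₀ p = some x → p.2 < b := by
    intro hx p hy
    obtain ⟨c₀, x₀, h₀⟩ := hex p x hy
    have h1 : x₀.ceil = x.ceil := le_antisymm (hle _ _ h₀.mem) (h₀.le hy)
    obtain ⟨h2, h3⟩ := hasc _ _ h₀ h1
    have h4 : x₀.primed = false := by
      by_contra h
      have := (h₀.primed (by simpa using h) hy h1.symm).1
      simp [hx] at this
    obtain rfl := Letter.eq_of h1 (h4.trans hx.symm)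
    have := h₀.unprimed hx hy
    have := (h2 hx).2
    omega
  have hlex : ∀ p y, F₀ p = some y → y ≤ x := by
    intro p y hy
    rw [Letter.le_def]
    rcases (hle p y hy).lt_or_eq with h | h
    · exact Or.inl h
    · exact Or.inr ⟨h, fun hx => (hprim hx hy h).1⟩
  have key : ∀ {i j y}, upd F₀ a b x (i, j) = some y → i = a ∧ j = b ∧ y = x ∨ F₀ (i, j) = some y := by
    intro i j y hy
    rw [upd_apply] at hy
    split_ifs at hy with h
    · cases hy
      exact Or.inl ⟨h.1, h.2, rfl⟩
    · exact Or.inr hy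
  refine ⟨⟨?_, ?_, ?_, ?_, ?_⟩, ?_, ?_, ?_, ?_⟩
  · rintro ⟨i, j⟩ y hy
    rcases key hy with ⟨-, -, rfl⟩ | hy
    · exact hpos
    · exact hF.pos hy
  · intro r c c' y y' hy hy' hc
    rcases key hy with ⟨rfl, rfl, rfl⟩ | hy₀ <;> rcases key hy' with ⟨h1, h2, rfl⟩ | hy₀'
    · exact le_rfl
    · exact absurd ⟨le_rfl, hc⟩ (hn _ _ _ hy₀')
    · exact hlex _ _ hy₀
    · exact hF.row hy₀ hy₀' hc
  · intro r r' c y y' hy hy' hc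
    rcases key hy with ⟨rfl, rfl, rfl⟩ | hy₀ <;> rcases key hy' with ⟨h1, h2, rfl⟩ | hy₀'
    · exact le_rfl
    · exact absurd ⟨hc, le_rfl⟩ (hn _ _ _ hy₀')
    · exact hlex _ _ hy₀
    · exact hF.col hy₀ hy₀' hc
  · intro r c c' y hy hy' hc
    rcases key hy with ⟨rfl, rfl, rfl⟩ | hy₀ <;> rcases key hy' with ⟨h1, h2, h3⟩ | hy₀'
    · omega
    · exact absurd ⟨le_rfl, hc.le⟩ (hn _ _ _ hy₀')
    · subst h1 h2 h3
      by_contra h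
      have := (hprim (by simpa using h) hy₀ rfl).2
      simp at this
    · exact hF.row_ne hy₀ hy₀' hc
  · intro r r' c y hy hy' hc
    rcases key hy with ⟨rfl, rfl, rfl⟩ | hy₀ <;> rcases key hy' with ⟨h1, h2, h3⟩ | hy₀'
    · omega
    · exact absurd ⟨hc.le, le_rfl⟩ (hn _ _ _ hy₀')
    · subst h1 h2 h3
      by_contra h
      have := hunp (by simpa using h) hy₀
      simp at this
    · exact hF.col_ne hy₀ hy₀' hc
  · exact upd_self _ _ _ _
  · rintro ⟨i, j⟩ y hy
    rcases key hy with ⟨-, -, rfl⟩ | hy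
    · exact le_rfl
    · exact hle _ _ hy
  · rintro hx ⟨i, j⟩ y hy he
    rcases key hy with ⟨rfl, -, rfl⟩ | hy
    · exact ⟨hx, le_rfl⟩
    · have := hprim hx hy he
      exact ⟨this.1, this.2.le⟩
  · rintro hx ⟨i, j⟩ hy
    rcases key hy with ⟨-, rfl, -⟩ | hy
    · exact le_rfl
    · exact (hunp hx hy).le

/-- Equal labels cannot be recorded in descending position. -/
theorem Final.not_descends {F : Fil} (hF : SS F) {c c₁ : ℕ × ℕ} {x x₁ : Letter} (h : Final F c x)
    (h₁ : F c₁ = some x₁) (hne : c₁ ≠ c) (he : x₁.ceil = x.ceil)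
    (hcl : c₁.1 < c.1 → c₁.2 < c.2 → ∃ y, F (c₁.1, c.2) = some y) :
    ¬ Descends c₁ x₁.primed c x.primed := by
  obtain ⟨a, b⟩ := c
  obtain ⟨a₁, b₁⟩ := c₁
  dsimp only at *
  rintro ⟨h2, h3⟩
  cases hx₁ : x₁.primed
  · have hx : x.primed = false := by
      by_contra hx
      have := (h.primed (by simpa using hx) h₁ he).1
      simp [hx₁] at this
    obtain rfl := Letter.eq_of he (hx₁.trans hx.symm)
    have hlt := h2 hx₁
    simp only [hx, Bool.false_eq_true, false_or] at hlt
    have hb := h.unprimed hx h₁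
    dsimp only at hb
    rcases hb.lt_or_eq with hb | rfl
    · obtain ⟨y, hy⟩ := hcl hlt hb
      obtain rfl := le_antisymm (hF.row h₁ hy hb.le) (hF.col hy h.mem hlt.le)
      have := hF.col_ne hy h.mem hlt
      simp [hx] at this
    · have := hF.col_ne h₁ h.mem hlt
      simp [hx] at this
  · obtain ⟨hx, hlt⟩ := h3 hx₁
    obtain rfl := Letter.eq_of he (hx₁.trans hx.symm)
    have ha := (h.primed hx h₁ rfl).2
    dsimp only at ha
    rcases ha.lt_or_eq with ha | rfl
    · obtain ⟨y, hy⟩ := hcl ha hlt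
      obtain rfl := le_antisymm (hF.row h₁ hy hlt.le) (hF.col hy h.mem ha.le)
      have := hF.row_ne h₁ hy hlt
      simp [hx] at this
    · have := hF.row_ne h₁ h.mem hlt
      simp [hx] at this

/-- Insert the letter `p.2` into the first tableau and record it with label `p.1` in the second. -/
def insertPair (T : STab × STab) (p : ℤ × Letter) : STab × STab :=
  ((egInsert T.1 p.2).1, addBox T.2 T.1 (egInsert T.1 p.2).1 ⟨p.1, (egInsert T.1 p.2).2⟩)

/-- The pair of tableaux of a word of labelled letters. -/
def tableauPair (β : List (ℤ × Letter)) : STab × STab := β.foldl insertPair ([], [])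

/-- The order on labelled letters in an increasing factorization. -/
def LabelLT (p q : ℤ × Letter) : Prop := p.1 < q.1 ∨ p.1 = q.1 ∧ p.2.ceil < q.2.ceil

theorem LabelLT.trans {p q r : ℤ × Letter} (h : LabelLT p q) (h' : LabelLT q r) : LabelLT p r := by
  unfold LabelLT at *
  omega

/-- Words of labelled letters that encode increasing factorizations. -/
structure Adm (z : Equiv.Perm ℤ) (β : List (ℤ × Letter)) : Prop where
  sorted : β.Pairwise LabelLT
  pos : ∀ p ∈ β, 0 < p.1
  word : β.map Prod.snd ∈ RinvPlus z

/-- Pairs of tableaux in the image of the correspondence. -/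
structure PairOK (z : Equiv.Perm ℤ) (P Q : STab) : Prop where
  pt : PT z P
  shifted : IsShifted Q
  dom : SameDom (ent Q) (ent P)
  ss : SS (ent Q)

/-- `(P, Q)` is obtained from `(P₀, Q₀)` by inserting `u` with label `i`. -/
def LastStep (z : Equiv.Perm ℤ) (T₀ : STab × STab) (p : ℤ × Letter) (T : STab × STab) : Prop :=
  ∃ c f, Ins z T₀.1 p.2 T.1 c f ∧ ent T₀.2 c = none ∧ ent T.2 = upd (ent T₀.2) c.1 c.2 ⟨p.1, f⟩ ∧
    Final (ent T.2) c ⟨p.1, f⟩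

theorem tableauPair_snoc (β : List (ℤ × Letter)) (p : ℤ × Letter) :
    tableauPair (β ++ [p]) = insertPair (tableauPair β) p := by
  simp [tableauPair]

theorem ent_nil : ent [] = fun _ => none := by
  funext p
  rw [ent_apply]
  simp

theorem act_of_mem {z : Equiv.Perm ℤ} {a : PWord} (h : a ∈ RinvPlus z) : act 1 a = z :=
  (mem_RinvPlus_iff.1 h).1

theorem length_eq_of_mem {z : Equiv.Perm ℤ} {a b : PWord} (ha : a ∈ RinvPlus z) (hb : b ∈ RinvPlus z) :
    a.length = b.length :=
  le_antisymm ((mem_RinvPlus_iff.1 ha).2.1 b (act_of_mem hb))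
    ((mem_RinvPlus_iff.1 hb).2.1 a (act_of_mem ha))

theorem isShifted_nil : IsShifted ([] : STab) := by
  exact ⟨List.isChain_nil, by simp [shapeOf]⟩

theorem pt_nil {z : Equiv.Perm ℤ} (h : [] ∈ RinvPlus z) : PT z [] := by
  have he : ∀ r c x, entry? [] r c = some x → False := fun r c x hx => by
    simp [entry?, entryG?] at hx
  exact pt_iff.2 ⟨isShifted_nil, ⟨fun _ _ _ _ hx _ => (he _ _ _ hx).elim,
    fun _ _ _ _ hx _ => (he _ _ _ hx).elim⟩, fun _ _ hx => (he _ _ _ hx).elim, by simpa [rowWord] using h⟩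

theorem Adm.snoc {z : Equiv.Perm ℤ} {β : List (ℤ × Letter)} {p : ℤ × Letter} (h : Adm z (β ++ [p])) :
    Adm (act 1 (β.map Prod.snd)) β ∧ 0 < p.1 ∧ (∀ q ∈ β, LabelLT q p) := by
  obtain ⟨h1, h2, h3⟩ := h
  rw [List.pairwise_append] at h1
  rw [List.map_append] at h3
  exact ⟨⟨h1.1, fun q hq => h2 q (by simp [hq]), RinvPlus_prefix h3⟩, h2 p (by simp),
    fun q hq => h1.2.2 q hq p (by simp)⟩

theorem Adm.tableauPair {z : Equiv.Perm ℤ} {β : List (ℤ × Letter)} (h : Adm z β) :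
    PairOK z (tableauPair β).1 (tableauPair β).2 ∧
      ∀ β₀ p, β = β₀ ++ [p] → LastStep z (_root_.tableauPair β₀) p (_root_.tableauPair β) := by
  induction β using List.reverseRecOn generalizing z with
  | nil =>
    refine ⟨⟨pt_nil h.word, isShifted_nil, SameDom.refl _, ?_⟩, fun β₀ p hβ => by simp at hβ⟩
    constructor <;> intros <;> simp_all [_root_.tableauPair, ent_nil]
  | append_singleton β p ih =>
    obtain ⟨h₀, hpos, hlast⟩ := h.snoc
    obtain ⟨hok, hL⟩ := ih h₀
    rw [tableauPair_snoc]
    have hw := h.word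
    rw [List.map_append] at hw
    have hw' := RinvPlus_replace_prefix h₀.word hok.pt.word hw
    obtain ⟨T', c, f, hI⟩ := Ins.exists hok.pt.shifted hok.pt.tab hw'
    set P₀ := (_root_.tableauPair β).1 with hP₀
    set Q₀ := (_root_.tableauPair β).2 with hQ₀
    have hins : insertPair (_root_.tableauPair β) p = (T', addBox Q₀ P₀ T' ⟨p.1, f⟩) := by
      simp only [insertPair, ← hP₀, ← hQ₀, hI.eq]
    rw [hins]
    obtain ⟨hn, hd, y, hy⟩ := hI.run.newbox
    obtain ⟨N, hT'⟩ := hI.pt.tab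
    obtain ⟨ha, hb, hc⟩ := addBox_eq (x := ⟨p.1, f⟩) hT' hok.dom hy hd hok.shifted
    have hnone : ent Q₀ c = none := (hok.dom c).2 hn
    have hex : ∀ {q y}, ent Q₀ q = some y → ∃ β₁ p₁, β = β₁ ++ [p₁] := by
      intro q y hq
      rcases List.eq_nil_or_concat β with rfl | ⟨β₁, p₁, hβ⟩
      · rw [hQ₀] at hq
        simp [_root_.tableauPair, ent_nil] at hq
      · exact ⟨β₁, p₁, by simpa using hβ⟩
    have hfin : SS (upd (ent Q₀) c.1 c.2 ⟨p.1, f⟩) ∧ Final (upd (ent Q₀) c.1 c.2 ⟨p.1, f⟩) c ⟨p.1, f⟩ := by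
      refine Final.add hok.ss hpos ?_ ?_ ?_ ?_
      · rintro i j y hy ⟨h1, h2⟩
        obtain ⟨y', hy'⟩ := hok.shifted.closed hy h1 h2 hI.run.position.1
        rw [hnone] at hy'
        cases hy'
      · intro q y hq
        obtain ⟨β₁, p₁, hβ⟩ := hex hq
        obtain ⟨c₁, f₁, -, -, -, hF⟩ := hL _ _ hβ
        have h1 : y.ceil ≤ p₁.1 := hF.le hq
        have h2 : LabelLT p₁ p := hlast p₁ (by simp [hβ])
        unfold LabelLT at h2
        show y.ceil ≤ p.1
        omega
      · intro c₀ x₀ hF₀ hx₀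
        obtain ⟨β₁, p₁, hβ⟩ := hex hF₀.mem
        obtain ⟨c₁, f₁, hI₁, -, -, hF⟩ := hL _ _ hβ
        obtain ⟨rfl, rfl⟩ := Final.unique hok.ss hF₀ hF
        have h2 : LabelLT p₁ p := hlast p₁ (by simp [hβ])
        have h3 : p₁.1 = p.1 := hx₀
        exact hI₁.ascends hI (by unfold LabelLT at h2; omega)
      · intro q y hq
        obtain ⟨β₁, p₁, hβ⟩ := hex hq
        obtain ⟨c₁, f₁, -, -, -, hF⟩ := hL _ _ hβ
        exact ⟨_, _, hF⟩
    refine ⟨⟨hI.pt, ha, hc, by rw [hb]; exact hfin.1⟩, fun β₀ q hβ => ?_⟩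
    obtain ⟨rfl, hq⟩ := List.append_inj' hβ rfl
    obtain rfl : p = q := by simpa using hq
    refine ⟨c, f, hI, hnone, hb, ?_⟩
    dsimp only
    rw [hb]
    exact hfin.2

theorem Adm.inj {z z' : Equiv.Perm ℤ} {β β' : List (ℤ × Letter)} (h : Adm z β) (h' : Adm z' β')
    (he : _root_.tableauPair β = _root_.tableauPair β') : β = β' := by
  induction β using List.reverseRecOn generalizing z z' β' with
  | nil =>
    rcases List.eq_nil_or_concat β' with rfl | ⟨β₁, p₁, hβ⟩
    · rfl
    · obtain ⟨c, f, -, -, -, hF⟩ := h'.tableauPair.2 β₁ p₁ (by simpa using hβ)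
      have := hF.mem
      rw [← he] at this
      simp [_root_.tableauPair, ent_nil] at this
  | append_singleton β p ih =>
    obtain ⟨hok, hL⟩ := h.tableauPair
    obtain ⟨hok', hL'⟩ := h'.tableauPair
    obtain ⟨c, f, hI, hn, hu, hF⟩ := hL _ _ rfl
    rcases List.eq_nil_or_concat β' with rfl | ⟨β₁, p₁, hβ⟩
    · have := hF.mem
      rw [he] at this
      simp [_root_.tableauPair, ent_nil] at this
    · obtain rfl : β' = β₁ ++ [p₁] := by simpa using hβ
      obtain ⟨c₁, f₁, hI₁, hn₁, hu₁, hF₁⟩ := hL' _ _ rfl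
      have hz : z = z' := by
        rw [← act_of_mem hok.pt.word, he, act_of_mem hok'.pt.word]
      subst hz
      have hS := hok.ss
      rw [he] at hF hI hu hS
      obtain ⟨rfl, hx⟩ := hF.unique hS hF₁
      obtain ⟨hp, rfl⟩ : p.1 = p₁.1 ∧ f = f₁ := by simpa using hx
      obtain ⟨hP, hpu⟩ := hI.det hI₁
      have hQ : (_root_.tableauPair β).2 = (_root_.tableauPair β₁).2 := by
        refine ent_inj h.snoc.1.tableauPair.1.shifted h'.snoc.1.tableauPair.1.shifted ?_
        rw [← del_upd (x := ⟨p.1, f⟩) hn, ← del_upd (x := ⟨p₁.1, f⟩) hn₁]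
        show del (upd _ c.1 c.2 _) c = del (upd _ c.1 c.2 _) c
        rw [← hu, ← hu₁]
      rw [ih h.snoc.1 h'.snoc.1 (Prod.ext hP hQ), Prod.ext hp hpu]

theorem PairOK.surj {z : Equiv.Perm ℤ} {P Q : STab} (h : PairOK z P Q) :
    ∃ β, Adm z β ∧ tableauPair β = (P, Q) := by
  induction hn : (rowWord P).length generalizing z P Q with
  | zero =>
    have hP : P = [] := by
      by_contra hP
      obtain ⟨row, T, rfl⟩ := List.exists_cons_of_ne_nil hP
      have := h.pt.shifted.ne_nil row (by simp)
      rw [rowWord, List.length_eq_zero_iff] at hn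
      exact this (by simpa using List.flatten_eq_nil_iff.1 hn row (by simp))
    subst hP
    have hQ : Q = [] := by
      refine ent_inj h.shifted isShifted_nil ?_
      rw [ent_nil]
      funext p
      exact (h.dom p).2 (by rw [ent_nil])
    subst hQ
    exact ⟨[], ⟨by simp, by simp, by simpa [rowWord] using h.pt.word⟩, rfl⟩
  | succ n ih =>
    have hne : ∃ p x, ent Q p = some x := by
      by_contra hne
      have hQ : ent P = ent [] := by
        rw [ent_nil]
        funext p
        refine (h.dom p).1 ?_
        by_contra hp
        exact hne ⟨p, Option.ne_none_iff_exists'.1 hp⟩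
      rw [ent_inj h.pt.shifted isShifted_nil hQ] at hn
      simp [rowWord] at hn
    obtain ⟨c, x, hF, hC⟩ := Final.exists h.ss (room_side Q).lt hne
    have hC' : Corner (ent P) c := by
      refine ⟨Option.ne_none_iff_exists'.1 fun hc => ?_, (h.dom _).1 hC.up, (h.dom _).1 hC.right⟩
      have := hF.mem
      rw [(h.dom _).2 hc] at this
      cases this
    obtain ⟨T, u, hI⟩ := Ins.back h.pt hC' x.primed
    obtain ⟨hn', hd, y, hy⟩ := hI.run.newbox
    have hp := hI.run.position.1
    obtain ⟨hT, hw⟩ := hI.word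
    obtain ⟨Q₀, hS₀, hQ₀⟩ : ∃ Q₀, IsShifted Q₀ ∧ ent Q₀ = del (ent Q) c := by
      refine exists_ent_of (N := side Q) ?_ ?_ ?_
      · intro i j y hq
        rw [del_apply] at hq
        split_ifs at hq
        rw [ent_apply] at hq
        by_contra hij
        rw [if_neg hij] at hq
        cases hq
      · intro i j y hq
        rw [del_apply] at hq
        split_ifs at hq
        exact (room_side Q).lt _ _ _ hq
      · intro i j i' j' y hq hi hj hij
        rw [del_apply] at hq
        split_ifs at hq with hc
        obtain ⟨y', hq'⟩ := h.shifted.closed hq hi hj hij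
        refine ⟨y', ?_⟩
        rw [del_apply, if_neg, hq']
        obtain ⟨a, b⟩ := c
        rintro ⟨rfl, rfl⟩
        dsimp only at hc
        have hup := hC.up
        have hri := hC.right
        dsimp only at hup hri
        rcases Nat.lt_or_ge i' i with hlt | hge
        · by_cases hij₁ : i' + 1 ≤ j'
          · obtain ⟨w, hw⟩ := h.shifted.closed hq (i' := i' + 1) (j' := j') hlt hj hij₁
            rw [hup] at hw
            cases hw
          · have : i ≤ j := by
              by_contra hij'
              rw [ent_apply, if_neg hij'] at hq
              cases hq
            obtain ⟨w, hw⟩ := h.shifted.closed hq (i' := i') (j' := j' + 1) hi (by omega) (by omega)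
            rw [hri] at hw
            cases hw
        · obtain rfl : i = i' := by omega
          have : j' < j := by
            rcases Nat.lt_or_ge j' j with h1 | h1
            · exact h1
            · exact absurd ⟨rfl, le_antisymm h1 hj⟩ hc
          obtain ⟨w, hw⟩ := h.shifted.closed hq (i' := i) (j' := j' + 1) le_rfl this (by omega)
          rw [hri] at hw
          cases hw
    have hdom₀ : SameDom (ent Q₀) (ent T) := by
      rintro q
      have := hd q
      simp only [ori] at this
      rw [hQ₀]
      refine Iff.trans ?_ this.symm
      simp only [del]
      split_ifs
      · simp
      · exact h.dom q
    have hT₀ : rowWord T ∈ RinvPlus (act 1 (rowWord T)) := RinvPlus_prefix hw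
    have hok₀ : PairOK (act 1 (rowWord T)) T Q₀ :=
      ⟨⟨hI.shifted, hT, hT₀⟩, hS₀, hdom₀, by rw [hQ₀]; exact h.ss.del c⟩
    have hlen : (rowWord T).length = n := by
      have := length_eq_of_mem hw h.pt.word
      simp at this
      omega
    obtain ⟨β, hβ, hpair⟩ := ih hok₀ hlen
    have hword : β.map Prod.snd ++ [u] ∈ RinvPlus z := RinvPlus_replace_prefix hT₀ hβ.word hw
    have hxc : upd (ent Q₀) c.1 c.2 x = ent Q := by
      rw [hQ₀]
      exact upd_del hF.mem
    refine ⟨β ++ [(x.ceil, u)], ⟨?_, ?_, by simpa using hword⟩, ?_⟩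
    · have key : ∀ β₁ p₁, β = β₁ ++ [p₁] → LabelLT p₁ (x.ceil, u) := by
        rintro β₁ p₁ rfl
        obtain ⟨c₁, f₁, hI₁, -, hu₁, hF₁⟩ := hβ.tableauPair.2 _ _ rfl
        rw [hpair] at hI₁ hF₁
        dsimp only at hI₁ hF₁
        have hm := hF₁.mem
        rw [hQ₀] at hm
        have hcc : c₁ ≠ c := by
          rintro rfl
          simp [del] at hm
        have hm' : ent Q c₁ = some ⟨p₁.1, f₁⟩ := by simpa [del, hcc] using hm
        have hle : p₁.1 ≤ x.ceil := hF.le hm'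
        rcases hle.lt_or_eq with h1 | h1
        · exact Or.inl h1
        · refine Or.inr ⟨h1, ?_⟩
          have hne : p₁.2.ceil ≠ u.ceil := by
            refine (locCls_RinvPlus z).ne (β₁.map Prod.snd) _ _ [] ?_
            simpa using hword
          by_contra hlt
          refine hF.not_descends h.ss hm' hcc h1 ?_ (hI₁.descends hI ?_)
          · intro h3 h4
            exact h.shifted.closed (i := c.1) (j := c.2) hF.mem h3.le le_rfl (by omega)
          · dsimp only at hlt
            omega
      rw [List.pairwise_append]
      refine ⟨hβ.sorted, by simp, fun q hq p hp => ?_⟩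
      obtain rfl : p = (x.ceil, u) := by simpa using hp
      rcases List.eq_nil_or_concat β with rfl | ⟨β₁, p₁, hb⟩
      · simp at hq
      · obtain rfl : β = β₁ ++ [p₁] := by simpa using hb
        have hk := key _ _ rfl
        rcases List.mem_append.1 hq with h1 | h1
        · exact (List.pairwise_append.1 hβ.sorted).2.2 q h1 p₁ (by simp) |>.trans hk
        · obtain rfl : q = p₁ := by simpa using h1
          exact hk
    · intro q hq
      rcases List.mem_append.1 hq with h1 | h1
      · exact hβ.pos q h1
      · obtain rfl : q = (x.ceil, u) := by simpa using h1
        exact h.ss.pos hF.mem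
    · obtain ⟨N, hT'⟩ := hI.pt.tab
      obtain ⟨ha, hb, -⟩ := addBox_eq (x := x) hT' hdom₀ hy hd hS₀
      rw [tableauPair_snoc, hpair]
      simp only [insertPair, hI.eq]
      exact Prod.ext rfl (ent_inj ha h.shifted (hb.trans hxc))

theorem ent_le {T : STab} {r c : ℕ} {x : Letter} (h : ent T (r, c) = some x) : r ≤ c := by
  by_contra hrc
  rw [ent_apply, if_neg hrc] at h
  cases h

theorem mem_flatten_iff {T : STab} {x : Letter} : x ∈ T.flatten ↔ ∃ p, ent T p = some x := by
  constructor
  · intro h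
    obtain ⟨row, hrow, hx⟩ := List.mem_flatten.1 h
    obtain ⟨r, hr, rfl⟩ := List.getElem_of_mem hrow
    obtain ⟨k, hk, rfl⟩ := List.getElem_of_mem hx
    refine ⟨(r, r + k), ?_⟩
    rw [← ent_row, List.getD_eq_getElem _ _ hr, List.getElem?_eq_getElem hk]
  · rintro ⟨⟨r, c⟩, h⟩
    have hrc := ent_le h
    rw [ent_apply, if_pos hrc] at h
    have hx := List.mem_of_getElem? h
    rcases Nat.lt_or_ge r T.length with hr | hr
    · rw [List.getD_eq_getElem _ _ hr] at hx
      exact List.mem_flatten.2 ⟨_, List.getElem_mem hr, hx⟩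
    · rw [List.getD_eq_default _ _ hr] at hx
      cases hx

theorem ss_iff {Q : STab} (hS : IsShifted Q) : SS (ent Q) ↔ IsSemistandard Q := by
  constructor
  · intro h
    refine ⟨fun x hx => ?_, fun r c x y hx hy => h.row hx hy (Nat.le_succ c),
      fun r c x y hx hy => h.col hx hy (Nat.le_succ r), fun r c c' x hc hx hy => h.row_ne hx hy hc,
      fun r r' c x hr hx hy => h.col_ne hx hy hr⟩
    obtain ⟨p, hp⟩ := mem_flatten_iff.1 hx
    exact h.pos hp
  · rintro ⟨h1, h2, h3, h4, h5⟩
    refine ⟨fun hx => h1 _ (mem_flatten_iff.2 ⟨_, hx⟩), ?_, ?_, fun hx hy hc => h4 _ _ _ _ hc hx hy,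
      fun hx hy hr => h5 _ _ _ _ hr hx hy⟩
    · intro r c c' x y hx hy hc
      obtain ⟨d, rfl⟩ := Nat.exists_eq_add_of_le hc
      induction d generalizing y with
      | zero =>
        have : some x = some y := hx.symm.trans hy
        exact (Option.some.inj this).le
      | succ d ih =>
        have hrc := ent_le hx
        obtain ⟨w, hw⟩ := hS.closed hy le_rfl (j' := c + d) (by omega) (by omega)
        exact (ih hw (by omega)).trans (h2 _ _ _ _ hw hy)
    · intro r r' c x y hx hy hr
      obtain ⟨d, rfl⟩ := Nat.exists_eq_add_of_le hr
      induction d generalizing y with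
      | zero =>
        have : some x = some y := hx.symm.trans hy
        exact (Option.some.inj this).le
      | succ d ih =>
        have hrc := ent_le hy
        obtain ⟨w, hw⟩ := hS.closed hy (i' := r + d) (by omega) le_rfl (by omega)
        exact (ih hw (by omega)).trans (h3 _ _ _ _ hw hy)

theorem pairOK_iff {z : Equiv.Perm ℤ} {P Q : STab} : PairOK z P Q ↔
    shapeOf P = shapeOf Q ∧ IsShifted P ∧ IsIncreasing P ∧ NoDiagPrimes P ∧ rowWord P ∈ RinvPlus z ∧
      IsShifted Q ∧ IsSemistandard Q := by
  constructor
  · intro h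
    obtain ⟨a, b, c, d⟩ := pt_iff.1 h.pt
    exact ⟨(h.dom.symm).shapeOf a h.shifted, a, b, c, d, h.shifted, (ss_iff h.shifted).1 h.ss⟩
  · rintro ⟨hs, a, b, c, d, e, f⟩
    exact ⟨pt_iff.2 ⟨a, b, c, d⟩, e, (sameDom_of_shapeOf hs).symm, (ss_iff e).2 f⟩

/-- The labelled letters of the first `N` factors. -/
def labelWord (φ : ℕ → PWord) (N : ℕ) : List (ℤ × Letter) :=
  ((List.range N).map fun n => (φ n).map fun u => ((n + 1 : ℤ), u)).flatten

theorem labelWord_succ (φ : ℕ → PWord) (N : ℕ) :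
    labelWord φ (N + 1) = labelWord φ N ++ (φ N).map fun u => ((N + 1 : ℤ), u) := by
  simp [labelWord, List.range_succ]

theorem labelWord_snd (φ : ℕ → PWord) (N : ℕ) :
    (labelWord φ N).map Prod.snd = ((List.range N).map φ).flatten := by
  induction N with
  | zero => rfl
  | succ N ih =>
    rw [labelWord_succ, List.map_append, ih]
    simp [List.range_succ, Function.comp_def]

theorem prefLen_succ (φ : ℕ → PWord) (N : ℕ) : prefLen φ (N + 1) = prefLen φ N + (φ N).length := by
  simp [prefLen, List.range_succ]

theorem prefLen_mono (φ : ℕ → PWord) : Monotone (prefLen φ) :=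
  monotone_nat_of_le_succ fun n => by rw [prefLen_succ]; omega

theorem length_labelWord (φ : ℕ → PWord) (N : ℕ) : (labelWord φ N).length = prefLen φ N := by
  induction N with
  | zero => rfl
  | succ N ih => rw [labelWord_succ, List.length_append, ih, prefLen_succ, List.length_map]

theorem labelWord_eq_of_le {φ : ℕ → PWord} {M N : ℕ} (hφ : ∀ n, M ≤ n → φ n = []) (h : M ≤ N) :
    labelWord φ N = labelWord φ M := by
  obtain ⟨d, rfl⟩ := Nat.exists_eq_add_of_le h
  induction d with
  | zero => rfl
  | succ d ih =>
    rw [← Nat.add_assoc, labelWord_succ, ih (by omega), hφ (M + d) (by omega)]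
    simp

theorem relabel_eq {φ : ℕ → PWord} {n k : ℕ} (hk : k < (φ n).length) :
    relabel φ ((prefLen φ n + k + 1 : ℕ) : ℤ) = n + 1 := by
  have h : IsLeast {i : ℕ | 1 ≤ i ∧ ((prefLen φ n + k + 1 : ℕ) : ℤ) ≤ (prefLen φ i : ℤ)} (n + 1) := by
    refine ⟨⟨by omega, ?_⟩, ?_⟩
    · rw [prefLen_succ]
      omega
    · rintro i ⟨-, hi⟩
      by_contra hlt
      have := prefLen_mono φ (show i ≤ n by omega)
      omega
  rw [relabel, h.csInf_eq]
  push_cast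
  rfl

theorem getElem_labelWord {φ : ℕ → PWord} {N k : ℕ} {p : ℤ × Letter} (h : (labelWord φ N)[k]? = some p) :
    relabel φ ((k + 1 : ℕ) : ℤ) = p.1 := by
  induction N with
  | zero => simp [labelWord] at h
  | succ N ih =>
    rw [labelWord_succ] at h
    rcases Nat.lt_or_ge k (labelWord φ N).length with hk | hk
    · rw [List.getElem?_append_left hk] at h
      exact ih h
    · rw [List.getElem?_append_right hk, List.getElem?_map, Option.map_eq_some_iff] at h
      obtain ⟨u, hu, rfl⟩ := h
      rw [length_labelWord] at hk hu
      have hlt := (List.getElem?_eq_some_iff.1 hu).1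
      have := relabel_eq hlt
      rw [show prefLen φ N + (k - prefLen φ N) + 1 = k + 1 by omega] at this
      exact this

theorem addBox_map (g : Letter → Letter) (Q T T' : STab) (x : Letter) :
    (addBox Q T T' x).map (List.map g) = addBox (Q.map (List.map g)) T T' (g x) := by
  unfold addBox
  cases List.find? (fun r => decide ((T.getD r []).length ≠ (T'.getD r []).length))
    (List.range T'.length) with
  | none => rfl
  | some r =>
    have hr : (Q.map (List.map g)).getD r [] = (Q.getD r []).map g := by
      rw [List.getD_eq_getElem?_getD, List.getD_eq_getElem?_getD, List.getElem?_map]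
      cases Q[r]? <;> simp
    simp only [setRowG, List.length_map, hr]
    split_ifs
    · simp [List.map_set]
    · simp

theorem foldl_insertPair (h : ℤ → ℤ) (β : List (ℤ × Letter)) (n : ℕ)
    (hβ : ∀ k p, β[k]? = some p → h ((n + k : ℕ) : ℤ) = p.1) (P Q : STab) :
    β.foldl insertPair (P, Q.map (List.map fun x => ⟨h x.ceil, x.primed⟩)) =
      ((β.map Prod.snd).foldl (fun T u => (egInsert T u).1) P,
        (QEGaux P Q n (β.map Prod.snd)).map (List.map fun x => ⟨h x.ceil, x.primed⟩)) := by
  induction β generalizing n P Q with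
  | nil => rfl
  | cons p β ih =>
    have hp : h (n : ℤ) = p.1 := hβ 0 p rfl
    have hrec := ih (n + 1) (fun k q hq => by
      rw [show n + 1 + k = n + (k + 1) by omega]
      exact hβ (k + 1) q (by simpa using hq)) (egInsert P p.2).1
      (addBox Q P (egInsert P p.2).1 ⟨(n : ℤ), (egInsert P p.2).2⟩)
    rw [addBox_map] at hrec
    simp only [List.foldl_cons, List.map_cons, QEGaux, insertPair, ← hp]
    exact hrec

theorem seqBound_spec {φ : ℕ → PWord} {N : ℕ} (h : ∀ n, N ≤ n → φ n = []) :
    seqBound φ ≤ N ∧ ∀ n, seqBound φ ≤ n → φ n = [] :=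
  ⟨Nat.sInf_le h, Nat.sInf_mem (s := {N | ∀ n, N ≤ n → φ n = []}) ⟨N, h⟩⟩

theorem tableauPair_labelWord (φ : ℕ → PWord) :
    tableauPair (labelWord φ (seqBound φ)) = (PEGseq φ, QEGseq φ) := by
  have := foldl_insertPair (relabel φ) (labelWord φ (seqBound φ)) 1 (fun k p hp => by
    rw [Nat.add_comm]
    exact getElem_labelWord hp) [] []
  rw [labelWord_snd] at this
  exact this

theorem labelWord_filter (φ : ℕ → PWord) {n N : ℕ} (h : n < N) :
    ((labelWord φ N).filter fun p => p.1 = (n + 1 : ℤ)).map Prod.snd = φ n := by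
  have key : ∀ M : ℕ, ((φ M).map fun u => ((M + 1 : ℤ), u)).filter (fun p => p.1 = (n + 1 : ℤ)) =
      if M = n then (φ n).map fun u => ((n + 1 : ℤ), u) else [] := by
    intro M
    split_ifs with hM
    · subst hM
      rw [List.filter_eq_self]
      simp
    · rw [List.filter_eq_nil_iff]
      simp
      omega
  have hnil : ∀ M ≤ n, (labelWord φ M).filter (fun p => p.1 = (n + 1 : ℤ)) = [] := by
    intro M hM
    induction M with
    | zero => rfl
    | succ M ih => rw [labelWord_succ, List.filter_append, ih (by omega), key, if_neg (by omega)]; rfl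
  obtain ⟨d, rfl⟩ := Nat.exists_eq_add_of_le (Nat.succ_le_of_lt h)
  clear h
  induction d with
  | zero =>
    rw [Nat.add_zero, labelWord_succ, List.filter_append, hnil n le_rfl, key, if_pos rfl]
    simp [Function.comp_def]
  | succ d ih =>
    rw [← Nat.add_assoc, labelWord_succ, List.filter_append, key, if_neg (by omega), List.append_nil, ih]

theorem labelWord_pos {φ : ℕ → PWord} {N : ℕ} : ∀ p ∈ labelWord φ N, 0 < p.1 ∧ p.1 ≤ N := by
  intro p hp
  simp only [labelWord, List.mem_flatten, List.mem_map, List.mem_range] at hp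
  obtain ⟨-, ⟨n, hn, rfl⟩, hp⟩ := hp
  obtain ⟨u, -, rfl⟩ := List.mem_map.1 hp
  dsimp only
  omega

theorem sorted_factor {z : Equiv.Perm ℤ} {A w B : PWord} (h : A ++ w ++ B ∈ RinvPlus z)
    (hw : w.IsChain (· ≤ ·)) : w.Pairwise fun x y => x.ceil < y.ceil := by
  have hchain : w.IsChain fun x y => x.ceil < y.ceil := by
    induction w generalizing A with
    | nil => exact List.isChain_nil
    | cons x w ih =>
      cases w with
      | nil => exact List.isChain_singleton _
      | cons y w =>
        rw [List.isChain_cons_cons] at hw ⊢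
        refine ⟨lt_of_le_of_ne ?_ ?_, ih (A := A ++ [x]) (by simpa using h) hw.2⟩
        · rcases Letter.le_def.1 hw.1 with h1 | h1 <;> omega
        · exact (locCls_RinvPlus z).ne A x y (w ++ B) (by simpa using h)
  have : IsTrans Letter fun x y => x.ceil < y.ceil := ⟨fun _ _ _ => lt_trans⟩
  exact List.isChain_iff_pairwise.1 hchain

theorem labelWord_sorted {z : Equiv.Perm ℤ} {φ : ℕ → PWord} {N : ℕ}
    (hφ : ∀ n, (φ n).IsChain (· ≤ ·)) {B : PWord}
    (h : (labelWord φ N).map Prod.snd ++ B ∈ RinvPlus z) : (labelWord φ N).Pairwise LabelLT := by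
  induction N generalizing B with
  | zero => exact List.Pairwise.nil
  | succ N ih =>
    rw [labelWord_succ] at h ⊢
    rw [List.map_append, List.map_map] at h
    rw [List.pairwise_append]
    refine ⟨ih (by simpa using h), ?_, ?_⟩
    · rw [List.pairwise_map]
      have hs := sorted_factor (A := (labelWord φ N).map Prod.snd) (w := φ N) (B := B)
        (by simpa [Function.comp_def] using h) (hφ N)
      exact hs.imp fun hxy => Or.inr ⟨rfl, hxy⟩
    · intro p hp q hq
      obtain ⟨u, -, rfl⟩ := List.mem_map.1 hq
      have := labelWord_pos p hp
      exact Or.inl (by dsimp only; omega)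

theorem adm_labelWord {z : Equiv.Perm ℤ} {φ : ℕ → PWord} (h : φ ∈ IncrSeq z) :
    Adm z (labelWord φ (seqBound φ)) := by
  obtain ⟨hc, N, hN, hw⟩ := h
  obtain ⟨hle, hb⟩ := seqBound_spec hN
  rw [← labelWord_snd, labelWord_eq_of_le hb hle] at hw
  exact ⟨labelWord_sorted hc (B := []) (by simpa using hw), fun p hp => (labelWord_pos p hp).1, hw⟩

theorem labelWord_inj {φ ψ : ℕ → PWord} {M N : ℕ} (hφ : ∀ n, M ≤ n → φ n = [])
    (hψ : ∀ n, N ≤ n → ψ n = []) (h : labelWord φ M = labelWord ψ N) : φ = ψ := by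
  funext n
  have h1 := labelWord_eq_of_le hφ (Nat.le_add_right M (N + n + 1))
  have h2 := labelWord_eq_of_le hψ (Nat.le_add_left N (M + n + 1))
  rw [← labelWord_filter φ (n := n) (N := M + (N + n + 1)) (by omega),
    ← labelWord_filter ψ (n := n) (N := M + n + 1 + N) (by omega), h1, h2, h]

/-- The factors of a word of labelled letters. -/
def factors (β : List (ℤ × Letter)) (n : ℕ) : PWord :=
  (β.filter fun p => p.1 = (n + 1 : ℤ)).map Prod.snd

theorem sorted_split {β : List (ℤ × Letter)} (h : β.Pairwise LabelLT) (m : ℤ) :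
    β.filter (fun p => p.1 ≤ m) ++ β.filter (fun p => p.1 = m + 1) = β.filter fun p => p.1 ≤ m + 1 := by
  induction β with
  | nil => rfl
  | cons p β ih =>
    rw [List.pairwise_cons] at h
    have ih := ih h.2
    simp only [List.filter_cons]
    rcases lt_trichotomy p.1 (m + 1) with h1 | h1 | h1
    · have a : p.1 ≤ m := by omega
      have b : p.1 ≠ m + 1 := by omega
      have c : p.1 ≤ m + 1 := by omega
      simp [a, b, c, ← ih]
    · have hnil : β.filter (fun p => p.1 ≤ m) = [] := by
        rw [List.filter_eq_nil_iff]
        intro q hq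
        have := h.1 q hq
        unfold LabelLT at this
        simp
        omega
      rw [hnil, List.nil_append] at ih
      simp [h1, hnil, ← ih]
    · have a : ¬ p.1 ≤ m := by omega
      have b : p.1 ≠ m + 1 := by omega
      have c : ¬ p.1 ≤ m + 1 := by omega
      simp [a, b, c, ← ih]

theorem labelWord_factors {β : List (ℤ × Letter)} (h : β.Pairwise LabelLT) (hpos : ∀ p ∈ β, 0 < p.1)
    (N : ℕ) : labelWord (factors β) N = β.filter fun p => p.1 ≤ (N : ℤ) := by
  induction N with
  | zero =>
    symm
    rw [labelWord, List.range_zero, List.map_nil, List.flatten_nil, List.filter_eq_nil_iff]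
    intro p hp
    have := hpos p hp
    simp
    omega
  | succ N ih =>
    rw [labelWord_succ, ih, factors, List.map_map]
    have hself : (β.filter fun p => p.1 = (N + 1 : ℤ)).map ((fun u => ((N + 1 : ℤ), u)) ∘ Prod.snd) =
        β.filter fun p => p.1 = (N + 1 : ℤ) := by
      conv_rhs => rw [← List.map_id (β.filter fun p => p.1 = (N + 1 : ℤ))]
      refine List.map_congr_left fun p hp => ?_
      have := (List.mem_filter.1 hp).2
      simp only [decide_eq_true_eq] at this
      exact Prod.ext this.symm rfl
    rw [hself, sorted_split h]
    push_cast
    rfl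

theorem Adm.exists_seq {z : Equiv.Perm ℤ} {β : List (ℤ × Letter)} (h : Adm z β) :
    ∃ φ ∈ IncrSeq z, labelWord φ (seqBound φ) = β := by
  obtain ⟨N, hN⟩ : ∃ N : ℕ, ∀ p ∈ β, p.1 ≤ (N : ℤ) := by
    clear h
    induction β with
    | nil => exact ⟨0, by simp⟩
    | cons p β ih =>
      obtain ⟨N, hN⟩ := ih
      refine ⟨N + p.1.toNat, fun q hq => ?_⟩
      rcases List.mem_cons.1 hq with rfl | hq
      · omega
      · have := hN q hq
        omega
  have hempty : ∀ n, N ≤ n → factors β n = [] := by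
    intro n hn
    rw [factors, List.map_eq_nil_iff, List.filter_eq_nil_iff]
    intro p hp
    have := hN p hp
    simp
    omega
  have hlab : labelWord (factors β) N = β := by
    rw [labelWord_factors h.sorted h.pos, List.filter_eq_self]
    simpa using hN
  obtain ⟨hle, hb⟩ := seqBound_spec hempty
  refine ⟨factors β, ⟨fun n => ?_, N, hempty, ?_⟩, ?_⟩
  · refine List.Pairwise.isChain ?_
    rw [factors, List.pairwise_map]
    refine (h.sorted.filter _).imp_of_mem fun {p q} hp hq hpq => ?_
    have h1 := (List.mem_filter.1 hp).2
    have h2 := (List.mem_filter.1 hq).2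
    simp only [decide_eq_true_eq] at h1 h2
    unfold LabelLT at hpq
    exact Letter.le_def.2 (Or.inl (by omega))
  · rw [← labelWord_snd, hlab]
    exact h.word
  · rw [← labelWord_eq_of_le hb hle, hlab]

/-- Theorem 3.21: `φ ↦ (P_EGᴼ(φ), Q_EGᴼ(φ))` is a bijection from
`Incr_∞(R_inv⁺(z))` to pairs `(P, Q)` of shifted tableaux of the same shape with `P`
increasing, without primes on the main diagonal and with `row(P) ∈ R_inv⁺(z)`, and `Q`
semistandard. -/
theorem stmt8 (z : Equiv.Perm ℤ) (hz : IZ z) :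
    Set.BijOn (fun φ => (PEGseq φ, QEGseq φ)) (IncrSeq z)
      {PQ : STab × STab | shapeOf PQ.1 = shapeOf PQ.2 ∧
        IsShifted PQ.1 ∧ IsIncreasing PQ.1 ∧ NoDiagPrimes PQ.1 ∧
        rowWord PQ.1 ∈ RinvPlus z ∧ IsShifted PQ.2 ∧ IsSemistandard PQ.2} := by
  refine ⟨fun φ hφ => ?_, fun φ hφ ψ hψ h => ?_, fun PQ h => ?_⟩
  · have := (adm_labelWord hφ).tableauPair.1
    rw [tableauPair_labelWord] at this
    exact pairOK_iff.1 this
  · have hadm := adm_labelWord hφ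
    have hadm' := adm_labelWord hψ
    obtain ⟨-, M, hM, -⟩ := hφ
    obtain ⟨-, N, hN, -⟩ := hψ
    refine labelWord_inj (seqBound_spec hM).2 (seqBound_spec hN).2 (hadm.inj hadm' ?_)
    rw [tableauPair_labelWord, tableauPair_labelWord]
    exact h
  · obtain ⟨β, hβ, hPQ⟩ := (pairOK_iff.2 h).surj
    obtain ⟨φ, hφ, rfl⟩ := hβ.exists_seq
    rw [tableauPair_labelWord] at hPQ
    exact ⟨φ, hφ, hPQ⟩
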